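/- (C¹ stratification of the singular set.) Let u be a solution of the normalized obstacle problem on Ω and let m ∈ {0, 1, …, n−1}. Then the stratum Σ_m is locally contained in an m-dimensional manifold of class C¹: for every x0 ∈ Σ_m there exist an open neighborhood U of x0 and an m-dimensional embedded C¹ submanifold M of ℝⁿ such that Σ_m ∩ U ⊆ M. -/

import Mathlib

open MeasureTheory Filter Metric Set
open scoped NNReal ENNReal Topology

noncomputable section

/-- The (pointwise a.e. defined) Laplacian of a `C^{1,1}_loc` function, as the
trace of the derivative of the gradient. -/
def lapGrad {n : ℕ} (w : EuclideanSpace ℝ (Fin n) → ℝ)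
    (x : EuclideanSpace ℝ (Fin n)) : ℝ :=
  ∑ i : Fin n, fderiv ℝ (gradient w) x (EuclideanSpace.single i 1) i

/-- `u` is a solution of the normalized obstacle problem on `Ω`:
`u ∈ C^{1,1}_loc(Ω)`, `u ≥ 0`, and `Δu = χ_{{u>0}}` a.e. on `Ω`. -/
def IsObstacleSol {n : ℕ} (Ω : Set (EuclideanSpace ℝ (Fin n)))
    (u : EuclideanSpace ℝ (Fin n) → ℝ) : Prop :=
  (∀ x ∈ Ω, DifferentiableAt ℝ u x) ∧
  (∀ K : Set (EuclideanSpace ℝ (Fin n)), K ⊆ Ω → IsCompact K →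
    ∃ L : ℝ≥0, LipschitzOnWith L (gradient u) K) ∧
  (∀ x ∈ Ω, 0 ≤ u x) ∧
  (∀ᵐ x ∂(volume.restrict Ω), lapGrad u x = if 0 < u x then 1 else 0)

/-- The free boundary `∂{u > 0} ∩ Ω`. -/
def freeBoundary {n : ℕ} (Ω : Set (EuclideanSpace ℝ (Fin n)))
    (u : EuclideanSpace ℝ (Fin n) → ℝ) : Set (EuclideanSpace ℝ (Fin n)) :=
  frontier {x | x ∈ Ω ∧ 0 < u x} ∩ Ω

/-- The quadratic polynomial `p(x) = (1/2)⟨Ax, x⟩` associated with a matrix `A`. -/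
def quadForm {n : ℕ} (A : Matrix (Fin n) (Fin n) ℝ)
    (x : EuclideanSpace ℝ (Fin n)) : ℝ :=
  (1 / 2) * ∑ i, ∑ j, A i j * x i * x j

/-- `A` encodes an element of `𝒫`: a symmetric nonnegative-definite matrix of
trace `1`. -/
def MemP {n : ℕ} (A : Matrix (Fin n) (Fin n) ℝ) : Prop :=
  A.PosSemidef ∧ A.trace = 1

/-- `x0` is a singular free boundary point: along some sequence `r_k → 0⁺` the
rescalings `u(x0 + r_k x)/r_k²` converge locally uniformly to some `p ∈ 𝒫`. -/
def IsSingularPt {n : ℕ} (Ω : Set (EuclideanSpace ℝ (Fin n)))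
    (u : EuclideanSpace ℝ (Fin n) → ℝ) (x0 : EuclideanSpace ℝ (Fin n)) : Prop :=
  x0 ∈ freeBoundary Ω u ∧
  ∃ (r : ℕ → ℝ) (A : Matrix (Fin n) (Fin n) ℝ),
    (∀ k, 0 < r k) ∧ Tendsto r atTop (𝓝 0) ∧ MemP A ∧
    TendstoLocallyUniformly (fun k x => u (x0 + r k • x) / r k ^ 2)
      (quadForm A) atTop

/-- `p(x) = (1/2)⟨Ax, x⟩ ∈ 𝒫` is the (full) blow-up of `u` at `x0`:
`u(x0 + r x)/r² → p(x)` locally uniformly as `r → 0⁺`. -/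
def IsBlowup {n : ℕ} (u : EuclideanSpace ℝ (Fin n) → ℝ)
    (x0 : EuclideanSpace ℝ (Fin n)) (A : Matrix (Fin n) (Fin n) ℝ) : Prop :=
  MemP A ∧
  TendstoLocallyUniformly (fun (r : ℝ) x => u (x0 + r • x) / r ^ 2)
    (quadForm A) (𝓝[>] 0)

/-- The stratum `Σ_m` of the singular set: singular points whose (unique)
blow-up `p_{*,x0}(x) = (1/2)⟨A_{x0}x, x⟩` has `dim ker A_{x0} = m`. -/
def singularStratum {n : ℕ} (Ω : Set (EuclideanSpace ℝ (Fin n)))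
    (u : EuclideanSpace ℝ (Fin n) → ℝ) (m : ℕ) :
    Set (EuclideanSpace ℝ (Fin n)) :=
  {x0 | IsSingularPt Ω u x0 ∧ ∃ A : Matrix (Fin n) (Fin n) ℝ,
    IsBlowup u x0 A ∧
    Module.finrank ℝ (LinearMap.ker (Matrix.toLin' A)) = m}

/-- `M` is an `m`-dimensional embedded submanifold of `ℝⁿ` of class `C¹`:
locally around each of its points, `M` is the zero set of a `C¹` map into
`ℝ^{n-m}` with surjective differential along `M`. -/
def IsC1SubmanifoldOfDim {n : ℕ} (m : ℕ)
    (M : Set (EuclideanSpace ℝ (Fin n))) : Prop :=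
  ∀ y ∈ M, ∃ V : Set (EuclideanSpace ℝ (Fin n)), IsOpen V ∧ y ∈ V ∧
    ∃ F : EuclideanSpace ℝ (Fin n) → EuclideanSpace ℝ (Fin (n - m)),
      ContDiffOn ℝ 1 F V ∧
      M ∩ V = {z ∈ V | F z = 0} ∧
      ∀ z ∈ M ∩ V, Function.Surjective (fderiv ℝ F z)

set_option linter.all false


/-! ### Weights and integration by parts -/

/-- Divergence of a vector field. -/
def divg {n : ℕ} (g : EuclideanSpace ℝ (Fin n) → EuclideanSpace ℝ (Fin n))
    (x : EuclideanSpace ℝ (Fin n)) : ℝ :=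
  ∑ i : Fin n, fderiv ℝ g x (EuclideanSpace.single i 1) i

/-- Radial weights. -/
def wt {n : ℕ} (j : ℕ) (y : EuclideanSpace ℝ (Fin n)) : ℝ := (max (1 - ‖y‖ ^ 2) 0) ^ j

section weights
variable {n : ℕ}
local notation "E" => EuclideanSpace ℝ (Fin n)

lemma wt_nonneg (j : ℕ) (y : E) : 0 ≤ wt j y := by unfold wt; positivity

lemma wt_le_one (j : ℕ) (y : E) : wt j y ≤ 1 := by
  unfold wt
  apply pow_le_one₀ (by positivity)
  apply max_le _ zero_le_one
  nlinarith [sq_nonneg ‖y‖]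

lemma wt_eq_zero {j : ℕ} (hj : j ≠ 0) {y : E} (hy : 1 ≤ ‖y‖) : wt j y = 0 := by
  unfold wt
  rw [max_eq_right (by nlinarith), zero_pow hj]

lemma wt_one_of {y : E} (hy : ‖y‖ ≤ 1) : wt 1 y = 1 - ‖y‖ ^ 2 := by
  unfold wt
  rw [max_eq_left (by nlinarith [norm_nonneg y]), pow_one]

lemma wt_pos {j : ℕ} {y : E} (hy : ‖y‖ < 1) : 0 < wt j y := by
  unfold wt
  apply pow_pos
  apply lt_max_of_lt_left
  nlinarith [norm_nonneg y]

lemma wt_succ_eq {j : ℕ} (hj : j ≠ 0) (y : E) : wt (j + 1) y = (1 - ‖y‖ ^ 2) * wt j y := by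
  unfold wt
  rcases le_total (1 - ‖y‖ ^ 2) 0 with h | h
  · rw [max_eq_right h, zero_pow hj, zero_pow (by omega), mul_zero]
  · rw [max_eq_left h, pow_succ, mul_comm]

lemma wt_anti {i j : ℕ} (h : i ≤ j) (y : E) : wt j y ≤ wt i y := by
  unfold wt
  apply pow_le_pow_of_le_one (by positivity) _ h
  apply max_le _ zero_le_one
  nlinarith [sq_nonneg ‖y‖]

lemma wt_continuous (j : ℕ) : Continuous (wt j : E → ℝ) := by
  unfold wt; fun_prop

lemma wt_compact {j : ℕ} (hj : j ≠ 0) : HasCompactSupport (wt j : E → ℝ) := by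
  apply HasCompactSupport.intro (isCompact_closedBall (0 : E) 1)
  intro x hx
  apply wt_eq_zero hj
  simp at hx
  exact hx.le

lemma hasDerivAt_maxpow {j : ℕ} (hj : j ≠ 0) (t : ℝ) :
    HasDerivAt (fun s : ℝ => (max s 0) ^ (j + 1)) (((j : ℝ) + 1) * (max t 0) ^ j) t := by
  rcases lt_trichotomy t 0 with h | h | h
  · have : (fun s : ℝ => (max s 0) ^ (j + 1)) =ᶠ[𝓝 t] fun _ => 0 := by
      filter_upwards [Iio_mem_nhds h] with s hs
      rw [max_eq_right (le_of_lt hs), zero_pow (by omega)]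
    rw [max_eq_right h.le, zero_pow hj, mul_zero]
    exact (hasDerivAt_const t (0 : ℝ)).congr_of_eventuallyEq this
  · subst h
    have h1 : HasDerivWithinAt (fun s : ℝ => (max s 0) ^ (j + 1)) 0 (Iic 0) 0 := by
      apply (hasDerivWithinAt_const (0 : ℝ) (Iic 0) (0 : ℝ)).congr
      · intro s hs
        rw [max_eq_right hs, zero_pow (by omega)]
      · simp
    have h2 : HasDerivWithinAt (fun s : ℝ => (max s 0) ^ (j + 1)) 0 (Ici 0) 0 := by
      have := (hasDerivAt_pow (j + 1) (0 : ℝ)).hasDerivWithinAt (s := Ici 0)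
      have h3 : ((j + 1 : ℕ) : ℝ) * (0 : ℝ) ^ (j + 1 - 1) = 0 := by
        simp [hj]
      rw [h3] at this
      apply this.congr
      · intro s hs
        rw [max_eq_left hs]
      · simp
    have := h1.union h2
    rw [Iic_union_Ici, hasDerivWithinAt_univ] at this
    simpa [hj] using this
  · have : (fun s : ℝ => (max s 0) ^ (j + 1)) =ᶠ[𝓝 t] fun s => s ^ (j + 1) := by
      filter_upwards [Ioi_mem_nhds h] with s hs
      rw [max_eq_left (le_of_lt hs)]
    rw [max_eq_left h.le]
    have := (hasDerivAt_pow (j + 1) t).congr_of_eventuallyEq this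
    simpa using this

lemma hasGrad_iff {f : E → ℝ} {g x : E} :
    HasGradientAt f g x ↔ HasFDerivAt f (innerSL ℝ g) x := by
  rw [hasGradientAt_iff_hasFDerivAt]
  exact Iff.rfl

lemma hasGrad_mul {f g : E → ℝ} {f' g' x : E} (hf : HasGradientAt f f' x)
    (hg : HasGradientAt g g' x) :
    HasGradientAt (fun y => f y * g y) (f x • g' + g x • f') x := by
  rw [hasGrad_iff] at *
  have := hf.mul hg
  refine this.congr_fderiv ?_
  ext v
  simp [inner_add_left, inner_smul_left]

lemma hasGrad_sub {f g : E → ℝ} {f' g' x : E} (hf : HasGradientAt f f' x)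
    (hg : HasGradientAt g g' x) :
    HasGradientAt (fun y => f y - g y) (f' - g') x := by
  rw [hasGrad_iff] at *
  refine (hf.sub hg).congr_fderiv ?_
  ext v
  simp [inner_sub_left]

lemma hasGrad_add {f g : E → ℝ} {f' g' x : E} (hf : HasGradientAt f f' x)
    (hg : HasGradientAt g g' x) :
    HasGradientAt (fun y => f y + g y) (f' + g') x := by
  rw [hasGrad_iff] at *
  refine (hf.add hg).congr_fderiv ?_
  ext v
  simp [inner_add_left]

lemma wt_hasGrad {j : ℕ} (hj : j ≠ 0) (y : E) :
    HasGradientAt (wt (j + 1) : E → ℝ) ((-(2 * ((j : ℝ) + 1)) * wt j y) • y) y := by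
  rw [hasGrad_iff]
  have h1 : HasFDerivAt (fun z : E => 1 - ‖z‖ ^ 2) (-(2 • innerSL ℝ y)) y := by
    have := (hasStrictFDerivAt_norm_sq y).hasFDerivAt
    exact this.const_sub 1
  have := (hasDerivAt_maxpow hj (1 - ‖y‖ ^ 2)).comp_hasFDerivAt y h1
  refine this.congr_fderiv ?_
  ext v
  simp [inner_smul_left, wt]
  ring

lemma contDiff_of_grad {f : E → ℝ} {g : E → E} (h : ∀ x, HasGradientAt f (g x) x)
    (hg : Continuous g) : ContDiff ℝ 1 f := by
  rw [contDiff_one_iff_fderiv]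
  refine ⟨fun x => (h x).differentiableAt, ?_⟩
  have : fderiv ℝ f = fun x => innerSL ℝ (g x) := by
    ext1 x
    exact (hasGrad_iff.1 (h x)).fderiv
  rw [this]
  fun_prop

lemma integrable_mul_wt {f : E → ℝ} (hf : Continuous f) {j : ℕ} (hj : j ≠ 0) :
    Integrable (fun y => f y * wt j y) :=
  (hf.mul (wt_continuous j)).integrable_of_hasCompactSupport ((wt_compact hj).mul_left)

/-- Integration by parts, global Lipschitz version. -/
lemma ibp_global {L : ℝ≥0} {g : E → E} (hg : LipschitzWith L g) {v : E → ℝ} {v' : E → E}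
    (hv : ∀ x, HasGradientAt v (v' x) x) (hv' : Continuous v') {j : ℕ} (hj : j ≠ 0) :
    ∫ y, v y * divg g y * wt (j + 1) y =
      - (∫ y, inner ℝ (v' y) (g y) * wt (j + 1) y)
      + 2 * ((j : ℝ) + 1) * ∫ y, v y * inner ℝ y (g y) * wt j y := by
  have hvc : Continuous v := (contDiff_of_grad hv hv').continuous
  have hgc : Continuous g := hg.continuous
  set G : E → ℝ := fun y => v y * wt (j + 1) y with hG
  have hGgrad : ∀ y, HasGradientAt G
      (v y • ((-(2 * ((j : ℝ) + 1)) * wt j y) • y) + wt (j + 1) y • v' y) y :=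
    fun y => hasGrad_mul (hv y) (wt_hasGrad hj y)
  have hGc1 : ContDiff ℝ 1 G := by
    refine contDiff_of_grad hGgrad ?_
    have := wt_continuous (n := n) j
    have := wt_continuous (n := n) (j + 1)
    fun_prop
  have hGs : HasCompactSupport G := (wt_compact (by omega)).mul_left
  obtain ⟨D, hD⟩ := ContDiff.lipschitzWith_of_hasCompactSupport hGs hGc1 (by simp)
  have hd := hg.ae_differentiableAt (μ := (volume : Measure E))
  have key : ∀ i : Fin n,
      ∫ y, fderiv ℝ g y (EuclideanSpace.single i 1) i * G y =
      ∫ y, (-(v' y i * g y i * wt (j + 1) y) +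
        2 * ((j : ℝ) + 1) * (v y * (y i * g y i) * wt j y)) := by
    intro i
    have hgi : LipschitzWith L (fun y => g y i) := by
      apply LipschitzWith.of_dist_le_mul
      intro x y
      calc dist (g x i) (g y i) ≤ dist (g x) (g y) := by
            rw [dist_eq_norm, dist_eq_norm, ← PiLp.sub_apply]
            exact PiLp.norm_apply_le _ i
        _ ≤ _ := hg.dist_le_mul x y
    have h1 := hgi.integral_lineDeriv_mul_eq (μ := (volume : Measure E)) hD hGs
      (EuclideanSpace.single i 1)
    have h2 : ∫ y, lineDeriv ℝ (fun y => g y i) y (EuclideanSpace.single i 1) * G y =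
        ∫ y, fderiv ℝ g y (EuclideanSpace.single i 1) i * G y := by
      apply integral_congr_ae
      filter_upwards [hd] with y hy
      have h3 : HasFDerivAt (fun y => g y i)
        ((EuclideanSpace.proj i : E →L[ℝ] ℝ).comp (fderiv ℝ g y)) y :=
        (EuclideanSpace.proj i : E →L[ℝ] ℝ).hasFDerivAt.comp y hy.hasFDerivAt
      rw [h3.differentiableAt.lineDeriv_eq_fderiv, h3.fderiv]
      simp
    rw [← h2, h1]
    apply integral_congr_ae
    filter_upwards with y
    rw [(hGgrad y).differentiableAt.lineDeriv_eq_fderiv, (hasGrad_iff.1 (hGgrad y)).fderiv]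
    simp [inner_add_left, inner_smul_left, EuclideanSpace.inner_single_right]
    ring
  have hintg : ∀ i : Fin n, Integrable
      (fun y => fderiv ℝ g y (EuclideanSpace.single i 1) i * G y) := by
    intro i
    apply Integrable.bdd_mul (c := L) (hGc1.continuous.integrable_of_hasCompactSupport hGs)
    · have h1 : Measurable fun y : E => fderiv ℝ g y (EuclideanSpace.single i 1) :=
        measurable_fderiv_apply_const ℝ g _
      exact ((EuclideanSpace.proj i : E →L[ℝ] ℝ).continuous.measurable.comp h1).aestronglyMeasurable
    · filter_upwards with y
      calc ‖fderiv ℝ g y (EuclideanSpace.single i 1) i‖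
          ≤ ‖fderiv ℝ g y (EuclideanSpace.single i 1)‖ := PiLp.norm_apply_le _ i
        _ ≤ ‖fderiv ℝ g y‖ * ‖(EuclideanSpace.single i 1 : E)‖ := ContinuousLinearMap.le_opNorm _ _
        _ ≤ L := by
          simpa using norm_fderiv_le_of_lipschitz ℝ hg
  have e1 : ∀ y, v y * divg g y * wt (j + 1) y =
      ∑ i, fderiv ℝ g y (EuclideanSpace.single i 1) i * G y := by
    intro y
    rw [← Finset.sum_mul]
    simp only [divg, hG]
    ring
  simp_rw [e1]
  rw [integral_finsetSum _ (fun i _ => hintg i)]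
  simp_rw [key]
  have c1 := wt_continuous (n := n) j
  rw [← integral_finsetSum]
  · rw [← integral_neg, ← integral_const_mul, ← integral_add]
    · apply integral_congr_ae
      filter_upwards with y
      simp only [PiLp.inner_apply, Finset.sum_add_distrib, RCLike.inner_apply, conj_trivial]
      rw [Finset.sum_neg_distrib, ← Finset.mul_sum, ← Finset.sum_mul, ← Finset.sum_mul,
        ← Finset.mul_sum]
      simp_rw [mul_comm]
    · exact (integrable_mul_wt (by fun_prop) (by omega)).neg
    · exact (integrable_mul_wt (by fun_prop) hj).const_mul _
  · intro i _
    apply Integrable.add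
    · exact (integrable_mul_wt (by fun_prop) (by omega)).neg
    · exact (integrable_mul_wt (by fun_prop) hj).const_mul _

/-- Integration by parts, for a vector field Lipschitz on a ball. -/
lemma ibp {L : ℝ≥0} {g : E → E} (hg : LipschitzOnWith L g (closedBall 0 2)) {v : E → ℝ} {v' : E → E}
    (hv : ∀ x, HasGradientAt v (v' x) x) (hv' : Continuous v') {j : ℕ} (hj : j ≠ 0) :
    ∫ y, v y * divg g y * wt (j + 1) y =
      - (∫ y, inner ℝ (v' y) (g y) * wt (j + 1) y)
      + 2 * ((j : ℝ) + 1) * ∫ y, v y * inner ℝ y (g y) * wt j y := by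
  obtain ⟨h, hh, hgh⟩ := hg.extend_finite_dimension
  have := ibp_global hh hv hv' hj
  have out : ∀ y : E, ¬ ‖y‖ < 1 → ∀ k : ℕ, k ≠ 0 → wt k y = 0 :=
    fun y hy k hk => wt_eq_zero hk (not_lt.1 hy)
  have ineq : ∀ y : E, ‖y‖ < 1 → g =ᶠ[𝓝 y] h := by
    intro y hy
    have : ball (0 : E) 2 ∈ 𝓝 y := isOpen_ball.mem_nhds (by simp; linarith)
    filter_upwards [this] with z hz
    exact hgh (ball_subset_closedBall hz)
  convert this using 1
  · congr 1; ext y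
    by_cases hy : ‖y‖ < 1
    · simp only [divg]
      rw [(ineq y hy).fderiv_eq]
    · rw [out y hy _ (by omega)]; simp
  · congr 2
    · congr 1; ext y
      by_cases hy : ‖y‖ < 1
      · rw [(ineq y hy).eq_of_nhds]
      · rw [out y hy _ (by omega)]; simp
    · congr 1; ext y
      by_cases hy : ‖y‖ < 1
      · rw [(ineq y hy).eq_of_nhds]
      · rw [out y hy _ (by omega)]; simp

end weights


/-! ### Quadratic forms and the Weiss / Monneau functionals -/

/-- The continuous linear map attached to a matrix. -/
def aop {n : ℕ} (A : Matrix (Fin n) (Fin n) ℝ) :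
    EuclideanSpace ℝ (Fin n) →L[ℝ] EuclideanSpace ℝ (Fin n) :=
  LinearMap.toContinuousLinearMap (Matrix.toEuclideanLin A)

/-- The bilinear Weiss form. -/
def bform {n : ℕ} (v : EuclideanSpace ℝ (Fin n) → ℝ)
    (v' : EuclideanSpace ℝ (Fin n) → EuclideanSpace ℝ (Fin n))
    (f : EuclideanSpace ℝ (Fin n) → ℝ)
    (f' : EuclideanSpace ℝ (Fin n) → EuclideanSpace ℝ (Fin n)) : ℝ :=
  (∫ y, inner ℝ (v' y) (f' y) * wt 2 y) - 8 * ∫ y, v y * f y * wt 1 y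

/-- A normalized global `C^{1,1}` function solving the obstacle problem in the unit ball. -/
structure Good {n : ℕ} (L : ℝ≥0) (U : EuclideanSpace ℝ (Fin n) → ℝ)
    (U' : EuclideanSpace ℝ (Fin n) → EuclideanSpace ℝ (Fin n)) : Prop where
  grad : ∀ x, HasGradientAt U (U' x) x
  lip : LipschitzWith L U'
  nonneg : ∀ x, 0 ≤ U x
  zero : U 0 = 0
  eqn : ∀ᵐ y : EuclideanSpace ℝ (Fin n), ‖y‖ < 1 → divg U' y = if 0 < U y then 1 else 0

/-- indicator of the contact set -/
def cind {n : ℕ} (U : EuclideanSpace ℝ (Fin n) → ℝ) (y : EuclideanSpace ℝ (Fin n)) : ℝ :=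
  if 0 < U y then 0 else 1

/-- The radial deviation from 2-homogeneity. -/
def ndev {n : ℕ} (U : EuclideanSpace ℝ (Fin n) → ℝ)
    (U' : EuclideanSpace ℝ (Fin n) → EuclideanSpace ℝ (Fin n))
    (y : EuclideanSpace ℝ (Fin n)) : ℝ := inner ℝ y (U' y) - 2 * U y

/-- Weiss functional -/
def gfun {n : ℕ} (U : EuclideanSpace ℝ (Fin n) → ℝ)
    (U' : EuclideanSpace ℝ (Fin n) → EuclideanSpace ℝ (Fin n)) (A : Matrix (Fin n) (Fin n) ℝ) : ℝ :=
  bform (fun y => U y - quadForm A y) (fun y => U' y - aop A y)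
    (fun y => U y - quadForm A y) (fun y => U' y - aop A y)

/-- Monneau functional -/
def hfun {n : ℕ} (U : EuclideanSpace ℝ (Fin n) → ℝ) (A : Matrix (Fin n) (Fin n) ℝ) : ℝ :=
  ∫ y, (U y - quadForm A y) ^ 2 * wt 1 y

section forms
variable {n : ℕ}
local notation "E" => EuclideanSpace ℝ (Fin n)

lemma aop_apply (A : Matrix (Fin n) (Fin n) ℝ) (y : E) (i : Fin n) :
    aop A y i = ∑ j, A i j * y j := by
  simp [aop, Matrix.toLpLin_apply, Matrix.mulVec, dotProduct]

lemma quadForm_eq (A : Matrix (Fin n) (Fin n) ℝ) (y : E) :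
    quadForm A y = (1 / 2) * inner ℝ y (aop A y) := by
  unfold quadForm
  congr 1
  simp only [PiLp.inner_apply, aop_apply, RCLike.inner_apply, conj_trivial]
  apply Finset.sum_congr rfl
  intro i _
  rw [Finset.sum_mul]
  apply Finset.sum_congr rfl
  intros; ring

lemma aop_symm {A : Matrix (Fin n) (Fin n) ℝ} (hA : A.IsSymm) (x y : E) :
    inner ℝ x (aop A y) = inner ℝ (aop A x) y := by
  simp only [PiLp.inner_apply, aop_apply, RCLike.inner_apply, conj_trivial, Finset.mul_sum,
    Finset.sum_mul]
  rw [Finset.sum_comm]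
  apply Finset.sum_congr rfl
  intro i _
  apply Finset.sum_congr rfl
  intro j _
  rw [hA.apply i j]
  ring

lemma quadForm_grad {A : Matrix (Fin n) (Fin n) ℝ} (hA : A.IsSymm) (y : E) :
    HasGradientAt (quadForm A) (aop A y) y := by
  rw [hasGrad_iff]
  have h1 : HasFDerivAt (fun z : E => inner ℝ z (aop A z)) _ y :=
    HasFDerivAt.inner ℝ (hasFDerivAt_id y) (aop A).hasFDerivAt
  have h2 := h1.const_mul (1 / 2 : ℝ)
  have e : quadForm A = fun z : E => (1 / 2 : ℝ) * inner ℝ z (aop A z) := by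
    ext z; exact quadForm_eq A z
  rw [e]
  refine h2.congr_fderiv ?_
  ext v
  simp
  rw [aop_symm hA, real_inner_comm (aop A y) v]
  ring

lemma divg_aop (A : Matrix (Fin n) (Fin n) ℝ) (y : E) : divg (aop A) y = A.trace := by
  unfold divg
  rw [ContinuousLinearMap.fderiv]
  simp [aop_apply, Matrix.trace]

lemma aop_lip (A : Matrix (Fin n) (Fin n) ℝ) : LipschitzWith ‖aop A‖₊ (aop A) :=
  (aop A).lipschitz

lemma ndev_quad {A : Matrix (Fin n) (Fin n) ℝ} (y : E) : ndev (quadForm A) (aop A) y = 0 := by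
  unfold ndev
  rw [quadForm_eq]
  ring

lemma quadForm_continuous (A : Matrix (Fin n) (Fin n) ℝ) : Continuous (quadForm A : E → ℝ) := by
  unfold quadForm
  fun_prop

lemma aop_sub (A B : Matrix (Fin n) (Fin n) ℝ) (y : E) : aop (A - B) y = aop A y - aop B y := by
  simp [aop]

lemma quadForm_sub (A B : Matrix (Fin n) (Fin n) ℝ) (y : E) :
    quadForm (A - B) y = quadForm A y - quadForm B y := by
  simp only [quadForm_eq, aop_sub, inner_sub_right]
  ring

lemma aop_norm_le (A : Matrix (Fin n) (Fin n) ℝ) {y : E} (hy : ‖y‖ ≤ 1) : ‖aop A y‖ ≤ ‖aop A‖ :=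
  (aop A).unit_le_opNorm y hy

lemma quadForm_abs_le (A : Matrix (Fin n) (Fin n) ℝ) {y : E} (hy : ‖y‖ ≤ 1) :
    |quadForm A y| ≤ ‖aop A‖ := by
  rw [quadForm_eq, abs_mul]
  have h1 := abs_real_inner_le_norm y (aop A y)
  have h2 := aop_norm_le A hy
  have h3 : ‖y‖ * ‖aop A y‖ ≤ 1 * ‖aop A‖ := by gcongr
  rw [abs_of_pos (by norm_num : (0:ℝ) < 1 / 2)]
  have := norm_nonneg (aop A)
  linarith

lemma quadForm_nonneg {A : Matrix (Fin n) (Fin n) ℝ} (hA : A.PosSemidef) (y : E) :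
    0 ≤ quadForm A y := by
  have h := hA.dotProduct_mulVec_nonneg (fun i => y i)
  simp only [dotProduct, Matrix.mulVec, star_trivial] at h
  unfold quadForm
  have : ∑ i, ∑ j, A i j * y i * y j = ∑ x, y x * ∑ x_1, A x x_1 * y x_1 := by
    apply Finset.sum_congr rfl
    intro i _
    rw [Finset.mul_sum]
    apply Finset.sum_congr rfl
    intros; ring
  rw [this]
  linarith

lemma MemP.symm {A : Matrix (Fin n) (Fin n) ℝ} (hA : MemP A) : A.IsSymm := by
  have := hA.1.isHermitian
  rwa [Matrix.IsHermitian, Matrix.conjTranspose_eq_transpose_of_trivial] at this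

/-- the form through integration by parts -/
lemma bform_eq {v : E → ℝ} {v' : E → E} (hv : ∀ x, HasGradientAt v (v' x) x) (hv' : Continuous v')
    {L : ℝ≥0} {f : E → ℝ} {f' : E → E} (hf : LipschitzWith L f') (hfc : Continuous f) :
    bform v v' f f' = - (∫ y, v y * divg f' y * wt 2 y) + 4 * ∫ y, v y * ndev f f' y * wt 1 y := by
  have h := ibp (hf.lipschitzOnWith (s := closedBall 0 2)) hv hv' one_ne_zero
  norm_num at h
  rw [h]
  have hvc : Continuous v := (contDiff_of_grad hv hv').continuous
  have hf'c := hf.continuous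
  have e : ∫ y, v y * ndev f f' y * wt 1 y =
      (∫ y, v y * inner ℝ y (f' y) * wt 1 y) - 2 * ∫ y, v y * f y * wt 1 y := by
    rw [← integral_const_mul, ← integral_sub]
    · congr 1; ext y; unfold ndev; ring
    · exact integrable_mul_wt (by fun_prop) one_ne_zero
    · exact (integrable_mul_wt (by fun_prop) one_ne_zero).const_mul _
  rw [e]
  unfold bform
  ring

lemma bform_comm (v : E → ℝ) (v' : E → E) (f : E → ℝ) (f' : E → E) :
    bform v v' f f' = bform f f' v v' := by
  unfold bform
  congr 2
  · ext y; rw [real_inner_comm]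
  · congr 1; ext y; ring

lemma bform_add {v v2 f : E → ℝ} {v' v2' f' : E → E} (hv : Continuous v) (hv2 : Continuous v2)
    (hf : Continuous f) (hv' : Continuous v') (hv2' : Continuous v2') (hf' : Continuous f') :
    bform (fun y => v y + v2 y) (fun y => v' y + v2' y) f f' =
      bform v v' f f' + bform v2 v2' f f' := by
  unfold bform
  have e1 : ∫ y, inner ℝ (v' y + v2' y) (f' y) * wt 2 y =
      (∫ y, inner ℝ (v' y) (f' y) * wt 2 y) + ∫ y, inner ℝ (v2' y) (f' y) * wt 2 y := by
    rw [← integral_add]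
    · congr 1; ext y; rw [inner_add_left]; ring
    · exact integrable_mul_wt (by fun_prop) two_ne_zero
    · exact integrable_mul_wt (by fun_prop) two_ne_zero
  have e2 : ∫ y, (v y + v2 y) * f y * wt 1 y =
      (∫ y, v y * f y * wt 1 y) + ∫ y, v2 y * f y * wt 1 y := by
    rw [← integral_add]
    · congr 1; ext y; ring
    · exact integrable_mul_wt (by fun_prop) one_ne_zero
    · exact integrable_mul_wt (by fun_prop) one_ne_zero
  rw [e1, e2]; ring

lemma bform_harm {v : E → ℝ} {v' : E → E} (hv : ∀ x, HasGradientAt v (v' x) x) (hv' : Continuous v')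
    {A : Matrix (Fin n) (Fin n) ℝ} (htr : A.trace = 0) :
    bform v v' (quadForm A) (aop A) = 0 := by
  rw [bform_eq hv hv' (aop_lip A) (quadForm_continuous A)]
  simp [divg_aop, htr, ndev_quad]

/-- second-order Taylor -/
lemma taylor2 {L : ℝ≥0} {f : E → ℝ} {g : E → E} (hf : ∀ x, HasGradientAt f (g x) x)
    (hg : LipschitzWith L g) (y z : E) :
    |f z - f y - inner ℝ (g y) (z - y)| ≤ L * ‖z - y‖ ^ 2 := by
  have h := (convex_closedBall y ‖z - y‖).norm_image_sub_le_of_norm_hasFDerivWithin_le'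
    (f := f) (f' := fun x => innerSL ℝ (g x)) (φ := innerSL ℝ (g y)) (C := L * ‖z - y‖)
    (x := y) (y := z)
    (fun x _ => (hasGrad_iff.1 (hf x)).hasFDerivWithinAt)
    (fun x hx => by
      rw [← map_sub, innerSL_apply_norm]
      calc ‖g x - g y‖ ≤ L * ‖x - y‖ := by
            have := hg.dist_le_mul x y
            rwa [dist_eq_norm, dist_eq_norm] at this
        _ ≤ _ := by
            gcongr
            simpa [dist_eq_norm] using hx)
    (by simp) (by simp [dist_eq_norm])
  rw [Real.norm_eq_abs] at h
  simp only [innerSL_apply_apply] at h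
  nlinarith [h]

namespace Good
variable {L : ℝ≥0} {U : EuclideanSpace ℝ (Fin n) → ℝ}
  {U' : EuclideanSpace ℝ (Fin n) → EuclideanSpace ℝ (Fin n)}

lemma cont (h : Good L U U') : Continuous U := (contDiff_of_grad h.grad h.lip.continuous).continuous

lemma grad_zero (h : Good L U U') {y : E} (hy : U y = 0) : U' y = 0 := by
  have h1 : IsLocalMin U y := by
    filter_upwards with z
    rw [hy]; exact h.nonneg z
  have h2 := h1.hasFDerivAt_eq_zero (hasGrad_iff.1 (h.grad y))
  rw [← norm_eq_zero, ← innerSL_apply_norm ℝ (U' y), h2, norm_zero]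

lemma grad_le (h : Good L U U') (y : E) : ‖U' y‖ ≤ L * ‖y‖ := by
  have := h.lip.dist_le_mul y 0
  rwa [h.grad_zero h.zero, dist_zero_right, dist_zero_right] at this

lemma abs_le (h : Good L U U') (y : E) : |U y| ≤ L * ‖y‖ ^ 2 := by
  have := taylor2 h.grad h.lip 0 y
  rw [h.grad_zero h.zero, h.zero] at this
  simpa using this

lemma divg_sub (h : Good L U U') {A : Matrix (Fin n) (Fin n) ℝ} (hA : A.trace = 1) :
    ∀ᵐ y : E, ‖y‖ < 1 → divg (fun y => U' y - aop A y) y = - cind U y := by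
  filter_upwards [h.eqn, h.lip.ae_differentiableAt (μ := (volume : Measure E))] with y hy hd h1
  have e : divg (fun y => U' y - aop A y) y = divg U' y - divg (aop A) y := by
    unfold divg
    rw [fderiv_fun_sub hd (aop A).differentiableAt, ← Finset.sum_sub_distrib]
    simp
  rw [e, hy h1, divg_aop, hA]
  unfold cind
  split_ifs <;> norm_num

lemma sub_grad (h : Good L U U') {A : Matrix (Fin n) (Fin n) ℝ} (hA : A.IsSymm) (x : E) :
    HasGradientAt (fun y => U y - quadForm A y) (U' x - aop A x) x :=
  hasGrad_sub (h.grad x) (quadForm_grad hA x)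

lemma sub_lip (h : Good L U U') (A : Matrix (Fin n) (Fin n) ℝ) :
    LipschitzWith (L + ‖aop A‖₊) (fun y => U' y - aop A y) := h.lip.sub (aop_lip A)

lemma ndev_sub (U : E → ℝ) (U' : E → E) (A : Matrix (Fin n) (Fin n) ℝ) (y : E) :
    ndev (fun y => U y - quadForm A y) (fun y => U' y - aop A y) y = ndev U U' y := by
  have := ndev_quad (A := A) y
  unfold ndev at *
  rw [inner_sub_right]
  linarith

/-- The key identity. -/
lemma bform_sub (h : Good L U U') {A : Matrix (Fin n) (Fin n) ℝ} (hA : A.trace = 1)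
    {v : E → ℝ} {v' : E → E} (hv : ∀ x, HasGradientAt v (v' x) x) (hv' : Continuous v') :
    bform v v' (fun y => U y - quadForm A y) (fun y => U' y - aop A y) =
      (∫ y, v y * cind U y * wt 2 y) + 4 * ∫ y, v y * ndev U U' y * wt 1 y := by
  rw [bform_eq (f := fun y => U y - quadForm A y) hv hv' (h.sub_lip A)
    (h.cont.sub (quadForm_continuous A)), ← integral_neg]
  simp_rw [ndev_sub]
  congr 1
  apply integral_congr_ae
  filter_upwards [h.divg_sub hA] with y hy
  by_cases h1 : ‖y‖ < 1
  · rw [hy h1]; ring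
  · rw [wt_eq_zero two_ne_zero (not_lt.1 h1)]; simp

end Good

lemma cind_nonneg (U : E → ℝ) (y : E) : 0 ≤ cind U y := by unfold cind; split_ifs <;> norm_num
lemma cind_le_one (U : E → ℝ) (y : E) : cind U y ≤ 1 := by unfold cind; split_ifs <;> norm_num

lemma cind_meas {U : E → ℝ} (hU : Continuous U) : Measurable (cind U) := by
  unfold cind
  exact Measurable.ite (measurableSet_lt measurable_const hU.measurable) measurable_const
    measurable_const

lemma integrable_cind {U v : E → ℝ} (hU : Continuous U) (hv : Continuous v) {j : ℕ} (hj : j ≠ 0) :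
    Integrable (fun y => v y * cind U y * wt j y) := by
  have h := (integrable_mul_wt hv hj).bdd_mul (c := 1) (f := cind U)
    (cind_meas hU).aestronglyMeasurable
    (by filter_upwards with y
        rw [Real.norm_eq_abs, abs_of_nonneg (cind_nonneg U y)]
        exact cind_le_one U y)
  refine h.congr ?_
  filter_upwards with y
  ring

/-- `gfun` does not depend on the matrix. -/
lemma gfun_indep {L : ℝ≥0} {U : E → ℝ} {U' : E → E} (h : Good L U U')
    {A B : Matrix (Fin n) (Fin n) ℝ} (hA : A.IsSymm) (hB : B.IsSymm) (hAt : A.trace = 1)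
    (hBt : B.trace = 1) : gfun U U' A = gfun U U' B := by
  have hS : (A - B).IsSymm := hA.sub hB
  have ht : (A - B).trace = 0 := by rw [Matrix.trace_sub, hAt, hBt, sub_self]
  have c1 := h.cont
  have c2 := h.lip.continuous
  have c3 := quadForm_continuous A
  have c4 := quadForm_continuous (A - B)
  have e1 : (fun y => U y - quadForm B y) =
      fun y => (U y - quadForm A y) + quadForm (A - B) y := by
    ext y; rw [quadForm_sub]; ring
  have e2 : (fun y => U' y - aop B y) = fun y => (U' y - aop A y) + aop (A - B) y := by
    ext1 y; rw [aop_sub]; abel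
  have z1 := bform_harm (h.sub_grad hA) (h.sub_lip A).continuous ht
  have z2 := bform_harm (quadForm_grad hS) (aop (A - B)).continuous ht
  have c5 : Continuous fun y => U y - quadForm A y := by fun_prop
  have c6 : Continuous fun y => U' y - aop A y := by fun_prop
  have c7 := (aop (A - B)).continuous
  have r1 := bform_add (f := fun y => U y - quadForm A y + quadForm (A - B) y)
    (f' := fun y => U' y - aop A y + aop (A - B) y) c5 c4 (c5.add c4) c6 c7 (c6.add c7)
  have y1 := bform_comm (fun y => U y - quadForm A y) (fun y => U' y - aop A y)
    (fun y => U y - quadForm A y + quadForm (A - B) y) (fun y => U' y - aop A y + aop (A - B) y)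
  have y2 := bform_comm (quadForm (A - B)) (aop (A - B))
    (fun y => U y - quadForm A y + quadForm (A - B) y) (fun y => U' y - aop A y + aop (A - B) y)
  have r2 := bform_add c5 c4 c5 c6 c7 c6
  have r3 := bform_add c5 c4 c4 c6 c7 c7
  have z3 := bform_comm (quadForm (A - B)) (aop (A - B)) (fun y => U y - quadForm A y)
    (fun y => U' y - aop A y)
  unfold gfun
  rw [e1, e2, r1, y1, y2, r2, r3, z3, z1, z2]
  ring

lemma gfun_ge {U : E → ℝ} {U' : E → E} {A : Matrix (Fin n) (Fin n) ℝ} :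
    - 8 * hfun U A ≤ gfun U U' A := by
  unfold gfun bform hfun
  have h1 : 0 ≤ ∫ y, inner ℝ (U' y - aop A y) (U' y - aop A y) * wt 2 y :=
    integral_nonneg fun y => mul_nonneg real_inner_self_nonneg (wt_nonneg _ _)
  have h2 : ∫ y, (U y - quadForm A y) * (U y - quadForm A y) * wt 1 y =
    ∫ y, (U y - quadForm A y) ^ 2 * wt 1 y := by
    congr 1; ext y; ring
  rw [h2]
  linarith

end forms


/-! ### Almost monotonicity: one step -/

/-- the square deviation -/
def nsq {n : ℕ} (U : EuclideanSpace ℝ (Fin n) → ℝ)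
    (U' : EuclideanSpace ℝ (Fin n) → EuclideanSpace ℝ (Fin n)) : ℝ :=
  ∫ y, (ndev U U' y) ^ 2 * wt 1 y

/-- the contact term -/
def qcon {n : ℕ} (U : EuclideanSpace ℝ (Fin n) → ℝ) (A : Matrix (Fin n) (Fin n) ℝ) : ℝ :=
  ∫ y, quadForm A y * cind U y * wt 2 y

/-- volume constant -/
def wvol (n : ℕ) : ℝ := ∫ y : EuclideanSpace ℝ (Fin n), wt 1 y

section step
variable {n : ℕ}
local notation "E" => EuclideanSpace ℝ (Fin n)

lemma nsq_nonneg (U : E → ℝ) (U' : E → E) : 0 ≤ nsq U U' :=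
  integral_nonneg fun y => mul_nonneg (sq_nonneg _) (wt_nonneg _ _)

lemma hfun_nonneg (U : E → ℝ) (A : Matrix (Fin n) (Fin n) ℝ) : 0 ≤ hfun U A :=
  integral_nonneg fun y => mul_nonneg (sq_nonneg _) (wt_nonneg _ _)

lemma qcon_nonneg (U : E → ℝ) {A : Matrix (Fin n) (Fin n) ℝ} (hA : A.PosSemidef) : 0 ≤ qcon U A :=
  integral_nonneg fun y => mul_nonneg (mul_nonneg (quadForm_nonneg hA y) (cind_nonneg _ _))
    (wt_nonneg _ _)

lemma wvol_nonneg (n : ℕ) : 0 ≤ wvol n := integral_nonneg fun y => wt_nonneg _ _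

lemma integrable_wt {j : ℕ} (hj : j ≠ 0) : Integrable (wt j : E → ℝ) := by
  simpa using integrable_mul_wt (continuous_const (y := (1:ℝ)) (X := E)) hj

lemma integral_wt_le {j : ℕ} (hj : j ≠ 0) : ∫ y : E, wt j y ≤ wvol n :=
  integral_mono (integrable_wt hj) (integrable_wt one_ne_zero) fun y => wt_anti (by omega) y

lemma ndev_continuous {U : E → ℝ} {U' : E → E} (hU : Continuous U) (hU' : Continuous U') :
    Continuous (ndev U U') := by
  unfold ndev; fun_prop

lemma Good.ndev_abs_le {L : ℝ≥0} {U : E → ℝ} {U' : E → E} (h : Good L U U') {y : E}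
    (hy : ‖y‖ ≤ 1) : |ndev U U' y| ≤ 3 * L := by
  unfold ndev
  have h1 := abs_real_inner_le_norm y (U' y)
  have h2 := h.grad_le y
  have h3 := h.abs_le y
  have h4 : ‖y‖ * ‖U' y‖ ≤ 1 * (L * 1) := by
    gcongr
    exact h2.trans (by gcongr)
  have h5 : L * ‖y‖ ^ 2 ≤ L * 1 := by
    gcongr
    exact pow_le_one₀ (norm_nonneg _) hy
  rw [_root_.abs_le] at *
  constructor <;> linarith [h1.1, h1.2, h3.1, h3.2]

lemma Good.abs_le_one {L : ℝ≥0} {U : E → ℝ} {U' : E → E} (h : Good L U U') {y : E}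
    (hy : ‖y‖ ≤ 1) : |U y| ≤ L := by
  have h3 := h.abs_le y
  have h5 : L * ‖y‖ ^ 2 ≤ L * 1 := by
    gcongr
    exact pow_le_one₀ (norm_nonneg _) hy
  linarith

/-- pointwise estimates -/
lemma step_pt {L : ℝ≥0} {U V : E → ℝ} {U' V' : E → E} (hU : Good L U U') (hV : Good L V V')
    {τ : ℝ} (h0 : 0 ≤ τ) (h1 : τ ≤ 1)
    (hVU : ∀ y, V y = U ((1 + τ) • y) / (1 + τ) ^ 2)
    (hVU' : ∀ y, V' y = (1 + τ)⁻¹ • U' ((1 + τ) • y)) {y : E} (hy : ‖y‖ ≤ 1) :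
    |V y - U y - τ * ndev U U' y| ≤ 11 * L * τ ^ 2 ∧
    |ndev V V' y - ndev U U' y| ≤ 16 * L * τ ∧
    - (L * τ ^ 2) ≤ (V y - U y) * (cind U y + cind V y) := by
  have hL : (0:ℝ) ≤ L := L.2
  have hlam : (0:ℝ) < 1 + τ := by linarith
  have hlam2 : (1:ℝ) ≤ (1 + τ) ^ 2 := by nlinarith
  have eN : (1 + τ) • y - y = τ • y := by module
  have hny : ‖τ • y‖ ≤ τ := by
    rw [norm_smul, Real.norm_eq_abs, abs_of_nonneg h0]
    nlinarith [norm_nonneg y]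
  have hny2 : ‖τ • y‖ ^ 2 ≤ τ ^ 2 := by gcongr
  have t1 := taylor2 hU.grad hU.lip y ((1 + τ) • y)
  rw [eN, inner_smul_right] at t1
  have t2 : |U ((1 + τ) • y) - U y - τ * inner ℝ (U' y) y| ≤ L * τ ^ 2 :=
    t1.trans (by gcongr)
  have bU := hU.abs_le_one hy
  have bN := hU.ndev_abs_le hy
  have eI : inner ℝ (U' y) y = ndev U U' y + 2 * U y := by
    unfold ndev; rw [real_inner_comm]; ring
  rw [eI] at t2
  set N := ndev U U' y with hN
  set R := U ((1 + τ) • y) - U y - τ * (N + 2 * U y) with hR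
  have hUl : U ((1 + τ) • y) = U y + τ * (N + 2 * U y) + R := by rw [hR]; ring
  have hτ2 : 0 ≤ τ ^ 2 := sq_nonneg _
  have key : ∀ (X c : ℝ), |X| ≤ c → |X / (1 + τ) ^ 2| ≤ c := by
    intro X c hX
    rw [abs_div, abs_of_pos (by positivity : (0:ℝ) < (1 + τ) ^ 2)]
    exact (div_le_self (abs_nonneg _) hlam2).trans hX
  refine ⟨?_, ?_, ?_⟩
  · have e : V y - U y - τ * N = (-(τ ^ 2) * U y - τ ^ 2 * (2 + τ) * N + R) / (1 + τ) ^ 2 := by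
      rw [hVU, hUl]; field_simp; ring
    rw [e]
    apply key
    have a1 : |-(τ ^ 2) * U y| ≤ τ ^ 2 * L := by
      rw [abs_mul, abs_neg, abs_of_nonneg hτ2]; gcongr
    have a2 : |τ ^ 2 * (2 + τ) * N| ≤ τ ^ 2 * 3 * (3 * L) := by
      rw [abs_mul, abs_of_nonneg (by positivity)]
      gcongr
      linarith
    calc |-(τ ^ 2) * U y - τ ^ 2 * (2 + τ) * N + R|
        ≤ |-(τ ^ 2) * U y| + |τ ^ 2 * (2 + τ) * N| + |R| :=
          (abs_add_le _ _).trans (by gcongr; exact abs_sub _ _)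
      _ ≤ _ := by linarith
  · have eV : ndev V V' y = (inner ℝ ((1 + τ) • y) (U' ((1 + τ) • y)) - 2 * U ((1 + τ) • y)) /
        (1 + τ) ^ 2 := by
      unfold ndev
      rw [hVU, hVU', inner_smul_right, real_inner_smul_left]
      field_simp
    have hl2 : ‖(1 + τ) • y‖ ≤ 2 := by
      rw [norm_smul, Real.norm_eq_abs, abs_of_pos hlam]
      nlinarith [norm_nonneg y]
    have g1 : ‖U' ((1 + τ) • y)‖ ≤ 2 * L := by
      have := hU.grad_le ((1 + τ) • y)
      nlinarith
    have g2 : ‖U' ((1 + τ) • y) - U' y‖ ≤ L * τ := by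
      have := hU.lip.dist_le_mul ((1 + τ) • y) y
      rw [dist_eq_norm, dist_eq_norm, eN] at this
      exact this.trans (by gcongr)
    have i1 : |inner ℝ y (U' ((1 + τ) • y))| ≤ 2 * L := by
      refine (abs_real_inner_le_norm _ _).trans ?_
      calc _ ≤ 1 * (2 * (L:ℝ)) := by gcongr
        _ = _ := by ring
    have i2 : |inner ℝ y (U' ((1 + τ) • y) - U' y)| ≤ L * τ := by
      refine (abs_real_inner_le_norm _ _).trans ?_
      calc _ ≤ 1 * (L * τ) := by gcongr
        _ = _ := by ring
    have e : ndev V V' y - N = (τ * inner ℝ y (U' ((1 + τ) • y))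
        + inner ℝ y (U' ((1 + τ) • y) - U' y) - 2 * (τ * (N + 2 * U y) + R)
        + (-(τ * (2 + τ))) * N) / (1 + τ) ^ 2 := by
      rw [eV, hUl, inner_sub_right, real_inner_smul_left]
      have : inner ℝ y (U' y) = N + 2 * U y := by rw [hN]; unfold ndev; ring
      rw [this]
      field_simp
      ring
    rw [e]
    apply key
    have j3 : |N + 2 * U y| ≤ L := by
      have := abs_real_inner_le_norm (U' y) y
      rw [eI] at this
      refine this.trans ?_
      have := hU.grad_le y
      calc ‖U' y‖ * ‖y‖ ≤ (L * 1) * 1 := by gcongr; exact this.trans (by gcongr)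
        _ = L := by ring
    have k1 : |τ * inner ℝ y (U' ((1 + τ) • y))| ≤ τ * (2 * L) := by
      rw [abs_mul, abs_of_nonneg h0]; gcongr
    have k2 : |τ * (N + 2 * U y)| ≤ τ * L := by
      rw [abs_mul, abs_of_nonneg h0]; gcongr
    have k3 : |-(τ * (2 + τ)) * N| ≤ τ * 3 * (3 * L) := by
      rw [abs_mul, abs_neg, abs_of_nonneg (by positivity)]
      gcongr
      linarith
    have k4 : L * τ ^ 2 ≤ L * τ := by
      gcongr; nlinarith
    rw [abs_le] at *
    constructor <;> linarith [i2.1, i2.2, k1.1, k1.2, k2.1, k2.2, k3.1, k3.2, t2.1, t2.2]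
  · have c1 : 0 ≤ (V y - U y) * cind U y := by
      unfold cind
      split_ifs with h
      · simp
      · have : U y = 0 := le_antisymm (not_lt.1 h) (hU.nonneg y)
        rw [this]
        simpa using hV.nonneg y
    have c2 : -(L * τ ^ 2) ≤ (V y - U y) * cind V y := by
      unfold cind
      split_ifs with h
      · simp; positivity
      · have h2 : V y = 0 := le_antisymm (not_lt.1 h) (hV.nonneg y)
        have h3 : U ((1 + τ) • y) = 0 := by
          rw [hVU] at h2
          field_simp at h2
          simpa using h2
        have h4 := taylor2 hU.grad hU.lip ((1 + τ) • y) y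
        rw [hU.grad_zero h3, h3, norm_sub_rev, eN] at h4
        simp only [inner_zero_left, sub_zero] at h4
        rw [h2]
        have := le_abs_self (U y)
        have h5 : L * ‖τ • y‖ ^ 2 ≤ L * τ ^ 2 := by gcongr
        linarith
    linarith

lemma step_g {L : ℝ≥0} {U V : E → ℝ} {U' V' : E → E} (hU : Good L U U') (hV : Good L V V')
    {τ : ℝ} (h0 : 0 ≤ τ) (h1 : τ ≤ 1)
    (hVU : ∀ y, V y = U ((1 + τ) • y) / (1 + τ) ^ 2)
    (hVU' : ∀ y, V' y = (1 + τ)⁻¹ • U' ((1 + τ) • y))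
    {A : Matrix (Fin n) (Fin n) ℝ} (hA : MemP A) :
    gfun U U' A + 8 * τ * nsq U U' - (L + 1200 * L ^ 2) * wvol n * τ ^ 2 ≤ gfun V V' A := by
  have hL : (0:ℝ) ≤ L := L.2
  have cU := hU.cont
  have cV := hV.cont
  have cU' := hU.lip.continuous
  have cV' := hV.lip.continuous
  have cq := quadForm_continuous A
  have cNU := ndev_continuous cU cU'
  have cNV := ndev_continuous cV cV'
  set D : E → ℝ := fun y => V y - U y with hD
  set D' : E → E := fun y => V' y - U' y with hD'
  have gD : ∀ x, HasGradientAt D (D' x) x := fun x => hasGrad_sub (hV.grad x) (hU.grad x)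
  have cD : Continuous D := by fun_prop
  have cD' : Continuous D' := by fun_prop
  have e1 : (fun y => V y - quadForm A y) = fun y => D y + (U y - quadForm A y) := by
    ext y; simp [hD]
  have e2 : (fun y => V' y - aop A y) = fun y => D' y + (U' y - aop A y) := by
    ext1 y; simp [hD']
  have r1 := bform_add (v2 := fun y => U y - quadForm A y) (v2' := fun y => U' y - aop A y)
    (f := fun y => V y - quadForm A y) (f' := fun y => V' y - aop A y) cD
    (by fun_prop) (by fun_prop) cD' (by fun_prop) (by fun_prop)
  have r2 := bform_add (v2 := fun y => U y - quadForm A y) (v2' := fun y => U' y - aop A y)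
    (f := fun y => U y - quadForm A y) (f' := fun y => U' y - aop A y) cD
    (by fun_prop) (by fun_prop) cD' (by fun_prop) (by fun_prop)
  rw [← e1, ← e2] at r1 r2
  rw [bform_comm (fun y => V y - quadForm A y) (fun y => V' y - aop A y)
    (fun y => U y - quadForm A y)] at r2
  have eg : gfun V V' A - gfun U U' A = (∫ y, D y * (cind U y + cind V y) * wt 2 y)
      + 4 * ∫ y, D y * (ndev V V' y + ndev U U' y) * wt 1 y := by
    have s1 := hV.bform_sub hA.2 gD cD'
    have s2 := hU.bform_sub hA.2 gD cD'
    have q1 : ∫ y, D y * (cind U y + cind V y) * wt 2 y =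
        (∫ y, D y * cind U y * wt 2 y) + ∫ y, D y * cind V y * wt 2 y := by
      rw [← integral_add (integrable_cind cU cD two_ne_zero) (integrable_cind cV cD two_ne_zero)]
      congr 1; ext y; ring
    have q2 : ∫ y, D y * (ndev V V' y + ndev U U' y) * wt 1 y =
        (∫ y, D y * ndev V V' y * wt 1 y) + ∫ y, D y * ndev U U' y * wt 1 y := by
      rw [← integral_add (integrable_mul_wt (by fun_prop) one_ne_zero)
        (integrable_mul_wt (by fun_prop) one_ne_zero)]
      congr 1; ext y; ring
    unfold gfun
    rw [r1, r2, s1, s2, q1, q2]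
    ring
  have f1 : -(L * τ ^ 2) * wvol n ≤ ∫ y, D y * (cind U y + cind V y) * wt 2 y := by
    have i1 : ∫ y : E, (-(L * τ ^ 2)) * wt 2 y ≤ ∫ y, D y * (cind U y + cind V y) * wt 2 y := by
      apply integral_mono ((integrable_wt two_ne_zero).const_mul _)
      · refine ((integrable_cind cU cD two_ne_zero).add
          (integrable_cind cV cD two_ne_zero)).congr ?_
        filter_upwards with y
        simp only [Pi.add_apply]; ring
      · intro y
        by_cases hy : ‖y‖ ≤ 1
        · exact mul_le_mul_of_nonneg_right (step_pt hU hV h0 h1 hVU hVU' hy).2.2 (wt_nonneg _ _)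
        · simp [wt_eq_zero two_ne_zero (not_le.1 hy).le]
    rw [integral_const_mul] at i1
    have := integral_wt_le (n := n) two_ne_zero
    have : 0 ≤ L * τ ^ 2 := by positivity
    nlinarith
  have f2 : 2 * τ * nsq U U' - 300 * L ^ 2 * τ ^ 2 * wvol n ≤
      ∫ y, D y * (ndev V V' y + ndev U U' y) * wt 1 y := by
    unfold nsq wvol
    rw [← integral_const_mul, ← integral_const_mul, ← integral_sub
      ((integrable_mul_wt (by fun_prop) one_ne_zero).const_mul _)
      ((integrable_wt one_ne_zero).const_mul _)]
    apply integral_mono (((integrable_mul_wt (by fun_prop) one_ne_zero).const_mul _).sub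
      ((integrable_wt one_ne_zero).const_mul _)) (integrable_mul_wt (by fun_prop) one_ne_zero)
    intro y
    by_cases hy : ‖y‖ ≤ 1
    · obtain ⟨a1, a2, -⟩ := step_pt hU hV h0 h1 hVU hVU' hy
      have a3 := hU.ndev_abs_le hy
      have : 2 * τ * ndev U U' y ^ 2 - 300 * L ^ 2 * τ ^ 2 ≤
          D y * (ndev V V' y + ndev U U' y) := by
        set N := ndev U U' y
        set a := V y - U y - τ * N with ha
        set b := ndev V V' y - N with hb
        have e : D y * (ndev V V' y + N) = 2 * τ * N ^ 2 + τ * (N * b) + 2 * (a * N) + a * b := by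
          rw [ha, hb]; simp only [hD]; ring
        rw [e]
        have b1 : |N * b| ≤ (3 * L) * (16 * L * τ) := by
          rw [abs_mul]; gcongr
        have b2 : |a * N| ≤ (11 * L * τ ^ 2) * (3 * L) := by
          rw [abs_mul]; gcongr
        have b3 : |a * b| ≤ (11 * L * τ ^ 2) * (16 * L * τ) := by
          rw [abs_mul]; gcongr
        have b4 : (11 * L * τ ^ 2) * (16 * L * τ) ≤ 176 * L ^ 2 * τ ^ 2 := by
          have : (0:ℝ) ≤ L ^ 2 * τ ^ 2 := by positivity
          nlinarith
        have b5 := (abs_le.1 b1).1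
        have b6 : τ * (-((3 * L) * (16 * L * τ))) ≤ τ * (N * b) := by gcongr
        nlinarith [(abs_le.1 b2).1, (abs_le.1 b3).1, (by positivity : (0:ℝ) ≤ L ^ 2 * τ ^ 2)]
      have h3 := mul_le_mul_of_nonneg_right this (wt_nonneg 1 y)
      simp only [Pi.sub_apply, Pi.add_apply]
      linarith
    · simp [wt_eq_zero one_ne_zero (not_le.1 hy).le]
  nlinarith

lemma Good.pair {L : ℝ≥0} {U : E → ℝ} {U' : E → E} (hU : Good L U U')
    {A : Matrix (Fin n) (Fin n) ℝ} (hA : MemP A) :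
    4 * ∫ y, (U y - quadForm A y) * ndev U U' y * wt 1 y = gfun U U' A + qcon U A := by
  have h := hU.bform_sub hA.2 (hU.sub_grad hA.symm) (hU.sub_lip A).continuous
  have e : ∫ y, (U y - quadForm A y) * cind U y * wt 2 y = - qcon U A := by
    unfold qcon
    rw [← integral_neg]
    congr 1
    ext y
    unfold cind
    split_ifs with h
    · simp
    · have : U y = 0 := le_antisymm (not_lt.1 h) (hU.nonneg y)
      rw [this]; ring
  rw [e] at h
  unfold gfun
  rw [h]
  ring

lemma step_h {L : ℝ≥0} {U V : E → ℝ} {U' V' : E → E} (hU : Good L U U') (hV : Good L V V')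
    {τ : ℝ} (h0 : 0 ≤ τ) (h1 : τ ≤ 1)
    (hVU : ∀ y, V y = U ((1 + τ) • y) / (1 + τ) ^ 2)
    (hVU' : ∀ y, V' y = (1 + τ)⁻¹ • U' ((1 + τ) • y))
    {A : Matrix (Fin n) (Fin n) ℝ} (hA : MemP A) :
    hfun U A + τ / 2 * (gfun U U' A + qcon U A)
      - 22 * L * (L + ‖aop A‖) * wvol n * τ ^ 2 ≤ hfun V A := by
  have hL : (0:ℝ) ≤ L := L.2
  have cU := hU.cont
  have cV := hV.cont
  have cU' := hU.lip.continuous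
  have cV' := hV.lip.continuous
  have cq := quadForm_continuous A
  have cNU := ndev_continuous cU cU'
  rw [← hU.pair hA]
  have : hfun U A + 2 * τ * (∫ y, (U y - quadForm A y) * ndev U U' y * wt 1 y)
      - 22 * L * (L + ‖aop A‖) * τ ^ 2 * wvol n ≤ hfun V A := by
    have I1 : Integrable fun y : E => (U y - quadForm A y) ^ 2 * wt 1 y :=
      integrable_mul_wt (by fun_prop) one_ne_zero
    have I2 : Integrable fun y : E => 2 * τ * ((U y - quadForm A y) * ndev U U' y * wt 1 y) :=
      (integrable_mul_wt (by fun_prop) one_ne_zero).const_mul _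
    have I3 : Integrable fun y : E => 22 * L * (L + ‖aop A‖) * τ ^ 2 * wt 1 y :=
      (integrable_wt one_ne_zero).const_mul _
    have I4 : Integrable fun y : E => (V y - quadForm A y) ^ 2 * wt 1 y :=
      integrable_mul_wt (by fun_prop) one_ne_zero
    unfold hfun wvol
    have I12 : Integrable fun y : E => (U y - quadForm A y) ^ 2 * wt 1 y +
      2 * τ * ((U y - quadForm A y) * ndev U U' y * wt 1 y) := I1.add I2
    rw [← integral_const_mul, ← integral_const_mul, ← integral_add I1 I2,
      ← integral_sub I12 I3]
    apply integral_mono (I12.sub I3) I4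
    intro y
    by_cases hy : ‖y‖ ≤ 1
    · obtain ⟨a1, -, -⟩ := step_pt hU hV h0 h1 hVU hVU' hy
      have a2 : |U y - quadForm A y| ≤ L + ‖aop A‖ :=
        (abs_sub _ _).trans (add_le_add (hU.abs_le_one hy) (quadForm_abs_le A hy))
      have : (U y - quadForm A y) ^ 2 + 2 * τ * ((U y - quadForm A y) * ndev U U' y)
          - 22 * L * (L + ‖aop A‖) * τ ^ 2 ≤ (V y - quadForm A y) ^ 2 := by
        set N := ndev U U' y
        set a := V y - U y - τ * N with ha
        set w := U y - quadForm A y with hw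
        have e : V y - quadForm A y = w + (V y - U y) := by rw [hw]; ring
        have e2 : V y - U y = τ * N + a := by rw [ha]; ring
        have b1 : |a * w| ≤ (11 * L * τ ^ 2) * (L + ‖aop A‖) := by
          rw [abs_mul]; gcongr
        rw [e]
        have e3 : w * (V y - U y) = τ * (w * N) + a * w := by rw [e2]; ring
        nlinarith [(abs_le.1 b1).1, sq_nonneg (V y - U y)]
      have h3 := mul_le_mul_of_nonneg_right this (wt_nonneg 1 y)
      simp only [Pi.sub_apply, Pi.add_apply]
      linarith
    · simp [wt_eq_zero one_ne_zero (not_le.1 hy).le]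
  linarith

/-- discrete monotonicity implies monotonicity -/
lemma mono_of_step {φ : ℝ → ℝ} {a b c C : ℝ} (hab : a ≤ b) (hC : 0 ≤ C)
    (h : ∀ t σ, a ≤ t → 0 ≤ σ → σ ≤ 1 / 2 → t + σ ≤ b → φ t + c * σ - C * σ ^ 2 ≤ φ (t + σ)) :
    φ a + c * (b - a) ≤ φ b := by
  have key : ∀ N : ℕ, 2 * (b - a) ≤ N → 0 < N → φ a + c * (b - a) - C * (b - a) ^ 2 / N ≤ φ b := by
    intro N hN hN0
    have hNp : (0:ℝ) < N := by exact_mod_cast hN0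
    set σ := (b - a) / N with hσ
    have s0 : 0 ≤ σ := div_nonneg (by linarith) hNp.le
    have s1 : σ ≤ 1 / 2 := by rw [hσ, div_le_iff₀ hNp]; linarith
    have hσN : N * σ = b - a := by rw [hσ]; field_simp
    have ind : ∀ k : ℕ, k ≤ N → φ a + k * (c * σ - C * σ ^ 2) ≤ φ (a + k * σ) := by
      intro k
      induction k with
      | zero => intro _; simp
      | succ k ih =>
        intro hk
        have h1 := ih (by omega)
        have hk' : ((k + 1 : ℕ) : ℝ) ≤ N := by exact_mod_cast hk
        push_cast at hk'
        have h2 := h (a + k * σ) σ (by nlinarith [(Nat.cast_nonneg k : (0:ℝ) ≤ k)]) s0 s1 (by nlinarith)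
        have e : a + ((k + 1 : ℕ) : ℝ) * σ = a + k * σ + σ := by push_cast; ring
        rw [e]
        push_cast
        linarith
    have h3 := ind N le_rfl
    rw [hσN] at h3
    have e1 : a + (b - a) = b := by ring
    rw [e1] at h3
    have e2 : (N:ℝ) * (c * σ - C * σ ^ 2) = c * (b - a) - C * (b - a) ^ 2 / N := by
      rw [hσ]; field_simp
    rw [e2] at h3
    linarith
  have lim : Tendsto (fun N : ℕ => φ a + c * (b - a) - C * (b - a) ^ 2 / N) atTop
      (𝓝 (φ a + c * (b - a) - 0)) :=
    tendsto_const_nhds.sub (tendsto_const_div_atTop_nhds_zero_nat _)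
  rw [sub_zero] at lim
  apply le_of_tendsto lim
  obtain ⟨M, hM⟩ := exists_nat_ge (2 * (b - a))
  filter_upwards [eventually_ge_atTop (max M 1)] with N hN
  apply key N
  · exact hM.trans (by exact_mod_cast (le_max_left _ _).trans hN)
  · have := (le_max_right M 1).trans hN
    omega

end step


/-! ### Localisation and rescaling -/

/-- Global `C^{1,1}` function solving the obstacle problem in a ball. -/
structure Loc {n : ℕ} (L : ℝ≥0) (x0 : EuclideanSpace ℝ (Fin n)) (ρ : ℝ)
    (u : EuclideanSpace ℝ (Fin n) → ℝ)
    (u' : EuclideanSpace ℝ (Fin n) → EuclideanSpace ℝ (Fin n)) : Prop where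
  grad : ∀ x, HasGradientAt u (u' x) x
  lip : LipschitzWith L u'
  nonneg : ∀ x, 0 ≤ u x
  eqn : ∀ᵐ x : EuclideanSpace ℝ (Fin n), dist x x0 < ρ → divg u' x = if 0 < u x then 1 else 0

/-- rescaled function -/
def sclU {n : ℕ} (u : EuclideanSpace ℝ (Fin n) → ℝ) (x : EuclideanSpace ℝ (Fin n)) (r : ℝ)
    (y : EuclideanSpace ℝ (Fin n)) : ℝ := u (x + r • y) / r ^ 2

/-- rescaled gradient -/
def sclD {n : ℕ} (u' : EuclideanSpace ℝ (Fin n) → EuclideanSpace ℝ (Fin n))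
    (x : EuclideanSpace ℝ (Fin n)) (r : ℝ)
    (y : EuclideanSpace ℝ (Fin n)) : EuclideanSpace ℝ (Fin n) := r⁻¹ • u' (x + r • y)

section loc
variable {n : ℕ}
local notation "E" => EuclideanSpace ℝ (Fin n)

lemma lipOn_smul {F : Type*} [NormedAddCommGroup F] [NormedSpace ℝ F] {s : Set E} {f : E → ℝ}
    {g : E → F} {Lf Lg : ℝ≥0} {Mf Mg : ℝ} (hf : LipschitzOnWith Lf f s)
    (hg : LipschitzOnWith Lg g s) (bf : ∀ x ∈ s, |f x| ≤ Mf) (bg : ∀ x ∈ s, ‖g x‖ ≤ Mg) :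
    ∃ K : ℝ≥0, LipschitzOnWith K (fun x => f x • g x) s := by
  refine ⟨(Mf * Lg + Lf * Mg).toNNReal, ?_⟩
  rw [lipschitzOnWith_iff_norm_sub_le] at *
  intro x hx y hy
  have e : f x • g x - f y • g y = f x • (g x - g y) + (f x - f y) • g y := by module
  have hMf : 0 ≤ Mf := (abs_nonneg _).trans (bf x hx)
  have hMg : 0 ≤ Mg := (norm_nonneg _).trans (bg x hx)
  rw [e, Real.coe_toNNReal _ (by positivity)]
  refine (norm_add_le _ _).trans ?_
  rw [norm_smul, norm_smul, Real.norm_eq_abs, add_mul, mul_assoc]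
  have h1 := hg hx hy
  have h2 := hf hx hy
  have h3 := bf x hx
  have h4 := bg y hy
  calc |f x| * ‖g x - g y‖ + ‖f x - f y‖ * ‖g y‖
      ≤ Mf * (Lg * ‖x - y‖) + (Lf * ‖x - y‖) * Mg := by gcongr
    _ = _ := by ring

lemma lip_glue {F : Type*} [NormedAddCommGroup F] [NormedSpace ℝ F] {g : E → F} {x0 : E} {ρ : ℝ}
    (hρ : 0 < ρ) {K : ℝ≥0} (h1 : LipschitzOnWith K g (closedBall x0 (3 * ρ)))
    (h2 : ∀ x, 2 * ρ ≤ dist x x0 → g x = 0) : ∃ L : ℝ≥0, LipschitzWith L g := by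
  obtain ⟨M, hM⟩ := (isCompact_closedBall x0 (3 * ρ)).exists_bound_of_continuousOn h1.continuousOn
  have hM0 : 0 ≤ M := (norm_nonneg _).trans (hM x0 (by simp; positivity))
  have hMr : 0 ≤ M / ρ := by positivity
  have far : ∀ x y, dist x x0 < 2 * ρ → 3 * ρ < dist y x0 → ‖g x‖ ≤ (K + M / ρ) * dist x y := by
    intro x y hx hy
    have hd : ρ ≤ dist x y := by
      have := dist_triangle y x x0
      rw [dist_comm y x] at this
      linarith
    calc ‖g x‖ ≤ M := hM x (by simp; linarith)
      _ = M / ρ * ρ := by field_simp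
      _ ≤ M / ρ * dist x y := by gcongr
      _ ≤ _ := by nlinarith [K.2, dist_nonneg (x := x) (y := y), mul_nonneg K.2 (dist_nonneg (x := x) (y := y))]
  refine ⟨K + (M / ρ).toNNReal, LipschitzWith.of_dist_le_mul fun x y => ?_⟩
  push_cast
  rw [Real.coe_toNNReal _ hMr]
  have hd0 : 0 ≤ M / ρ * dist x y := mul_nonneg hMr dist_nonneg
  by_cases hx : 3 * ρ < dist x x0
  · rw [h2 x (by linarith)]
    by_cases hy : 2 * ρ ≤ dist y x0
    · rw [h2 y hy, dist_self]
      have := K.2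
      positivity
    · have := far y x (not_le.1 hy) hx
      rwa [dist_zero_left, dist_comm x y]
  · by_cases hy : 3 * ρ < dist y x0
    · rw [h2 y (by linarith)]
      by_cases hx2 : 2 * ρ ≤ dist x x0
      · rw [h2 x hx2, dist_self]
        have := K.2
        positivity
      · rw [dist_zero_right]
        exact far x y (not_le.1 hx2) hy
    · have := h1.dist_le_mul x (by simpa using hx) y (by simpa using hy)
      linarith

lemma exists_loc {Ω : Set E} (hΩ : IsOpen Ω) {u : E → ℝ} (hu : IsObstacleSol Ω u) {x0 : E}
    (hx0 : x0 ∈ Ω) : ∃ (ρ : ℝ) (L : ℝ≥0) (v : E → ℝ) (v' : E → E), 0 < ρ ∧ Loc L x0 ρ v v' ∧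
      (∀ x, dist x x0 < ρ → v x = u x) ∧ ball x0 ρ ⊆ Ω := by
  obtain ⟨hd, hl, hnn, hae⟩ := hu
  obtain ⟨δ, hδ, hδΩ⟩ := Metric.isOpen_iff.1 hΩ x0 hx0
  set ρ := δ / 4 with hρ
  have hρ0 : 0 < ρ := by positivity
  have hB : closedBall x0 (3 * ρ) ⊆ Ω :=
    (closedBall_subset_ball (by linarith)).trans hδΩ
  obtain ⟨L1, hL1⟩ := hl _ hB (isCompact_closedBall _ _)
  let η : ContDiffBump x0 := ⟨ρ, 2 * ρ, hρ0, by linarith⟩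
  have hη1 : ContDiff ℝ 2 (η : E → ℝ) := η.contDiff
  have hgη : ∀ x, HasGradientAt η (gradient η x) x :=
    fun x => ((hη1.differentiable (by norm_num)) x).hasGradientAt
  have hcη : HasCompactSupport (gradient η) := by
    apply HasCompactSupport.intro (isCompact_closedBall x0 (2 * ρ))
    intro x hx
    have : (η : E → ℝ) =ᶠ[𝓝 x] fun _ => 0 := by
      have : (closedBall x0 (2 * ρ))ᶜ ∈ 𝓝 x := isClosed_closedBall.isOpen_compl.mem_nhds hx
      filter_upwards [this] with z hz
      apply η.zero_of_le_dist
      simp at hz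
      exact hz.le
    rw [gradient, this.fderiv_eq]
    simp
  have hsη : ContDiff ℝ 1 (gradient η) := by
    unfold gradient
    exact (InnerProductSpace.toDual ℝ E).symm.contDiff.comp (hη1.fderiv_right (by norm_num))
  obtain ⟨Ka, hKa⟩ := hsη.lipschitzWith_of_hasCompactSupport hcη one_ne_zero
  obtain ⟨Kb, hKb⟩ := hη1.lipschitzWith_of_hasCompactSupport η.hasCompactSupport two_ne_zero
  have hcB := isCompact_closedBall x0 (3 * ρ)
  obtain ⟨Mg, hMg⟩ := hcB.exists_bound_of_continuousOn hL1.continuousOn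
  have hgu : ∀ x ∈ Ω, HasGradientAt u (gradient u x) x := fun x hx => (hd x hx).hasGradientAt
  have huc : ContinuousOn u (closedBall x0 (3 * ρ)) := fun x hx =>
    (hd x (hB hx)).continuousAt.continuousWithinAt
  obtain ⟨Mu, hMu⟩ := hcB.exists_bound_of_continuousOn huc
  obtain ⟨Ma, hMa⟩ := hcB.exists_bound_of_continuousOn hsη.continuous.continuousOn
  have hul : LipschitzOnWith Mg.toNNReal u (closedBall x0 (3 * ρ)) := by
    apply (convex_closedBall x0 (3 * ρ)).lipschitzOnWith_of_nnnorm_hasFDerivWithin_le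
      (f' := fun x => innerSL ℝ (gradient u x))
    · intro x hx
      exact (hasGrad_iff.1 (hgu x (hB hx))).hasFDerivWithinAt
    · intro x hx
      rw [← NNReal.coe_le_coe, coe_nnnorm, innerSL_apply_norm]
      exact (hMg x hx).trans (Real.le_coe_toNNReal _)
  obtain ⟨K1, hK1⟩ := lipOn_smul hKb.lipschitzOnWith hL1 (Mf := 1)
    (fun x _ => by rw [abs_of_nonneg η.nonneg]; exact η.le_one) hMg
  obtain ⟨K2, hK2⟩ := lipOn_smul hul hKa.lipschitzOnWith (fun x hx => hMu x hx) hMa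
  set v : E → ℝ := fun x => η x * u x with hv
  set v' : E → E := fun x => η x • gradient u x + u x • gradient η x with hv'
  have hz : ∀ x, 2 * ρ ≤ dist x x0 → η x = 0 := fun x hx => η.zero_of_le_dist hx
  have hz' : ∀ x, 2 * ρ ≤ dist x x0 → gradient η x = 0 := by
    intro x hx
    have h1 : IsLocalMin η x := by
      filter_upwards with z
      rw [hz x hx]; exact η.nonneg
    have h2 := h1.hasFDerivAt_eq_zero (hasGrad_iff.1 (hgη x))
    rw [← norm_eq_zero, ← innerSL_apply_norm ℝ (gradient η x), h2, norm_zero]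
  obtain ⟨L, hL⟩ := lip_glue hρ0 (g := v') (hK1.add hK2) (by
    intro x hx
    simp [hv', hz x hx, hz' x hx])
  have hone : ∀ x, dist x x0 < ρ → η x = 1 := fun x hx =>
    η.one_of_mem_closedBall (by simpa using hx.le)
  have hone' : ∀ x, dist x x0 < ρ → gradient η x = 0 := by
    intro x hx
    have : (η : E → ℝ) =ᶠ[𝓝 x] 1 := η.eventuallyEq_one_of_mem_ball hx
    rw [gradient, this.fderiv_eq]
    simp
  refine ⟨ρ, L, v, v', hρ0, ⟨?_, hL, ?_, ?_⟩, ?_, ?_⟩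
  · intro x
    by_cases hx : 2 * ρ < dist x x0
    · have : v =ᶠ[𝓝 x] fun _ => 0 := by
        have : (closedBall x0 (2 * ρ))ᶜ ∈ 𝓝 x :=
          isClosed_closedBall.isOpen_compl.mem_nhds (by simpa using hx)
        filter_upwards [this] with z hz2
        simp at hz2
        simp [hv, hz z hz2.le]
      have e : v' x = 0 := by simp [hv', hz x hx.le, hz' x hx.le]
      rw [e]
      rw [hasGrad_iff]
      refine HasFDerivAt.congr_of_eventuallyEq ?_ this
      simpa using hasFDerivAt_const (0:ℝ) x
    · have := hasGrad_mul (hgη x) (hgu x (hB (by simp; linarith)))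
      exact this
  · intro x
    by_cases hx : 2 * ρ < dist x x0
    · simp [hv, hz x hx.le]
    · exact mul_nonneg η.nonneg (hnn x (hB (by simp; linarith)))
  · rw [ae_restrict_iff' hΩ.measurableSet] at hae
    filter_upwards [hae] with x hx hdx
    have h1 := hx (hB (by simp; linarith))
    have e : v' =ᶠ[𝓝 x] gradient u := by
      filter_upwards [isOpen_ball.mem_nhds (show x ∈ ball x0 ρ from hdx)] with z hz2
      simp [hv', hone z hz2, hone' z hz2]
    have e2 : v x = u x := by simp [hv, hone x hdx]
    rw [e2, ← h1]
    unfold divg lapGrad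
    rw [e.fderiv_eq]
  · intro x hx
    simp [hv, hone x hx]
  · exact (ball_subset_closedBall.trans (closedBall_subset_closedBall (by linarith))).trans hB

variable {L : ℝ≥0} {x0 : EuclideanSpace ℝ (Fin n)} {ρ : ℝ} {u : EuclideanSpace ℝ (Fin n) → ℝ}
  {u' : EuclideanSpace ℝ (Fin n) → EuclideanSpace ℝ (Fin n)}

lemma Loc.good (h : Loc L x0 ρ u u') {x : E} {r : ℝ} (hr : 0 < r) (hxr : dist x x0 + r ≤ ρ)
    (hx : u x = 0) : Good L (sclU u x r) (sclD u' x r) := by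
  have haff : ∀ y : E, HasFDerivAt (fun y : E => x + r • y) (r • ContinuousLinearMap.id ℝ E) y :=
    fun y => ((hasFDerivAt_id y).const_smul r).const_add x
  have hqm : Measure.QuasiMeasurePreserving (fun y : E => x + r • y) volume volume :=
    (measurePreserving_add_left volume x).quasiMeasurePreserving.comp
      (Measure.quasiMeasurePreserving_smul volume hr.ne')
  refine ⟨?_, ?_, ?_, ?_, ?_⟩
  · intro y
    rw [hasGrad_iff]
    have h1 := ((hasGrad_iff.1 (h.grad (x + r • y))).comp y (haff y)).mul_const ((r ^ 2)⁻¹)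
    refine h1.congr_fderiv ?_
    ext v
    simp [sclD, inner_smul_left]
    field_simp
  · apply LipschitzWith.of_dist_le_mul
    intro y z
    unfold sclD
    have := h.lip.dist_le_mul (x + r • y) (x + r • z)
    rw [dist_add_left, dist_smul₀, Real.norm_eq_abs, abs_of_pos hr] at this
    rw [dist_smul₀, Real.norm_eq_abs, abs_of_pos (inv_pos.2 hr)]
    calc _ ≤ r⁻¹ * (L * (r * dist y z)) := by gcongr
      _ = _ := by field_simp
  · intro y
    exact div_nonneg (h.nonneg _) (sq_nonneg _)
  · simp [sclU, hx]
  · have h1 := hqm.ae h.eqn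
    have h2 := hqm.ae (h.lip.ae_differentiableAt (μ := (volume : Measure E)))
    filter_upwards [h1, h2] with y hy hd hy1
    have h3 : dist (x + r • y) x0 < ρ := by
      have : dist (x + r • y) x < r := by
        rw [dist_eq_norm, add_sub_cancel_left, norm_smul, Real.norm_eq_abs, abs_of_pos hr]
        nlinarith
      have := dist_triangle (x + r • y) x x0
      linarith
    have e1 : divg (sclD u' x r) y = divg u' (x + r • y) := by
      unfold divg
      have h4 := (hd.hasFDerivAt.comp y (haff y)).const_smul r⁻¹
      have h5 : fderiv ℝ (sclD u' x r) y = fderiv ℝ u' (x + r • y) := by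
        refine (HasFDerivAt.fderiv (f' := fderiv ℝ u' (x + r • y)) ?_)
        refine h4.congr_fderiv ?_
        ext v
        simp [hr.ne']
      rw [h5]
    have e2 : (0 < sclU u x r y) ↔ (0 < u (x + r • y)) := by
      unfold sclU
      constructor
      · intro hh
        by_contra hc
        have : u (x + r • y) / r ^ 2 ≤ 0 := div_nonpos_of_nonpos_of_nonneg (not_lt.1 hc) (sq_nonneg _)
        linarith
      · intro hh; positivity
    rw [e1, hy h3]
    simp only [e2]

lemma sclU_step {x : E} {s τ : ℝ} (hs : 0 < s) (h0 : 0 ≤ τ) (y : E) :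
    sclU u x ((1 + τ) * s) y = sclU u x s ((1 + τ) • y) / (1 + τ) ^ 2 := by
  unfold sclU
  have e : x + ((1 + τ) * s) • y = x + s • (1 + τ) • y := by module
  rw [e]
  field_simp

lemma sclD_step {x : E} {s τ : ℝ} (hs : 0 < s) (h0 : 0 ≤ τ) (y : E) :
    sclD u' x ((1 + τ) * s) y = (1 + τ)⁻¹ • sclD u' x s ((1 + τ) • y) := by
  unfold sclD
  have e : x + ((1 + τ) * s) • y = x + s • (1 + τ) • y := by module
  rw [e, smul_smul (1 + τ)⁻¹ s⁻¹, mul_inv]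

/-- logarithmic monotonicity -/
lemma log_mono {f : ℝ → ℝ} {s t c C : ℝ} (hs : 0 < s) (hst : s ≤ t) (hC : 0 ≤ C) (hc : 0 ≤ c)
    (h : ∀ r τ, s ≤ r → 0 ≤ τ → τ ≤ 1 → (1 + τ) * r ≤ t →
      f r + c * τ - C * τ ^ 2 ≤ f ((1 + τ) * r)) :
    f s + c * Real.log (t / s) ≤ f t := by
  have ht : 0 < t := hs.trans_le hst
  have := mono_of_step (φ := fun z => f (Real.exp z)) (a := Real.log s) (b := Real.log t) (c := c)
    (C := 4 * C) (Real.log_le_log hs hst) (by positivity) (by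
      intro z σ hz h0 h1 h2
      have e : Real.exp (z + σ) = (1 + (Real.exp σ - 1)) * Real.exp z := by
        rw [Real.exp_add]; ring
      have a1 := Real.add_one_le_exp σ
      have a2 := Real.abs_exp_sub_one_le (x := σ) (by rw [abs_of_nonneg h0]; linarith)
      rw [abs_of_nonneg h0] at a2
      have a3 := (abs_le.1 a2).2
      have := h (Real.exp z) (Real.exp σ - 1) (by rwa [← Real.log_le_iff_le_exp hs])
        (by linarith) (by linarith) (by
          rw [← e, ← Real.le_log_iff_exp_le ht]; exact h2)
      simp only [e]
      refine le_trans ?_ this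
      have b1 : c * σ ≤ c * (Real.exp σ - 1) := by
        apply mul_le_mul_of_nonneg_left _ hc; linarith
      have b2 : C * (Real.exp σ - 1) ^ 2 ≤ C * (2 * σ) ^ 2 := by
        apply mul_le_mul_of_nonneg_left _ hC
        apply pow_le_pow_left₀ (by linarith) a3
      linarith)
  simp only [Real.exp_log hs, Real.exp_log ht] at this
  rwa [Real.log_div ht.ne' hs.ne']

lemma Loc.gfun_mono (h : Loc L x0 ρ u u') {x : E} {s t : ℝ} (hs : 0 < s) (hst : s ≤ t)
    (hxr : dist x x0 + t ≤ ρ) (hx : u x = 0) {A : Matrix (Fin n) (Fin n) ℝ} (hA : MemP A) :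
    gfun (sclU u x s) (sclD u' x s) A ≤ gfun (sclU u x t) (sclD u' x t) A := by
  have hL : (0:ℝ) ≤ L := L.2
  have hw := wvol_nonneg n
  have := log_mono (f := fun s => gfun (sclU u x s) (sclD u' x s) A) (c := 0) hs hst
    (C := (L + 1200 * L ^ 2) * wvol n) (by positivity) le_rfl (by
      intro r τ hr h0 h1 h2
      have hr0 : 0 < r := hs.trans_le hr
      have g1 := h.good hr0 (by nlinarith) hx
      have g2 := h.good (r := (1 + τ) * r) (by positivity) (by linarith) hx
      have := step_g g1 g2 h0 h1 (fun y => sclU_step hr0 h0 y) (fun y => sclD_step hr0 h0 y) hA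
      have n1 := nsq_nonneg (sclU u x r) (sclD u' x r)
      have : 0 ≤ 8 * τ * nsq (sclU u x r) (sclD u' x r) := by positivity
      linarith)
  linarith

lemma Loc.hfun_mono (h : Loc L x0 ρ u u') {x : E} {s t : ℝ} (hs : 0 < s) (hst : s ≤ t)
    (hxr : dist x x0 + t ≤ ρ) (hx : u x = 0) {A : Matrix (Fin n) (Fin n) ℝ} (hA : MemP A)
    (hg : ∀ r, 0 < r → r ≤ t → 0 ≤ gfun (sclU u x r) (sclD u' x r) A) :
    hfun (sclU u x s) A ≤ hfun (sclU u x t) A := by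
  have hL : (0:ℝ) ≤ L := L.2
  have hw := wvol_nonneg n
  have := log_mono (f := fun s => hfun (sclU u x s) A) (c := 0) hs hst
    (C := 22 * L * (L + ‖aop A‖) * wvol n) (by positivity) le_rfl (by
      intro r τ hr h0 h1 h2
      have hr0 : 0 < r := hs.trans_le hr
      have g1 := h.good hr0 (by nlinarith) hx
      have g2 := h.good (r := (1 + τ) * r) (by positivity) (by linarith) hx
      have := step_h g1 g2 h0 h1 (fun y => sclU_step hr0 h0 y) (fun y => sclD_step hr0 h0 y) hA
      have n1 := qcon_nonneg (sclU u x r) hA.1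
      have n2 := hg r hr0 (by nlinarith)
      have : 0 ≤ τ / 2 * (gfun (sclU u x r) (sclD u' x r) A + qcon (sclU u x r) A) := by positivity
      linarith)
  linarith

/-- Along some small scales the defect is small. -/
lemma Loc.exists_small (h : Loc L x0 ρ u u') {x : E} {t : ℝ} (ht : 0 < t)
    (hxr : dist x x0 + t ≤ ρ) (hx : u x = 0) {A : Matrix (Fin n) (Fin n) ℝ} (hA : MemP A)
    (hg : ∀ r, 0 < r → r ≤ t → 0 ≤ gfun (sclU u x r) (sclD u' x r) A) {ε : ℝ} (hε : 0 < ε) :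
    ∃ s, 0 < s ∧ s ≤ t ∧ nsq (sclU u x s) (sclD u' x s) + qcon (sclU u x s) A < ε := by
  by_contra hcon
  push Not at hcon
  have hL : (0:ℝ) ≤ L := L.2
  have hw := wvol_nonneg n
  set Φ : ℝ → ℝ := fun s => gfun (sclU u x s) (sclD u' x s) A + 2 * hfun (sclU u x s) A with hΦ
  have key : ∀ s, 0 < s → s ≤ t → ε * Real.log (t / s) ≤ Φ t := by
    intro s hs hst
    have := log_mono (f := Φ) (c := ε) hs hst
      (C := (L + 1200 * L ^ 2) * wvol n + 2 * (22 * L * (L + ‖aop A‖) * wvol n)) (by positivity)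
      hε.le (by
        intro r τ hr h0 h1 h2
        have hr0 : 0 < r := hs.trans_le hr
        have g1 := h.good hr0 (by nlinarith) hx
        have g2 := h.good (r := (1 + τ) * r) (by positivity) (by linarith) hx
        have s1 := step_g g1 g2 h0 h1 (fun y => sclU_step hr0 h0 y) (fun y => sclD_step hr0 h0 y) hA
        have s2 := step_h g1 g2 h0 h1 (fun y => sclU_step hr0 h0 y) (fun y => sclD_step hr0 h0 y) hA
        have hrt : r ≤ t := by nlinarith
        have n1 := nsq_nonneg (sclU u x r) (sclD u' x r)
        have n2 := hg r hr0 hrt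
        have n3 := hcon r hr0 hrt
        have : ε * τ ≤ 8 * τ * nsq (sclU u x r) (sclD u' x r) +
            τ * (gfun (sclU u x r) (sclD u' x r) A + qcon (sclU u x r) A) := by
          nlinarith [mul_nonneg h0 n1, mul_nonneg h0 n2]
        simp only [hΦ]
        linarith)
    have p1 := hg s hs hst
    have p2 := hfun_nonneg (sclU u x s) A
    have : 0 ≤ Φ s := by simp only [hΦ]; linarith
    linarith
  set T := Φ t / ε + 1 with hT
  have hT0 : 0 ≤ Φ t := by
    have := key t ht le_rfl
    rw [div_self ht.ne', Real.log_one] at this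
    linarith
  have hT1 : 0 < T := by positivity
  have := key (t * Real.exp (-T)) (by positivity) (by
    have : Real.exp (-T) ≤ 1 := by rw [Real.exp_le_one_iff]; linarith
    nlinarith)
  have e : t / (t * Real.exp (-T)) = Real.exp T := by
    rw [Real.exp_neg]; field_simp
  rw [e, Real.log_exp, hT, mul_add, mul_div_cancel₀ _ hε.ne'] at this
  linarith

end loc


/-! ### Classification of blow-up limits: integral identities -/

section ident
variable {n : ℕ}
local notation "E" => EuclideanSpace ℝ (Fin n)

lemma pw_grad (a : E) (k : ℕ) (y : E) :
    HasGradientAt (fun y : E => (inner ℝ a y) ^ k) (((k : ℝ) * (inner ℝ a y) ^ (k - 1)) • a) y := by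
  rw [hasGrad_iff]
  have h1 : HasFDerivAt (fun y : E => inner ℝ a y) (innerSL ℝ a) y := (innerSL ℝ a).hasFDerivAt
  have h2 := h1.pow k
  refine h2.congr_fderiv ?_
  ext v
  simp [inner_smul_left]

lemma pw_divg (a : E) (k : ℕ) (y : E) :
    divg (fun y : E => ((k : ℝ) * (inner ℝ a y) ^ (k - 1)) • a) y =
      k * ((k : ℝ) - 1) * ‖a‖ ^ 2 * (inner ℝ a y) ^ (k - 2) := by
  have h1 : HasFDerivAt (fun y : E => inner ℝ a y) (innerSL ℝ a) y := (innerSL ℝ a).hasFDerivAt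
  have h2 := ((h1.pow (k - 1)).const_mul (k : ℝ)).smul_const a
  unfold divg
  rw [h2.fderiv]
  have e : ∀ i : Fin n, inner ℝ a (EuclideanSpace.single i (1:ℝ)) = a i := by
    intro i; simp [EuclideanSpace.inner_single_right]
  simp only [ContinuousLinearMap.smulRight_apply, ContinuousLinearMap.smul_apply,
    innerSL_apply_apply, e, PiLp.smul_apply, smul_eq_mul, nsmul_eq_mul]
  rw [EuclideanSpace.real_norm_sq_eq, Finset.mul_sum, Finset.sum_mul]
  apply Finset.sum_congr rfl
  intro i _
  rcases k with _ | k
  · simp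
  · simp only [Nat.add_sub_cancel, Nat.cast_add, Nat.cast_one, add_sub_cancel_right]
    have : k + 1 - 2 = k - 1 := by omega
    rw [this]
    ring

lemma pw_lip (a : E) (k : ℕ) : ∃ K : ℝ≥0,
    LipschitzOnWith K (fun y : E => ((k : ℝ) * (inner ℝ a y) ^ (k - 1)) • a) (closedBall 0 2) := by
  have h : ContDiff ℝ 1 (fun y : E => ((k : ℝ) * (inner ℝ a y) ^ (k - 1)) • a) :=
    (contDiff_const.mul ((contDiff_const.inner ℝ contDiff_id).pow _)).smul contDiff_const
  exact h.contDiffOn.exists_lipschitzOnWith one_ne_zero (convex_closedBall _ _)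
    (isCompact_closedBall _ _)

lemma Good.main_id {L : ℝ≥0} {U : E → ℝ} {U' : E → E} (h : Good L U U')
    {B : Matrix (Fin n) (Fin n) ℝ} (hB : B.IsSymm) (hBt : B.trace = 1) (a : E) (k : ℕ) {j : ℕ}
    (hj : j ≠ 0) :
    (k * ((k : ℝ) - 1) * ‖a‖ ^ 2) *
      (∫ y, (U y - quadForm B y) * (inner ℝ a y) ^ (k - 2) * wt (j + 1) y) =
    2 * ((j : ℝ) + 1) * ((k : ℝ) - 2) * (∫ y, (U y - quadForm B y) * (inner ℝ a y) ^ k * wt j y)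
      - 2 * ((j : ℝ) + 1) * (∫ y, (inner ℝ a y) ^ k * ndev U U' y * wt j y)
      - ∫ y, (inner ℝ a y) ^ k * cind U y * wt (j + 1) y := by
  have cU := h.cont
  have cU' := h.lip.continuous
  have cq := quadForm_continuous B
  have cN := ndev_continuous cU cU'
  have cg : Continuous (fun y : E => ((k : ℝ) * (inner ℝ a y) ^ (k - 1)) • a) := by fun_prop
  obtain ⟨K, hK⟩ := pw_lip a k
  have i1 := ibp hK (h.sub_grad hB) (h.sub_lip B).continuous hj
  have i2 := ibp (h.sub_lip B).lipschitzOnWith (fun y => pw_grad a k y) cg hj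
  have e1 : ∫ y, (U y - quadForm B y) * divg (fun y : E => ((k : ℝ) * (inner ℝ a y) ^ (k - 1)) • a) y
      * wt (j + 1) y = (k * ((k : ℝ) - 1) * ‖a‖ ^ 2) *
      (∫ y, (U y - quadForm B y) * (inner ℝ a y) ^ (k - 2) * wt (j + 1) y) := by
    rw [← integral_const_mul]
    congr 1; ext y; rw [pw_divg]; ring
  have e2 : ∫ y, (inner ℝ a y) ^ k * divg (fun y => U' y - aop B y) y * wt (j + 1) y =
      - ∫ y, (inner ℝ a y) ^ k * cind U y * wt (j + 1) y := by
    rw [← integral_neg]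
    apply integral_congr_ae
    filter_upwards [h.divg_sub hBt] with y hy
    by_cases h1 : ‖y‖ < 1
    · rw [hy h1]; ring
    · rw [wt_eq_zero (by omega) (not_lt.1 h1)]; simp
  have e3 : ∫ y, inner ℝ (((k : ℝ) * (inner ℝ a y) ^ (k - 1)) • a) (U' y - aop B y) * wt (j + 1) y =
      ∫ y, inner ℝ (U' y - aop B y) (((k : ℝ) * (inner ℝ a y) ^ (k - 1)) • a) * wt (j + 1) y := by
    congr 1; ext y; rw [real_inner_comm]
  have e4 : ∫ y, (U y - quadForm B y) * inner ℝ y (((k : ℝ) * (inner ℝ a y) ^ (k - 1)) • a) * wt j y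
      = k * ∫ y, (U y - quadForm B y) * (inner ℝ a y) ^ k * wt j y := by
    rw [← integral_const_mul]
    congr 1; ext y
    rw [inner_smul_right, real_inner_comm]
    rcases k with _ | k
    · simp
    · simp only [Nat.add_sub_cancel]; ring
  have e5 : ∫ y, (inner ℝ a y) ^ k * inner ℝ y (U' y - aop B y) * wt j y =
      (∫ y, (inner ℝ a y) ^ k * ndev U U' y * wt j y) +
      2 * ∫ y, (U y - quadForm B y) * (inner ℝ a y) ^ k * wt j y := by
    rw [← integral_const_mul, ← integral_add (integrable_mul_wt (by fun_prop) hj)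
      ((integrable_mul_wt (by fun_prop) hj).const_mul _)]
    congr 1; ext y
    have := Good.ndev_sub U U' B y
    have e : inner ℝ y (U' y - aop B y) = ndev U U' y + 2 * (U y - quadForm B y) := by
      rw [← this]; unfold ndev; ring
    rw [e]; ring
  rw [e1, e4] at i1
  rw [e2, e3, e5] at i2
  linear_combination i1 - i2

lemma divg_id (y : E) : divg (fun y : E => y) y = n := by
  unfold divg
  have : fderiv ℝ (fun y : E => y) y = ContinuousLinearMap.id ℝ E := fderiv_id'
  rw [this]
  simp

lemma Good.rec_id {L : ℝ≥0} {U : E → ℝ} {U' : E → E} (h : Good L U U')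
    {B : Matrix (Fin n) (Fin n) ℝ} (hB : B.IsSymm) (a : E) (k : ℕ) {j : ℕ}
    (hj : j ≠ 0) :
    ((n : ℝ) + k + 2 + 2 * ((j : ℝ) + 1)) *
      (∫ y, (U y - quadForm B y) * (inner ℝ a y) ^ k * wt (j + 1) y) =
    2 * ((j : ℝ) + 1) * (∫ y, (U y - quadForm B y) * (inner ℝ a y) ^ k * wt j y)
      - ∫ y, (inner ℝ a y) ^ k * ndev U U' y * wt (j + 1) y := by
  have cU := h.cont
  have cU' := h.lip.continuous
  have cq := quadForm_continuous B
  have cN := ndev_continuous cU cU'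
  have hj1 : j + 1 ≠ 0 := by omega
  have cg : Continuous (fun y : E => ((k : ℝ) * (inner ℝ a y) ^ (k - 1)) • a) := by fun_prop
  have hv : ∀ y : E, HasGradientAt (fun y => (U y - quadForm B y) * (inner ℝ a y) ^ k)
      ((U y - quadForm B y) • (((k : ℝ) * (inner ℝ a y) ^ (k - 1)) • a)
      + (inner ℝ a y) ^ k • (U' y - aop B y)) y :=
    fun y => hasGrad_mul (h.sub_grad hB y) (pw_grad a k y)
  have hv' : Continuous fun y : E => ((U y - quadForm B y) • (((k : ℝ) * (inner ℝ a y) ^ (k - 1)) • a)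
      + (inner ℝ a y) ^ k • (U' y - aop B y)) := by fun_prop
  have hid : LipschitzOnWith 1 (fun y : E => y) (closedBall 0 2) := LipschitzWith.id.lipschitzOnWith
  have i1 := ibp hid hv hv' hj
  have e1 : ∫ y : E, (U y - quadForm B y) * (inner ℝ a y) ^ k * divg (fun y : E => y) y * wt (j + 1) y
      = n * ∫ y, (U y - quadForm B y) * (inner ℝ a y) ^ k * wt (j + 1) y := by
    rw [← integral_const_mul]
    congr 1; ext y; rw [divg_id]; ring
  have e2 : ∫ y : E, inner ℝ ((U y - quadForm B y) • (((k : ℝ) * (inner ℝ a y) ^ (k - 1)) • a)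
      + (inner ℝ a y) ^ k • (U' y - aop B y)) y * wt (j + 1) y =
      ((k : ℝ) + 2) * (∫ y, (U y - quadForm B y) * (inner ℝ a y) ^ k * wt (j + 1) y) +
      ∫ y, (inner ℝ a y) ^ k * ndev U U' y * wt (j + 1) y := by
    rw [← integral_const_mul, ← integral_add ((integrable_mul_wt (by fun_prop) hj1).const_mul _)
      (integrable_mul_wt (by fun_prop) hj1)]
    congr 1; ext y
    have := Good.ndev_sub U U' B y
    have e : inner ℝ (U' y - aop B y) y = ndev U U' y + 2 * (U y - quadForm B y) := by
      rw [← this, real_inner_comm]; unfold ndev; ring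
    have e3 : (k : ℝ) * (inner ℝ a y) ^ (k - 1) * inner ℝ a y = k * (inner ℝ a y) ^ k := by
      rcases k with _ | k
      · simp
      · simp only [Nat.add_sub_cancel]; ring
    simp only [inner_add_left, real_inner_smul_left, e]
    linear_combination (U y - quadForm B y) * wt (j + 1) y * e3
  have e3 : ∫ y : E, (U y - quadForm B y) * (inner ℝ a y) ^ k * inner ℝ y y * wt j y =
      (∫ y, (U y - quadForm B y) * (inner ℝ a y) ^ k * wt j y) -
      ∫ y, (U y - quadForm B y) * (inner ℝ a y) ^ k * wt (j + 1) y := by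
    rw [← integral_sub (integrable_mul_wt (by fun_prop) hj) (integrable_mul_wt (by fun_prop) hj1)]
    congr 1; ext y
    rw [wt_succ_eq hj, real_inner_self_eq_norm_sq]
    ring
  rw [e1, e2, e3] at i1
  linear_combination i1

lemma pw_abs_le (a : E) (k : ℕ) {y : E} (hy : ‖y‖ ≤ 1) : |(inner ℝ a y) ^ k| ≤ ‖a‖ ^ k := by
  rw [abs_pow]
  apply pow_le_pow_left₀ (abs_nonneg _)
  refine (abs_real_inner_le_norm _ _).trans ?_
  nlinarith [norm_nonneg a]

lemma tendsto_of_eta {X q : ℕ → ℝ} {C D : ℝ} (hC : 0 ≤ C)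
    (h : ∀ k, ∀ η > 0, |X k| ≤ C * η + D * q k / η) (hq : Tendsto q atTop (𝓝 0)) :
    Tendsto X atTop (𝓝 0) := by
  rw [Metric.tendsto_atTop]
  intro ε hε
  have hη : 0 < ε / (2 * (C + 1)) := by positivity
  set η := ε / (2 * (C + 1))
  have h2 : Tendsto (fun k => D * q k / η) atTop (𝓝 (D * 0 / η)) := (hq.const_mul D).div_const η
  rw [mul_zero, zero_div] at h2
  obtain ⟨N, hN⟩ := Metric.tendsto_atTop.1 h2 (ε / 2) (by positivity)
  refine ⟨N, fun k hk => ?_⟩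
  have h3 := hN k hk
  rw [Real.dist_eq, sub_zero] at *
  have h4 := h k η hη
  have h5 : C * η ≤ ε / 2 := by
    have : (C + 1) * η = ε / 2 := by simp only [η]; field_simp
    nlinarith
  linarith [le_abs_self (D * q k / η)]

lemma abs_integral_wt_le {f g : E → ℝ} {j : ℕ} (hg : Integrable fun y => g y * wt j y)
    (hfg : ∀ y, ‖y‖ ≤ 1 → |f y| ≤ g y) (hj : j ≠ 0) :
    |∫ y, f y * wt j y| ≤ ∫ y, g y * wt j y := by
  rw [← Real.norm_eq_abs]
  apply norm_integral_le_of_norm_le hg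
  filter_upwards with y
  rw [Real.norm_eq_abs, abs_mul, abs_of_nonneg (wt_nonneg j y)]
  by_cases hy : ‖y‖ ≤ 1
  · exact mul_le_mul_of_nonneg_right (hfg y hy) (wt_nonneg j y)
  · simp [wt_eq_zero hj (not_le.1 hy).le]

/-- error terms from the radial deviation -/
lemma Good.err1 {L : ℝ≥0} {U : E → ℝ} {U' : E → E} (h : Good L U U') (a : E) (k : ℕ) {j : ℕ}
    (hj : j ≠ 0) {η : ℝ} (hη : 0 < η) :
    |∫ y, (inner ℝ a y) ^ k * ndev U U' y * wt j y| ≤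
      (‖a‖ ^ k * wvol n) * η + ‖a‖ ^ k * nsq U U' / η := by
  have cU := h.cont
  have cU' := h.lip.continuous
  have cN := ndev_continuous cU cU'
  have hcont : Continuous fun y => ‖a‖ ^ k * (η + ndev U U' y ^ 2 / η) := by fun_prop
  have h1 := abs_integral_wt_le (f := fun y => (inner ℝ a y) ^ k * ndev U U' y)
    (integrable_mul_wt hcont hj) (fun y hy => by
      rw [abs_mul]
      apply mul_le_mul (pw_abs_le a k hy) _ (abs_nonneg _) (by positivity)
      set N := ndev U U' y
      rw [← sub_nonneg]
      have : η + N ^ 2 / η - |N| = ((η - |N|) ^ 2 + η * |N|) / η := by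
        rw [← sq_abs N]; field_simp; ring
      rw [this]
      positivity) hj
  refine h1.trans ?_
  have h2 : ∫ y, ‖a‖ ^ k * (η + ndev U U' y ^ 2 / η) * wt j y ≤
      ∫ y, ‖a‖ ^ k * (η + ndev U U' y ^ 2 / η) * wt 1 y := by
    apply integral_mono (integrable_mul_wt hcont hj) (integrable_mul_wt hcont one_ne_zero)
    intro y
    apply mul_le_mul_of_nonneg_left (wt_anti (by omega) y)
    positivity
  refine h2.trans (le_of_eq ?_)
  unfold wvol nsq
  have e : ∫ y, ‖a‖ ^ k * (η + ndev U U' y ^ 2 / η) * wt 1 y =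
      ∫ y : E, ((‖a‖ ^ k * η) * wt 1 y + (‖a‖ ^ k / η) * (ndev U U' y ^ 2 * wt 1 y)) := by
    congr 1; ext y; field_simp
  rw [e, integral_add ((integrable_wt one_ne_zero).const_mul _)
    ((integrable_mul_wt (by fun_prop) one_ne_zero).const_mul _), integral_const_mul,
    integral_const_mul]
  ring

/-- the isotropic matrix -/
def pZero (n : ℕ) : Matrix (Fin n) (Fin n) ℝ := (1 / (n : ℝ)) • 1

lemma quadForm_pZero (y : E) : quadForm (pZero n) y = ‖y‖ ^ 2 / (2 * n) := by
  unfold quadForm pZero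
  rw [EuclideanSpace.real_norm_sq_eq]
  have : ∀ i : Fin n, ∑ j, ((1 / (n : ℝ)) • (1 : Matrix (Fin n) (Fin n) ℝ)) i j * y i * y j =
      1 / n * (y i) ^ 2 := by
    intro i
    rw [Finset.sum_eq_single i]
    · simp; ring
    · intro j _ hj
      simp [Matrix.one_apply, hj.symm]
    · simp
  rw [Finset.sum_congr rfl fun i _ => this i, ← Finset.mul_sum]
  ring

lemma memP_pZero (hn : n ≠ 0) : MemP (pZero n) := by
  have hn' : (n : ℝ) ≠ 0 := by exact_mod_cast hn
  refine ⟨?_, ?_⟩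
  · exact Matrix.PosSemidef.one.smul (by positivity)
  · simp [pZero, Matrix.trace_smul, hn']

lemma Good.err2 (hn : n ≠ 0) {L : ℝ≥0} {U : E → ℝ} {U' : E → E} (h : Good L U U') (a : E) {k : ℕ} (hk : k ≠ 0)
    {j : ℕ} (hj : j ≠ 0) {η : ℝ} (hη : 0 < η) :
    |∫ y, (inner ℝ a y) ^ k * cind U y * wt (j + 1) y| ≤
      (‖a‖ ^ k * wvol n) * η + (‖a‖ ^ k * (2 * n)) * qcon U (pZero n) / η := by
  have cU := h.cont
  have hj1 : j + 1 ≠ 0 := by omega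
  have hn' : (n : ℝ) ≠ 0 := by exact_mod_cast hn
  have hintg : ∀ i ≠ 0, Integrable fun y : E => ‖a‖ ^ k * (η + ‖y‖ ^ 2 / η * cind U y) * wt i y := by
    intro i hi
    have := ((integrable_wt (n := n) hi).const_mul (‖a‖ ^ k * η)).add
      (integrable_cind (v := fun y => ‖a‖ ^ k * (‖y‖ ^ 2 / η)) cU (by fun_prop) hi)
    refine this.congr ?_
    filter_upwards with y
    simp only [Pi.add_apply]
    ring
  have h1 := abs_integral_wt_le (f := fun y => (inner ℝ a y) ^ k * cind U y)
    (hintg _ hj1) (fun y hy => by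
      have c0 := cind_nonneg U y
      have c1 := cind_le_one U y
      have ya : 0 ≤ ‖y‖ := norm_nonneg y
      rw [abs_mul, abs_of_nonneg c0]
      have p1 : |(inner ℝ a y) ^ k| ≤ ‖a‖ ^ k * ‖y‖ := by
        rw [abs_pow]
        calc |inner ℝ a y| ^ k ≤ (‖a‖ * ‖y‖) ^ k := by
              apply pow_le_pow_left₀ (abs_nonneg _) (abs_real_inner_le_norm _ _)
          _ = ‖a‖ ^ k * ‖y‖ ^ k := mul_pow _ _ _
          _ ≤ ‖a‖ ^ k * ‖y‖ := by
              gcongr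
              exact pow_le_of_le_one ya hy hk
      calc |(inner ℝ a y) ^ k| * cind U y ≤ ‖a‖ ^ k * ‖y‖ * cind U y := by gcongr
        _ = ‖a‖ ^ k * (‖y‖ * cind U y) := by ring
        _ ≤ _ := by
          gcongr
          have : ‖y‖ ≤ η + ‖y‖ ^ 2 / η := by
            rw [← sub_nonneg]
            have : η + ‖y‖ ^ 2 / η - ‖y‖ = ((η - ‖y‖) ^ 2 + η * ‖y‖) / η := by
              field_simp; ring
            rw [this]
            positivity
          calc ‖y‖ * cind U y ≤ (η + ‖y‖ ^ 2 / η) * cind U y := by gcongr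
            _ = η * cind U y + ‖y‖ ^ 2 / η * cind U y := by ring
            _ ≤ _ := by nlinarith) hj1
  refine h1.trans ?_
  have h2 : ∫ y, ‖a‖ ^ k * (η + ‖y‖ ^ 2 / η * cind U y) * wt (j + 1) y ≤
      ∫ y, ‖a‖ ^ k * (η + ‖y‖ ^ 2 / η * cind U y) * wt 2 y := by
    apply integral_mono (hintg _ hj1) (hintg _ two_ne_zero)
    intro y
    apply mul_le_mul_of_nonneg_left (wt_anti (by omega) y)
    have c0 := cind_nonneg U y
    positivity
  refine h2.trans ?_
  unfold qcon
  have e : ∫ y, ‖a‖ ^ k * (η + ‖y‖ ^ 2 / η * cind U y) * wt 2 y =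
      ∫ y : E, ((‖a‖ ^ k * η) * wt 2 y +
        (‖a‖ ^ k * (2 * n) / η) * (quadForm (pZero n) y * cind U y * wt 2 y)) := by
    congr 1; ext y; rw [quadForm_pZero]; field_simp
  rw [e, integral_add ((integrable_wt two_ne_zero).const_mul _)
    ((integrable_cind cU (quadForm_continuous _) two_ne_zero).const_mul _), integral_const_mul,
    integral_const_mul]
  have := integral_wt_le (n := n) two_ne_zero
  have h3 : ‖a‖ ^ k * η * ∫ y : E, wt 2 y ≤ ‖a‖ ^ k * η * wvol n := by gcongr
  have h4 : ∀ I : ℝ, (‖a‖ ^ k * (2 * n) / η) * I = ‖a‖ ^ k * (2 * n) * I / η := by intro I; ring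
  rw [h4]
  linarith

end ident


/-! ### Classification of blow-ups: moments -/

section classify
variable {n : ℕ}
local notation "E" => EuclideanSpace ℝ (Fin n)

lemma quadForm_polar {A : Matrix (Fin n) (Fin n) ℝ} (hA : A.IsSymm) (x y : E) :
    quadForm A (x + y) = quadForm A x + quadForm A y + inner ℝ x (aop A y) := by
  simp only [quadForm_eq, map_add, inner_add_left, inner_add_right]
  have := aop_symm hA x y
  rw [real_inner_comm y (aop A x)] at *
  rw [this, real_inner_comm (aop A x) y]
  ring

lemma quadForm_smul (A : Matrix (Fin n) (Fin n) ℝ) (t : ℝ) (y : E) :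
    quadForm A (t • y) = t ^ 2 * quadForm A y := by
  simp only [quadForm_eq, map_smul, inner_smul_left, inner_smul_right]
  simp
  ring

lemma aop_inj {A B : Matrix (Fin n) (Fin n) ℝ} (h : ∀ y : E, aop A y = aop B y) : A = B := by
  ext i j
  have := congrArg (fun v : E => v i) (h (EuclideanSpace.single j 1))
  simpa [aop_apply] using this

lemma eq_of_quadForm_ball {A B : Matrix (Fin n) (Fin n) ℝ} (hA : A.IsSymm) (hB : B.IsSymm)
    {r : ℝ} (hr : 0 < r) (h : ∀ y : E, ‖y‖ < r → quadForm A y = quadForm B y) : A = B := by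
  have h1 : ∀ y : E, quadForm A y = quadForm B y := by
    intro y
    have h2 : 0 < r / (‖y‖ + 1) := by positivity
    have h3 := h ((r / (‖y‖ + 1)) • y) (by
      rw [norm_smul, Real.norm_of_nonneg h2.le, div_mul_eq_mul_div, div_lt_iff₀ (by positivity)]
      nlinarith [norm_nonneg y])
    rw [quadForm_smul, quadForm_smul] at h3
    exact mul_left_cancel₀ (by positivity) h3
  apply aop_inj
  intro y
  apply ext_inner_left ℝ
  intro x
  have h4 := quadForm_polar hA x y
  have h5 := quadForm_polar hB x y
  linarith [h1 x, h1 y, h1 (x + y)]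

lemma zero_of_int {f : E → ℝ} (hf : Continuous f) (h : ∫ y, (f y) ^ 2 * wt 1 y = 0) :
    ∀ y, ‖y‖ < 1 → f y = 0 := by
  have h0 : 0 ≤ fun y : E => (f y) ^ 2 * wt 1 y :=
    fun y => mul_nonneg (sq_nonneg _) (wt_nonneg _ _)
  rw [integral_eq_zero_iff_of_nonneg h0 (integrable_mul_wt (hf.pow 2) one_ne_zero)] at h
  have hc : Continuous fun y : E => (f y) ^ 2 * wt 1 y := (hf.pow 2).mul (wt_continuous 1)
  have h2 := (Continuous.ae_eq_iff_eq (volume : Measure E) hc continuous_zero).1 h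
  intro y hy
  have h3 := congrFun h2 y
  simp only [Pi.zero_apply, mul_eq_zero, pow_eq_zero_iff, ne_eq, OfNat.ofNat_ne_zero,
    not_false_eq_true] at h3
  rcases h3 with h3 | h3
  · exact h3
  · exact absurd h3 (wt_pos hy).ne'

lemma exists_proj {V : Type*} [AddCommGroup V] [Module ℝ V] [FiniteDimensional ℝ V]
    (Q : V →ₗ[ℝ] (E → ℝ)) (hc : ∀ T, Continuous (Q T))
    (hinj : ∀ T, (∀ y, ‖y‖ < 1 → Q T y = 0) → T = 0) {f : E → ℝ} (hf : Continuous f) :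
    ∃ T, ∀ S, ∫ y, (f y - Q T y) * Q S y * wt 1 y = 0 := by
  have hintg : ∀ g : E → ℝ, Continuous g → ∀ S, Integrable fun y => g y * Q S y * wt 1 y :=
    fun g hg S => integrable_mul_wt (hg.mul (hc S)) one_ne_zero
  let lin : ∀ g : E → ℝ, Continuous g → Module.Dual ℝ V := fun g hg =>
    { toFun := fun S => ∫ y, g y * Q S y * wt 1 y
      map_add' := by
        intro S T
        rw [← integral_add (hintg g hg S) (hintg g hg T)]
        congr 1; ext y
        simp only [map_add, Pi.add_apply]; ring
      map_smul' := by
        intro c S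
        rw [RingHom.id_apply, smul_eq_mul, ← integral_const_mul]
        congr 1; ext y
        simp only [map_smul, Pi.smul_apply, smul_eq_mul]; ring }
  let Φ : V →ₗ[ℝ] Module.Dual ℝ V :=
    { toFun := fun T => lin (Q T) (hc T)
      map_add' := by
        intro S T
        ext R
        show ∫ y, Q (S + T) y * Q R y * wt 1 y = (∫ y, Q S y * Q R y * wt 1 y) +
          ∫ y, Q T y * Q R y * wt 1 y
        rw [← integral_add (hintg _ (hc S) R) (hintg _ (hc T) R)]
        congr 1; ext y
        simp only [map_add, Pi.add_apply]; ring
      map_smul' := by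
        intro c T
        ext R
        show ∫ y, Q (c • T) y * Q R y * wt 1 y = c * ∫ y, Q T y * Q R y * wt 1 y
        rw [← integral_const_mul]
        congr 1; ext y
        simp only [map_smul, Pi.smul_apply, smul_eq_mul]; ring }
  have hΦ : Function.Injective Φ := by
    rw [injective_iff_map_eq_zero]
    intro T hT
    apply hinj
    apply zero_of_int (hc T)
    have : Φ T T = 0 := by rw [hT]; rfl
    rw [← this]
    show _ = ∫ y, Q T y * Q T y * wt 1 y
    congr 1; ext y; ring
  have hs := (LinearMap.injective_iff_surjective_of_finrank_eq_finrank
    (Subspace.dual_finrank_eq (K := ℝ) (V := V)).symm).1 hΦ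
  obtain ⟨T, hT⟩ := hs (lin f hf)
  refine ⟨T, fun S => ?_⟩
  have h1 : ∫ y, Q T y * Q S y * wt 1 y = ∫ y, f y * Q S y * wt 1 y :=
    congrArg (fun g : Module.Dual ℝ V => g S) hT
  rw [← sub_eq_zero.2 h1.symm, ← integral_sub (hintg f hf S) (hintg _ (hc T) S)]
  congr 1; ext y; ring

/-- choice of the quadratic polynomial -/
lemma exists_quad (hn : n ≠ 0) {v : E → ℝ} (hv : Continuous v) :
    ∃ B : Matrix (Fin n) (Fin n) ℝ, B.IsSymm ∧ B.trace = 1 ∧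
      ∀ S : Matrix (Fin n) (Fin n) ℝ, S.IsSymm → S.trace = 0 →
        ∫ y, (v y - quadForm B y) * quadForm S y * wt 1 y = 0 := by
  let V : Submodule ℝ (Matrix (Fin n) (Fin n) ℝ) :=
    { carrier := {S | S.IsSymm ∧ S.trace = 0}
      add_mem' := by
        rintro a b ⟨h1, h2⟩ ⟨h3, h4⟩
        exact ⟨h1.add h3, by rw [Matrix.trace_add, h2, h4, add_zero]⟩
      zero_mem' := ⟨Matrix.isSymm_zero, Matrix.trace_zero _ _⟩
      smul_mem' := by
        rintro c a ⟨h1, h2⟩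
        exact ⟨h1.smul c, by rw [Matrix.trace_smul, h2, smul_zero]⟩ }
  let Q : V →ₗ[ℝ] (E → ℝ) :=
    { toFun := fun T => quadForm (T : Matrix (Fin n) (Fin n) ℝ)
      map_add' := by
        intro S T
        ext y
        simp only [quadForm, Pi.add_apply, Submodule.coe_add, Matrix.add_apply, add_mul,
          Finset.sum_add_distrib, mul_add]
      map_smul' := by
        intro c S
        ext y
        simp only [quadForm, Pi.smul_apply, Submodule.coe_smul, Matrix.smul_apply, smul_eq_mul,
          RingHom.id_apply, Finset.mul_sum]
        refine Finset.sum_congr rfl fun i _ => Finset.sum_congr rfl fun j _ => ?_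
        ring }
  obtain ⟨T, hT⟩ := exists_proj Q (fun T => quadForm_continuous _) (by
    intro T h
    apply Subtype.ext
    refine eq_of_quadForm_ball T.2.1 (0 : V).2.1 one_pos (fun y hy => ?_)
    have := h y hy
    have e0 : quadForm ((0 : V) : Matrix (Fin n) (Fin n) ℝ) y = 0 := by
      simp [quadForm]
    rw [e0]
    exact this) (hv.sub (quadForm_continuous (pZero n)))
  refine ⟨pZero n + (T : Matrix (Fin n) (Fin n) ℝ), (memP_pZero hn).symm.add T.2.1, ?_, ?_⟩
  · rw [Matrix.trace_add, (memP_pZero hn).2, T.2.2, add_zero]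
  · intro S hS hS'
    rw [← hT ⟨S, hS, hS'⟩]
    congr 1; ext y
    have e : quadForm (pZero n + (T : Matrix (Fin n) (Fin n) ℝ)) y = quadForm (pZero n) y + quadForm (T : Matrix (Fin n) (Fin n) ℝ) y := by
      simp only [quadForm, Matrix.add_apply, add_mul, Finset.sum_add_distrib, mul_add]
    rw [e]
    show _ = (v y - quadForm (pZero n) y - quadForm (T : Matrix (Fin n) (Fin n) ℝ) y) * quadForm S y * wt 1 y
    ring

lemma tendsto_mom {L : ℝ≥0} {U : ℕ → E → ℝ} (hU : ∀ k, Continuous (U k))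
    (hb : ∀ k y, ‖y‖ ≤ 1 → |U k y| ≤ L) {v : E → ℝ}
    (hlim : ∀ y, ‖y‖ ≤ 1 → Tendsto (fun k => U k y) atTop (𝓝 (v y)))
    {q p : E → ℝ} (hq : Continuous q) (hp : Continuous p) {j : ℕ} (hj : j ≠ 0) :
    Tendsto (fun k => ∫ y, (U k y - q y) * p y * wt j y) atTop
      (𝓝 (∫ y, (v y - q y) * p y * wt j y)) := by
  apply tendsto_integral_of_dominated_convergence (fun y => ((L + |q y|) * |p y|) * wt j y)
  · intro k
    exact ((((hU k).sub hq).mul hp).mul (wt_continuous j)).aestronglyMeasurable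
  · exact integrable_mul_wt (by fun_prop) hj
  · intro k
    filter_upwards with y
    rw [Real.norm_eq_abs, abs_mul, abs_mul, abs_of_nonneg (wt_nonneg j y)]
    rcases le_total ‖y‖ 1 with hy | hy
    · have h1 := hb k y hy
      have h2 := abs_sub (U k y) (q y)
      have := wt_nonneg j y
      gcongr
      linarith
    · rw [wt_eq_zero hj hy]; simp
  · filter_upwards with y
    rcases le_total ‖y‖ 1 with hy | hy
    · exact (((hlim y hy).sub_const _).mul_const _).mul_const _
    · rw [wt_eq_zero hj hy]; simp

lemma mom_rel (hn : n ≠ 0) {L : ℝ≥0} {U : ℕ → E → ℝ} {U' : ℕ → E → E}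
    (hG : ∀ k, Good L (U k) (U' k))
    (h1 : Tendsto (fun k => nsq (U k) (U' k)) atTop (𝓝 0))
    (h2 : Tendsto (fun k => qcon (U k) (pZero n)) atTop (𝓝 0)) {v : E → ℝ}
    (hlim : ∀ y, ‖y‖ ≤ 1 → Tendsto (fun k => U k y) atTop (𝓝 (v y)))
    {B : Matrix (Fin n) (Fin n) ℝ} (hB : B.IsSymm) (hBt : B.trace = 1) (a : E) {i j : ℕ}
    (hj : j ≠ 0) (hi : i ≠ 0) :
    (i * ((i : ℝ) - 1) * ‖a‖ ^ 2) *
      (∫ y, (v y - quadForm B y) * (inner ℝ a y) ^ (i - 2) * wt (j + 1) y) =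
    2 * ((j : ℝ) + 1) * ((i : ℝ) - 2) * (∫ y, (v y - quadForm B y) * (inner ℝ a y) ^ i * wt j y) := by
  have T1 := tendsto_mom (fun k => (hG k).cont) (fun k y hy => (hG k).abs_le_one hy) hlim
    (quadForm_continuous B) (p := fun y => (inner ℝ a y) ^ (i - 2)) (by fun_prop) (j := j + 1)
    (by omega)
  have T2 := tendsto_mom (fun k => (hG k).cont) (fun k y hy => (hG k).abs_le_one hy) hlim
    (quadForm_continuous B) (p := fun y => (inner ℝ a y) ^ i) (by fun_prop) hj
  have w0 := wvol_nonneg n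
  have T3 := tendsto_of_eta (X := fun k => ∫ y, (inner ℝ a y) ^ i * ndev (U k) (U' k) y * wt j y)
    (by positivity) (fun k η hη => (hG k).err1 a i hj hη) h1
  have T4 := tendsto_of_eta (X := fun k => ∫ y, (inner ℝ a y) ^ i * cind (U k) y * wt (j + 1) y)
    (by positivity) (fun k η hη => (hG k).err2 hn a hi hj hη) h2
  have T5 := T1.const_mul (i * ((i : ℝ) - 1) * ‖a‖ ^ 2)
  have T6 := ((T2.const_mul (2 * ((j : ℝ) + 1) * ((i : ℝ) - 2))).sub
    (T3.const_mul (2 * ((j : ℝ) + 1)))).sub T4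
  have e := fun k => (hG k).main_id hB hBt a i hj
  simp only [e] at T5
  have := tendsto_nhds_unique T5 T6
  simpa using this

lemma mom_rec {L : ℝ≥0} {U : ℕ → E → ℝ} {U' : ℕ → E → E}
    (hG : ∀ k, Good L (U k) (U' k))
    (h1 : Tendsto (fun k => nsq (U k) (U' k)) atTop (𝓝 0)) {v : E → ℝ}
    (hlim : ∀ y, ‖y‖ ≤ 1 → Tendsto (fun k => U k y) atTop (𝓝 (v y)))
    {B : Matrix (Fin n) (Fin n) ℝ} (hB : B.IsSymm) (a : E) (i : ℕ) {j : ℕ}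
    (hj : j ≠ 0) :
    ((n : ℝ) + i + 2 + 2 * ((j : ℝ) + 1)) *
      (∫ y, (v y - quadForm B y) * (inner ℝ a y) ^ i * wt (j + 1) y) =
    2 * ((j : ℝ) + 1) * (∫ y, (v y - quadForm B y) * (inner ℝ a y) ^ i * wt j y) := by
  have T1 := tendsto_mom (fun k => (hG k).cont) (fun k y hy => (hG k).abs_le_one hy) hlim
    (quadForm_continuous B) (p := fun y => (inner ℝ a y) ^ i) (by fun_prop) (j := j + 1)
    (by omega)
  have T2 := tendsto_mom (fun k => (hG k).cont) (fun k y hy => (hG k).abs_le_one hy) hlim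
    (quadForm_continuous B) (p := fun y => (inner ℝ a y) ^ i) (by fun_prop) hj
  have w0 := wvol_nonneg n
  have T3 := tendsto_of_eta
    (X := fun k => ∫ y, (inner ℝ a y) ^ i * ndev (U k) (U' k) y * wt (j + 1) y)
    (by positivity) (fun k η hη => (hG k).err1 a i (by omega) hη) h1
  have T5 := T1.const_mul ((n : ℝ) + i + 2 + 2 * ((j : ℝ) + 1))
  have T6 := (T2.const_mul (2 * ((j : ℝ) + 1))).sub T3
  have e := fun k => (hG k).rec_id hB a i hj
  simp only [e] at T5
  have := tendsto_nhds_unique T5 T6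
  simpa using this

/-- abstract vanishing of all moments -/
lemma mom_zero (hn : n ≠ 0) {f : E → ℝ} (hf : Continuous f)
    (hrel : ∀ (a : E) (i j : ℕ), j ≠ 0 → i ≠ 0 → (i * ((i : ℝ) - 1) * ‖a‖ ^ 2) *
      (∫ y, f y * (inner ℝ a y) ^ (i - 2) * wt (j + 1) y) =
    2 * ((j : ℝ) + 1) * ((i : ℝ) - 2) * (∫ y, f y * (inner ℝ a y) ^ i * wt j y))
    (hrec : ∀ (a : E) (i j : ℕ), j ≠ 0 → ((n : ℝ) + i + 2 + 2 * ((j : ℝ) + 1)) *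
      (∫ y, f y * (inner ℝ a y) ^ i * wt (j + 1) y) =
    2 * ((j : ℝ) + 1) * (∫ y, f y * (inner ℝ a y) ^ i * wt j y))
    (hquad : ∀ S : Matrix (Fin n) (Fin n) ℝ, S.IsSymm → S.trace = 0 →
        ∫ y, f y * quadForm S y * wt 1 y = 0) (a : E) :
    ∀ i : ℕ, ∫ y, f y * (inner ℝ a y) ^ i * wt 1 y = 0 := by
  -- all weights are equivalent
  have up : ∀ (a : E) (i j : ℕ), j ≠ 0 → ∫ y, f y * (inner ℝ a y) ^ i * wt j y = 0 →
      ∫ y, f y * (inner ℝ a y) ^ i * wt (j + 1) y = 0 := by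
    intro a i j hj h
    have := hrec a i j hj
    rw [h, mul_zero] at this
    rcases mul_eq_zero.1 this with h | h
    · exfalso
      have : (0:ℝ) < (n : ℝ) + i + 2 + 2 * ((j : ℝ) + 1) := by positivity
      linarith
    · exact h
  have ups : ∀ (a : E) (i : ℕ), ∫ y, f y * (inner ℝ a y) ^ i * wt 1 y = 0 →
      ∀ j : ℕ, ∫ y, f y * (inner ℝ a y) ^ i * wt (j + 1) y = 0 := by
    intro a i h j
    induction j with
    | zero => exact h
    | succ j ih => exact up a i (j + 1) (by omega) ih
  have down : ∀ (a : E) (i j : ℕ), j ≠ 0 → ∫ y, f y * (inner ℝ a y) ^ i * wt (j + 1) y = 0 →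
      ∫ y, f y * (inner ℝ a y) ^ i * wt j y = 0 := by
    intro a i j hj h
    have := hrec a i j hj
    rw [h, mul_zero] at this
    rcases mul_eq_zero.1 this.symm with h | h
    · exfalso
      have : (0:ℝ) < 2 * ((j : ℝ) + 1) := by positivity
      linarith
    · exact h
  haveI : Nonempty (Fin n) := ⟨⟨0, by omega⟩⟩
  let e0 : E := EuclideanSpace.single (Classical.arbitrary (Fin n)) 1
  have he0 : ‖e0‖ = 1 := by simp [e0]
  have m0 : ∫ y, f y * wt 1 y = 0 := by
    have h := hrel e0 2 1 one_ne_zero two_ne_zero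
    rw [he0] at h
    have h2 : ∫ y, f y * (inner ℝ e0 y) ^ 0 * wt (1 + 1) y = 0 := by
      norm_num at h
      simpa using h
    have h3 := down e0 0 1 one_ne_zero h2
    simpa using h3
  have m1 : ∫ y, f y * wt 2 y = 0 := by
    have := up e0 0 1 one_ne_zero (by simpa using m0)
    simpa using this
  have msq : ∫ y, f y * ‖y‖ ^ 2 * wt 1 y = 0 := by
    have : ∫ y, f y * ‖y‖ ^ 2 * wt 1 y = (∫ y, f y * wt 1 y) - ∫ y, f y * wt 2 y := by
      rw [← integral_sub (integrable_mul_wt hf one_ne_zero) (integrable_mul_wt hf two_ne_zero)]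
      congr 1; ext y
      rw [show (2:ℕ) = 1 + 1 from rfl, wt_succ_eq one_ne_zero]; ring
    rw [this, m0, m1, sub_zero]
  have mz : ∀ a : E, ∫ y, f y * (inner ℝ a y) ^ 2 * wt 1 y = 0 := by
    intro a
    have hn' : (n : ℝ) ≠ 0 := by exact_mod_cast hn
    let S : Matrix (Fin n) (Fin n) ℝ := Matrix.of (fun i j => a i * a j) - (‖a‖ ^ 2) • pZero n
    have hS : S.IsSymm := by
      apply Matrix.IsSymm.sub
      · ext i j; simp [Matrix.transpose_apply, mul_comm]
      · exact (memP_pZero hn).symm.smul _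
    have hS0 : S.trace = 0 := by
      rw [Matrix.trace_sub, Matrix.trace_smul, (memP_pZero hn).2, EuclideanSpace.real_norm_sq_eq]
      simp [Matrix.trace, sq]
    have hq : ∀ y : E, quadForm S y = (1/2) * (inner ℝ a y) ^ 2 - ‖a‖ ^ 2 * (‖y‖ ^ 2 / (2 * n)) := by
      intro y
      rw [quadForm_sub, ← quadForm_pZero]
      congr 1
      · unfold quadForm
        congr 1
        simp only [Matrix.of_apply, PiLp.inner_apply, RCLike.inner_apply, conj_trivial, sq,
          Finset.sum_mul, Finset.mul_sum]
        refine Finset.sum_congr rfl fun i _ => Finset.sum_congr rfl fun j _ => ?_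
        ring
      · unfold quadForm
        simp only [Matrix.smul_apply, smul_eq_mul, Finset.mul_sum]
        refine Finset.sum_congr rfl fun i _ => Finset.sum_congr rfl fun j _ => ?_
        ring
    have h := hquad S hS hS0
    have e : ∀ y, f y * quadForm S y * wt 1 y = (1/2) * (f y * (inner ℝ a y) ^ 2 * wt 1 y) -
        (‖a‖ ^ 2 / (2 * n)) * (f y * ‖y‖ ^ 2 * wt 1 y) := by
      intro y; rw [hq]; ring
    simp only [e] at h
    have I1 : Integrable fun y => f y * (inner ℝ a y) ^ 2 * wt 1 y :=
      integrable_mul_wt (by fun_prop) one_ne_zero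
    have I2 : Integrable fun y => f y * ‖y‖ ^ 2 * wt 1 y :=
      integrable_mul_wt (by fun_prop) one_ne_zero
    rw [integral_sub (I1.const_mul _) (I2.const_mul _), integral_const_mul, integral_const_mul,
      msq] at h
    linarith
  intro i
  induction i using Nat.strong_induction_on with
  | _ i ih =>
    rcases Nat.lt_or_ge i 3 with hi | hi
    · interval_cases i
      · simpa using m0
      · have h := hrel a 1 1 one_ne_zero one_ne_zero
        norm_num at h
        simpa using h
      · exact mz a
    · have h := hrel a i 1 one_ne_zero (by omega)
      rw [ups a (i - 2) (ih (i - 2) (by omega)) 1, mul_zero] at h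
      rcases mul_eq_zero.1 h.symm with h | h
      · exfalso
        have : (3 : ℝ) ≤ i := by exact_mod_cast hi
        have h3 : (0:ℝ) < (i : ℝ) - 2 := by linarith
        have : 0 < 2 * (((1:ℕ) : ℝ) + 1) * ((i : ℝ) - 2) := by positivity
        linarith
      · exact h

lemma exp_mom {f : E → ℝ} (hf : Continuous f) (a : E)
    (h : ∀ i : ℕ, ∫ y, f y * (inner ℝ a y) ^ i * wt 1 y = 0) :
    ∫ y, f y * Real.exp (inner ℝ a y) * wt 1 y = 0 := by
  have key := hasSum_integral_of_dominated_convergence (μ := (volume : Measure E))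
    (F := fun (i : ℕ) (y : E) => f y * ((inner ℝ a y) ^ i / (i.factorial : ℝ)) * wt 1 y)
    (f := fun y => f y * Real.exp (inner ℝ a y) * wt 1 y)
    (fun i y => (|f y| * wt 1 y) * (‖a‖ ^ i / (i.factorial : ℝ)))
    (fun i => by
      apply Continuous.aestronglyMeasurable
      have := wt_continuous (n := n) 1
      fun_prop)
    (fun i => by
      filter_upwards with y
      rw [norm_mul, norm_mul, Real.norm_eq_abs, Real.norm_eq_abs, Real.norm_of_nonneg (wt_nonneg 1 y)]
      rcases le_total ‖y‖ 1 with hy | hy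
      · have h1 := pw_abs_le a i hy
        have h2 := wt_nonneg 1 y
        rw [abs_div, abs_of_nonneg (by positivity : (0:ℝ) ≤ (i.factorial : ℝ)), mul_right_comm]
        gcongr
      · rw [wt_eq_zero one_ne_zero hy]; simp)
    (by
      filter_upwards with y
      exact (Real.summable_pow_div_factorial ‖a‖).mul_left _)
    (by
      simp only [tsum_mul_left]
      exact (integrable_mul_wt hf.abs one_ne_zero).mul_const _)
    (by
      filter_upwards with y
      have := NormedSpace.expSeries_div_hasSum_exp (𝔸 := ℝ) (inner ℝ a y)
      rw [← Real.exp_eq_exp_ℝ] at this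
      exact (this.mul_left (f y)).mul_right (wt 1 y))
  have e : ∀ i : ℕ, ∫ y, f y * ((inner ℝ a y) ^ i / (i.factorial : ℝ)) * wt 1 y = 0 := by
    intro i
    have : ∀ y, f y * ((inner ℝ a y) ^ i / (i.factorial : ℝ)) * wt 1 y =
        (f y * (inner ℝ a y) ^ i * wt 1 y) * (1 / (i.factorial : ℝ)) := by
      intro y; ring
    simp only [this]
    rw [integral_mul_const, h, zero_mul]
  simp only [e] at key
  exact key.unique hasSum_zero

lemma exp_dense {f : E → ℝ} (hf : Continuous f)
    (h : ∀ a : E, ∫ y, f y * Real.exp (inner ℝ a y) * wt 1 y = 0) :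
    ∀ y, ‖y‖ < 1 → f y = 0 := by
  let X := closedBall (0 : E) 1
  haveI : CompactSpace X := isCompact_iff_compactSpace.1 (isCompact_closedBall 0 1)
  let ee : E → C(X, ℝ) := fun a => ⟨fun y => Real.exp (inner ℝ a (y : E)), by fun_prop⟩
  let S : Submonoid C(X, ℝ) :=
    { carrier := range ee
      mul_mem' := by
        rintro _ _ ⟨a, rfl⟩ ⟨b, rfl⟩
        refine ⟨a + b, ?_⟩
        ext y
        simp [ee, inner_add_left, Real.exp_add]
      one_mem' := ⟨0, by ext y; simp [ee]⟩ }
  let A : Subalgebra ℝ C(X, ℝ) := Algebra.adjoin ℝ (S : Set C(X, ℝ))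
  have hA : A.SeparatesPoints := by
    intro x y hxy
    refine ⟨ee ((x : E) - y), ⟨ee ((x : E) - y), Algebra.subset_adjoin ⟨_, rfl⟩, rfl⟩, ?_⟩
    intro h
    have h1 : inner ℝ ((x : E) - y) (x : E) = inner ℝ ((x : E) - y) (y : E) := Real.exp_injective h
    have h2 : inner ℝ ((x : E) - y) ((x : E) - y) = 0 := by
      rw [inner_sub_right, h1, sub_self]
    exact hxy (Subtype.ext (sub_eq_zero.1 (inner_self_eq_zero.1 h2)))
  have hP : ∀ g ∈ A, ∃ G : E → ℝ, Continuous G ∧ (∀ y : X, G y = g y) ∧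
      ∫ y, f y * G y * wt 1 y = 0 := by
    intro g hg
    have hg' : g ∈ Submodule.span ℝ (S : Set C(X, ℝ)) := by
      have := Algebra.adjoin_eq_span ℝ (S : Set C(X, ℝ))
      rw [Submonoid.closure_eq] at this
      rw [← this]; exact hg
    induction hg' using Submodule.span_induction with
    | mem g hgS =>
      obtain ⟨a, rfl⟩ := hgS
      exact ⟨fun y => Real.exp (inner ℝ a y), by fun_prop, fun y => rfl, h a⟩
    | zero => exact ⟨0, continuous_zero, fun y => rfl, by simp⟩
    | add x y hx hy h1 h2 =>
      have mem : ∀ z, z ∈ Submodule.span ℝ (S : Set C(X, ℝ)) → z ∈ A := by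
        intro z hz
        have := Algebra.adjoin_eq_span ℝ (S : Set C(X, ℝ))
        rw [Submonoid.closure_eq] at this
        rw [← this] at hz; exact hz
      obtain ⟨G1, c1, e1, i1⟩ := h1 (mem x hx)
      obtain ⟨G2, c2, e2, i2⟩ := h2 (mem y hy)
      refine ⟨fun y => G1 y + G2 y, c1.add c2, fun y => by simp [e1, e2], ?_⟩
      have I1 : Integrable fun y => f y * G1 y * wt 1 y := integrable_mul_wt (hf.mul c1) one_ne_zero
      have I2 : Integrable fun y => f y * G2 y * wt 1 y := integrable_mul_wt (hf.mul c2) one_ne_zero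
      simp only [mul_add, add_mul]
      rw [integral_add I1 I2]
      show (∫ y, f y * G1 y * wt 1 y) + (∫ y, f y * G2 y * wt 1 y) = 0
      rw [i1, i2, add_zero]
    | smul c x hx h1 =>
      have mem : ∀ z, z ∈ Submodule.span ℝ (S : Set C(X, ℝ)) → z ∈ A := by
        intro z hz
        have := Algebra.adjoin_eq_span ℝ (S : Set C(X, ℝ))
        rw [Submonoid.closure_eq] at this
        rw [← this] at hz; exact hz
      obtain ⟨G1, c1, e1, i1⟩ := h1 (mem x hx)
      refine ⟨fun y => c * G1 y, continuous_const.mul c1, fun y => by simp [e1], ?_⟩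
      have : ∀ y, f y * (c * G1 y) * wt 1 y = c * (f y * G1 y * wt 1 y) := fun y => by ring
      simp only [this]
      rw [integral_const_mul, i1, mul_zero]
  apply zero_of_int hf
  have hintg : Integrable fun y => |f y| * wt 1 y := integrable_mul_wt hf.abs one_ne_zero
  set C := ∫ y, |f y| * wt 1 y
  have hC : 0 ≤ C := integral_nonneg fun y => mul_nonneg (abs_nonneg _) (wt_nonneg _ _)
  have h0 : 0 ≤ ∫ y, (f y) ^ 2 * wt 1 y :=
    integral_nonneg fun y => mul_nonneg (sq_nonneg _) (wt_nonneg _ _)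
  apply le_antisymm _ h0
  apply le_of_forall_pos_le_add
  intro ε hε
  obtain ⟨g, hg⟩ := ContinuousMap.exists_mem_subalgebra_near_continuous_of_separatesPoints A hA
    (fun y : X => f y) (by fun_prop) (ε / (C + 1)) (by positivity)
  obtain ⟨G, cG, eG, iG⟩ := hP g g.2
  have h3 : ∫ y, (f y) ^ 2 * wt 1 y = ∫ y, ((f y) * (f y - G y)) * wt 1 y := by
    have I1 : Integrable fun y => f y * f y * wt 1 y := integrable_mul_wt (hf.mul hf) one_ne_zero
    have I2 : Integrable fun y => f y * G y * wt 1 y := integrable_mul_wt (hf.mul cG) one_ne_zero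
    have : ∫ y, ((f y) * (f y - G y)) * wt 1 y =
        (∫ y, f y * f y * wt 1 y) - ∫ y, f y * G y * wt 1 y := by
      rw [← integral_sub I1 I2]
      congr 1; ext y; ring
    rw [this, iG, sub_zero]
    congr 1; ext y; ring
  have h4 : |∫ y, ((f y) * (f y - G y)) * wt 1 y| ≤ ∫ y, (ε / (C + 1) * |f y|) * wt 1 y := by
    apply abs_integral_wt_le _ _ one_ne_zero
    · simp only [mul_assoc]
      exact hintg.const_mul _
    · intro y hy
      have := hg ⟨y, by simpa [X] using hy⟩
      rw [abs_mul, mul_comm]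
      gcongr
      rw [abs_sub_comm]
      have e := eG ⟨y, by simpa [X] using hy⟩
      rw [← e] at this
      exact this.le
  have h5 : ∫ y, (ε / (C + 1) * |f y|) * wt 1 y = ε / (C + 1) * C := by
    simp only [mul_assoc]
    rw [integral_const_mul]
  rw [h5] at h4
  rw [h3, zero_add]
  refine (le_abs_self _).trans (h4.trans ?_)
  rw [div_mul_eq_mul_div, div_le_iff₀ (by positivity)]
  nlinarith

/-- Classification of limits. -/
theorem classify (hn : n ≠ 0) {L : ℝ≥0} {U : ℕ → E → ℝ} {U' : ℕ → E → E}
    (hG : ∀ k, Good L (U k) (U' k))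
    (h1 : Tendsto (fun k => nsq (U k) (U' k)) atTop (𝓝 0))
    (h2 : Tendsto (fun k => qcon (U k) (pZero n)) atTop (𝓝 0)) {v : E → ℝ} (hv : Continuous v)
    (hlim : ∀ y, ‖y‖ ≤ 1 → Tendsto (fun k => U k y) atTop (𝓝 (v y))) :
    ∃ B : Matrix (Fin n) (Fin n) ℝ, MemP B ∧ Tendsto (fun k => hfun (U k) B) atTop (𝓝 0) := by
  obtain ⟨B, hB, hBt, hBq⟩ := exists_quad hn hv
  have hz : ∀ y, ‖y‖ < 1 → v y - quadForm B y = 0 := by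
    apply exp_dense (f := fun y => v y - quadForm B y) (hv.sub (quadForm_continuous B))
    intro a
    apply exp_mom (f := fun y => v y - quadForm B y) (hv.sub (quadForm_continuous B))
    apply mom_zero hn (f := fun y => v y - quadForm B y) (hv.sub (quadForm_continuous B))
    · intro a i j hj hi
      exact mom_rel hn hG h1 h2 hlim hB hBt a hj hi
    · intro a i j hj
      exact mom_rec hG h1 hlim hB a i hj
    · exact hBq
  have hpos : ∀ y : E, 0 ≤ quadForm B y := by
    intro y
    have h2 : 0 < 1 / (‖y‖ + 1) := by positivity
    have hy : ‖(1 / (‖y‖ + 1)) • y‖ < 1 := by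
      rw [norm_smul, Real.norm_of_nonneg h2.le, div_mul_eq_mul_div, div_lt_iff₀ (by positivity)]
      nlinarith [norm_nonneg y]
    have h3 := hz _ hy
    rw [quadForm_smul] at h3
    have h4 : 0 ≤ v ((1 / (‖y‖ + 1)) • y) :=
      ge_of_tendsto' (hlim _ hy.le) (fun k => (hG k).nonneg _)
    have h5 : 0 ≤ (1 / (‖y‖ + 1)) ^ 2 * quadForm B y := by linarith
    exact nonneg_of_mul_nonneg_right h5 (by positivity)
  refine ⟨B, ⟨?_, hBt⟩, ?_⟩
  · rw [Matrix.posSemidef_iff_dotProduct_mulVec]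
    refine ⟨?_, ?_⟩
    · rwa [Matrix.IsHermitian, Matrix.conjTranspose_eq_transpose_of_trivial]
    · intro x
      have h3 := hpos (WithLp.toLp 2 x)
      unfold quadForm at h3
      simp only [dotProduct, Matrix.mulVec, star_trivial, Finset.mul_sum]
      have h4 : 0 ≤ ∑ i, ∑ j, B i j * x i * x j := by linarith
      refine h4.trans_eq ?_
      refine Finset.sum_congr rfl fun i _ => Finset.sum_congr rfl fun j _ => ?_
      ring
  · have : ∫ y, (v y - quadForm B y) ^ 2 * wt 1 y = 0 := by
      rw [← integral_zero E ℝ (μ := volume)]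
      congr 1; ext y
      rcases lt_or_ge ‖y‖ 1 with hy | hy
      · rw [hz y hy]; simp
      · rw [wt_eq_zero one_ne_zero hy, mul_zero]
    rw [← this]
    unfold hfun
    apply tendsto_integral_of_dominated_convergence (fun y => ((L + |quadForm B y|) ^ 2) * wt 1 y)
    · intro k
      exact ((((hG k).cont.sub (quadForm_continuous B)).pow 2).mul (wt_continuous 1)).aestronglyMeasurable
    · have := quadForm_continuous B
      exact integrable_mul_wt (by fun_prop) one_ne_zero
    · intro k
      filter_upwards with y
      rw [Real.norm_eq_abs, abs_mul, abs_pow, abs_of_nonneg (wt_nonneg 1 y)]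
      rcases le_total ‖y‖ 1 with hy | hy
      · have h1 := (hG k).abs_le_one hy
        have h2 := abs_sub (U k y) (quadForm B y)
        have := wt_nonneg 1 y
        gcongr
        linarith
      · rw [wt_eq_zero one_ne_zero hy]; simp
    · filter_upwards with y
      rcases le_total ‖y‖ 1 with hy | hy
      · exact (((hlim y hy).sub_const _).pow 2).mul_const _
      · rw [wt_eq_zero one_ne_zero hy]; simp

end classify


/-! ### Existence of blow-ups on a closed set -/

section blow
variable {n : ℕ} {L : ℝ≥0}
local notation "E" => EuclideanSpace ℝ (Fin n)

lemma Good.lipBall {U : E → ℝ} {U' : E → E} (h : Good L U U') {y z : E} (hy : ‖y‖ ≤ 1)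
    (hz : ‖z‖ ≤ 1) : |U z - U y| ≤ 3 * L * ‖z - y‖ := by
  have h1 := taylor2 h.grad h.lip y z
  have h2 := abs_real_inner_le_norm (U' y) (z - y)
  have h3 := h.grad_le y
  have hL : (0:ℝ) ≤ L := L.2
  have h4 : ‖z - y‖ ≤ 2 := (norm_sub_le _ _).trans (by linarith)
  have h5 : ‖U' y‖ * ‖z - y‖ ≤ L * ‖z - y‖ := by
    gcongr
    exact h3.trans (by nlinarith)
  have h6 : L * ‖z - y‖ ^ 2 ≤ 2 * L * ‖z - y‖ := by
    nlinarith [mul_nonneg hL (norm_nonneg (z - y))]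
  rw [_root_.abs_le] at *
  constructor <;> linarith [h1.1, h1.2, h2.1, h2.2]

lemma extract {U : ℕ → E → ℝ} {U' : ℕ → E → E} (hG : ∀ k, Good L (U k) (U' k)) :
    ∃ φ : ℕ → ℕ, StrictMono φ ∧ ∃ v : E → ℝ, Continuous v ∧
      ∀ y, ‖y‖ ≤ 1 → Tendsto (fun k => U (φ k) y) atTop (𝓝 (v y)) := by
  let X := closedBall (0 : E) 1
  haveI : CompactSpace X := isCompact_iff_compactSpace.1 (isCompact_closedBall 0 1)
  have hb : ∀ y : X, ‖(y : E)‖ ≤ 1 := fun y => mem_closedBall_zero_iff.1 y.2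
  let F : ℕ → BoundedContinuousFunction X ℝ := fun k =>
    BoundedContinuousFunction.mkOfCompact ⟨fun y => U k y, (hG k).cont.comp continuous_subtype_val⟩
  have hF : ∀ k (y : X), F k y = U k y := fun k y => rfl
  have hlip : ∀ k, LipschitzWith (3 * L) (fun y : X => F k y) := by
    intro k
    apply LipschitzWith.of_dist_le_mul
    intro y z
    rw [Real.dist_eq, hF, hF, Subtype.dist_eq, dist_eq_norm]
    exact (hG k).lipBall (hb z) (hb y)
  have hcpt := BoundedContinuousFunction.arzela_ascoli (Icc (-(L:ℝ)) L) isCompact_Icc (range F)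
    (by
      rintro _ y ⟨k, rfl⟩
      rw [hF, mem_Icc, ← _root_.abs_le]
      exact (hG k).abs_le_one (hb y))
    (by
      apply UniformEquicontinuous.equicontinuous
      apply LipschitzWith.uniformEquicontinuous _ (3 * L)
      rintro ⟨_, k, rfl⟩
      exact hlip k)
  obtain ⟨g, -, φ, hφ, hlim⟩ := hcpt.tendsto_subseq (x := F) (fun k => subset_closure ⟨k, rfl⟩)
  obtain ⟨v, hv⟩ := ContinuousMap.exists_restrict_eq (isClosed_closedBall (x := (0:E)) (ε := 1))
    g.toContinuousMap
  refine ⟨φ, hφ, v, v.continuous, fun y hy => ?_⟩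
  have e : v y = g ⟨y, by simpa [X] using hy⟩ := by
    have := congrArg (fun f : C(X, ℝ) => f ⟨y, by simpa [X] using hy⟩) hv
    exact this
  rw [e]
  rw [BoundedContinuousFunction.tendsto_iff_tendstoUniformly] at hlim
  exact hlim.tendsto_at ⟨y, by simpa [X] using hy⟩

variable {x0 : EuclideanSpace ℝ (Fin n)} {ρ : ℝ}
  {u : EuclideanSpace ℝ (Fin n) → ℝ} {u' : EuclideanSpace ℝ (Fin n) → EuclideanSpace ℝ (Fin n)}

/-- The closed set of points with nonnegative Weiss energy. -/
def sset (u : EuclideanSpace ℝ (Fin n) → ℝ)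
    (u' : EuclideanSpace ℝ (Fin n) → EuclideanSpace ℝ (Fin n)) (x0 : EuclideanSpace ℝ (Fin n))
    (r0 : ℝ) : Set (EuclideanSpace ℝ (Fin n)) :=
  {x | dist x x0 ≤ r0 ∧ u x = 0 ∧
    ∀ s, 0 < s → s ≤ r0 → 0 ≤ gfun (sclU u x s) (sclD u' x s) (pZero n)}

lemma sset_gfun (hn : n ≠ 0) (h : Loc L x0 ρ u u') {r0 : ℝ} (hr : 2 * r0 ≤ ρ) {x : E}
    (hx : x ∈ sset u u' x0 r0) {A : Matrix (Fin n) (Fin n) ℝ} (hA : MemP A) {s : ℝ} (hs : 0 < s)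
    (hs' : s ≤ r0) : 0 ≤ gfun (sclU u x s) (sclD u' x s) A := by
  obtain ⟨h1, h2, h3⟩ := hx
  rw [gfun_indep (h.good hs (by linarith) h2) hA.symm (memP_pZero hn).symm hA.2 (memP_pZero hn).2]
  exact h3 s hs hs'

lemma sset_mono (hn : n ≠ 0) (h : Loc L x0 ρ u u') {r0 : ℝ} (hr : 2 * r0 ≤ ρ) {x : E}
    (hx : x ∈ sset u u' x0 r0) {A : Matrix (Fin n) (Fin n) ℝ} (hA : MemP A) {s t : ℝ} (hs : 0 < s)
    (hst : s ≤ t) (ht : t ≤ r0) : hfun (sclU u x s) A ≤ hfun (sclU u x t) A :=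
  h.hfun_mono hs hst (by linarith [hx.1]) hx.2.1 hA
    (fun r h1 h2 => sset_gfun hn h hr hx hA h1 (h2.trans ht))

/-- blow-ups exist along all scales -/
lemma sset_blow (hn : n ≠ 0) (h : Loc L x0 ρ u u') {r0 : ℝ} (hr0 : 0 < r0) (hr : 2 * r0 ≤ ρ) {x : E}
    (hx : x ∈ sset u u' x0 r0) : ∃ B : Matrix (Fin n) (Fin n) ℝ, MemP B ∧
      ∀ ε > 0, ∃ s0, 0 < s0 ∧ s0 ≤ r0 ∧ ∀ s, 0 < s → s ≤ s0 → hfun (sclU u x s) B < ε := by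
  have h1 : ∀ k : ℕ, ∃ s, 0 < s ∧ s ≤ r0 ∧
      nsq (sclU u x s) (sclD u' x s) + qcon (sclU u x s) (pZero n) < 1 / ((k : ℝ) + 1) := by
    intro k
    exact h.exists_small hr0 (by linarith [hx.1]) hx.2.1 (memP_pZero hn)
      (fun r h1 h2 => sset_gfun hn h hr hx (memP_pZero hn) h1 h2) (by positivity)
  choose s hs hs' hsm using h1
  have hG : ∀ k, Good L (sclU u x (s k)) (sclD u' x (s k)) :=
    fun k => h.good (hs k) (by linarith [hx.1, hs' k]) hx.2.1
  have lim1 : Tendsto (fun k => nsq (sclU u x (s k)) (sclD u' x (s k))) atTop (𝓝 0) := by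
    apply squeeze_zero (fun k => nsq_nonneg _ _) (fun k => _) tendsto_one_div_add_atTop_nhds_zero_nat
    intro k
    have := hsm k
    have := qcon_nonneg (sclU u x (s k)) (memP_pZero hn).1
    linarith
  have lim2 : Tendsto (fun k => qcon (sclU u x (s k)) (pZero n)) atTop (𝓝 0) := by
    apply squeeze_zero (fun k => qcon_nonneg _ (memP_pZero hn).1) (fun k => _)
      tendsto_one_div_add_atTop_nhds_zero_nat
    intro k
    have := hsm k
    have := nsq_nonneg (sclU u x (s k)) (sclD u' x (s k))
    linarith
  obtain ⟨φ, hφ, v, hv, hlim⟩ := extract hG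
  obtain ⟨B, hB, hBlim⟩ := classify hn (fun k => hG (φ k)) (lim1.comp hφ.tendsto_atTop)
    (lim2.comp hφ.tendsto_atTop) hv hlim
  refine ⟨B, hB, fun ε hε => ?_⟩
  obtain ⟨k, hk⟩ := (hBlim.eventually (gt_mem_nhds hε)).exists
  refine ⟨s (φ k), hs _, hs' _, fun t ht ht' => ?_⟩
  exact (sset_mono hn h hr hx hB ht ht' (hs' _)).trans_lt hk

lemma continuous_int {F : E → E → ℝ} (hF : Continuous (Function.uncurry F)) {j : ℕ} (hj : j ≠ 0) :
    Continuous fun x => ∫ y, F x y * wt j y := by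
  rw [← continuousOn_univ]
  apply continuousOn_integral_of_compact_support (isCompact_closedBall (0 : E) 1)
  · apply Continuous.continuousOn
    exact hF.mul ((wt_continuous j).comp continuous_snd)
  · intro p y _ hy
    rw [wt_eq_zero hj, mul_zero]
    rw [mem_closedBall, dist_zero_right, not_le] at hy
    exact hy.le

lemma Loc.cont (h : Loc L x0 ρ u u') : Continuous u :=
  (contDiff_of_grad h.grad h.lip.continuous).continuous

lemma hfun_cont (h : Loc L x0 ρ u u') (s : ℝ) (A : Matrix (Fin n) (Fin n) ℝ) :
    Continuous fun x => hfun (sclU u x s) A := by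
  unfold hfun
  apply continuous_int (F := fun x y => (sclU u x s y - quadForm A y) ^ 2) _ one_ne_zero
  have h1 := h.cont
  have h2 := quadForm_continuous A
  unfold sclU Function.uncurry
  fun_prop

lemma gfun_cont (h : Loc L x0 ρ u u') (s : ℝ) (A : Matrix (Fin n) (Fin n) ℝ) :
    Continuous fun x => gfun (sclU u x s) (sclD u' x s) A := by
  unfold gfun bform
  have h1 := h.cont
  have h3 := h.lip.continuous
  have h2 := quadForm_continuous A
  apply Continuous.sub
  · apply continuous_int (F := fun x y => inner ℝ (sclD u' x s y - aop A y) (sclD u' x s y - aop A y))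
      _ two_ne_zero
    unfold sclD Function.uncurry
    fun_prop
  · apply Continuous.const_mul
    apply continuous_int (F := fun x y => (sclU u x s y - quadForm A y) * (sclU u x s y - quadForm A y))
      _ one_ne_zero
    unfold sclU Function.uncurry
    fun_prop

lemma sset_compact (h : Loc L x0 ρ u u') (r0 : ℝ) : IsCompact (sset u u' x0 r0) := by
  apply (isCompact_closedBall x0 r0).of_isClosed_subset
  · have h1 := h.cont
    have e : sset u u' x0 r0 = {x | dist x x0 ≤ r0} ∩ ({x | u x = 0} ∩
      ⋂ (s : ℝ) (_ : 0 < s) (_ : s ≤ r0), {x | 0 ≤ gfun (sclU u x s) (sclD u' x s) (pZero n)}) := by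
      ext x
      simp [sset]
    rw [e]
    refine (isClosed_le (by fun_prop) continuous_const).inter
      ((isClosed_eq h1 continuous_const).inter ?_)
    refine isClosed_iInter fun s => isClosed_iInter fun _ => isClosed_iInter fun _ => ?_
    exact isClosed_le continuous_const (gfun_cont h s _)
  · intro x hx
    exact hx.1

lemma sset_of_hfun (hn : n ≠ 0) (h : Loc L x0 ρ u u') {r0 : ℝ} (hr : 2 * r0 ≤ ρ) {x : E}
    (hx : dist x x0 ≤ r0) (hux : u x = 0) {A : Matrix (Fin n) (Fin n) ℝ} (hA : MemP A)
    (hlim : Tendsto (fun s => hfun (sclU u x s) A) (𝓝[>] 0) (𝓝 0)) : x ∈ sset u u' x0 r0 := by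
  refine ⟨hx, hux, fun s hs hs' => ?_⟩
  rw [← gfun_indep (h.good hs (by linarith) hux) hA.symm (memP_pZero hn).symm hA.2 (memP_pZero hn).2]
  have h1 : Tendsto (fun s => - 8 * hfun (sclU u x s) A) (𝓝[>] 0) (𝓝 0) := by
    simpa using hlim.const_mul (-8)
  apply le_of_tendsto h1
  filter_upwards [Ioo_mem_nhdsGT hs] with t ht
  exact (gfun_ge (U' := sclD u' x t)).trans (h.gfun_mono ht.1 ht.2.le (by linarith) hux hA)

end blow


/-! ### Uniformity of the blow-ups -/

section unif
variable {n : ℕ} {L : ℝ≥0}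
local notation "E" => EuclideanSpace ℝ (Fin n)

lemma MemP.quad_le {A : Matrix (Fin n) (Fin n) ℝ} (hA : MemP A) (y : E) :
    quadForm A y ≤ (1 / 2) * ‖y‖ ^ 2 := by
  obtain ⟨hA, ht⟩ := hA
  obtain ⟨N, B, hB⟩ := Matrix.posSemidef_iff_eq_sum_vecMulVec.1 hA
  have e : ∀ i j, A i j = ∑ k, B k i * B k j := by
    intro i j; rw [hB]; simp [Matrix.sum_apply, Matrix.vecMulVec_apply]
  have ht' : ∑ k, ∑ j, (B k j) ^ 2 = 1 := by
    rw [← ht, Finset.sum_comm]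
    simp only [Matrix.trace, Matrix.diag, e, sq]
  unfold quadForm
  have e2 : ∑ i, ∑ j, A i j * y i * y j = ∑ k, (∑ j, B k j * y j) ^ 2 := by
    simp only [e, sq, Finset.sum_mul, Finset.mul_sum]
    rw [Finset.sum_comm_cycle]
    refine Finset.sum_congr rfl fun i _ => Finset.sum_congr rfl fun j _ =>
      Finset.sum_congr rfl fun k _ => ?_
    ring
  rw [e2]
  gcongr
  have : ∀ k, (∑ j, B k j * y j) ^ 2 ≤ (∑ j, (B k j) ^ 2) * ‖y‖ ^ 2 := by
    intro k
    rw [EuclideanSpace.real_norm_sq_eq]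
    exact Finset.sum_mul_sq_le_sq_mul_sq _ _ _
  refine (Finset.sum_le_sum fun k _ => this k).trans ?_
  rw [← Finset.sum_mul, ht', one_mul]

lemma MemP.aop_sq_le {A : Matrix (Fin n) (Fin n) ℝ} (hA : MemP A) (w : E) :
    ‖aop A w‖ ^ 2 ≤ 2 * quadForm A w := by
  have h1 := quadForm_nonneg hA.1 (w + (-1 : ℝ) • aop A w)
  rw [quadForm_polar hA.symm, quadForm_smul, map_smul, inner_smul_right, aop_symm hA.symm,
    real_inner_self_eq_norm_sq] at h1
  have h2 := hA.quad_le (aop A w)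
  linarith

lemma MemP.aop_le {A : Matrix (Fin n) (Fin n) ℝ} (hA : MemP A) (w : E) : ‖aop A w‖ ≤ ‖w‖ := by
  have h1 := hA.aop_sq_le w
  have h2 := hA.quad_le w
  exact abs_le_of_sq_le_sq' (by linarith) (norm_nonneg _) |>.2

lemma MemP.quad_lip {A : Matrix (Fin n) (Fin n) ℝ} (hA : MemP A) {y z : E} (hy : ‖y‖ ≤ 1)
    (hz : ‖z‖ ≤ 1) : |quadForm A z - quadForm A y| ≤ 2 * ‖z - y‖ := by
  have e : z = y + (z - y) := by abel
  have h1 := quadForm_polar hA.symm y (z - y)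
  rw [← e] at h1
  have h2 := abs_real_inner_le_norm y (aop A (z - y))
  have h3 := hA.aop_le (z - y)
  have h4 := hA.quad_le (z - y)
  have h5 := quadForm_nonneg hA.1 (z - y)
  have h6 : ‖z - y‖ ≤ 2 := (norm_sub_le _ _).trans (by linarith)
  have h7 : ‖y‖ * ‖aop A (z - y)‖ ≤ 1 * ‖z - y‖ := by gcongr
  have h8 : quadForm A (z - y) ≤ ‖z - y‖ := by nlinarith [norm_nonneg (z - y)]
  rw [abs_le] at *
  constructor <;> linarith [h2.1, h2.2]

lemma aop_small {D : Matrix (Fin n) (Fin n) ℝ} (hD : D.IsSymm) {η : ℝ}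
    (h : ∀ y : E, ‖y‖ ≤ 1 / 2 → |quadForm D y| ≤ η) : ‖aop D‖ ≤ 48 * η := by
  have hη : 0 ≤ η := (abs_nonneg _).trans (h 0 (by simp))
  apply ContinuousLinearMap.opNorm_le_bound _ (by positivity)
  intro y
  have key : ∀ x y : E, ‖x‖ ≤ 1 → ‖y‖ ≤ 1 → |inner ℝ x (aop D y)| ≤ 48 * η := by
    intro x y hx hy
    have n1 : ‖(1 / 4 : ℝ) • x‖ ≤ 1 / 4 := by rw [norm_smul]; norm_num; linarith
    have n2 : ‖(1 / 4 : ℝ) • y‖ ≤ 1 / 4 := by rw [norm_smul]; norm_num; linarith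
    have h1 := quadForm_polar hD ((1 / 4 : ℝ) • x) ((1 / 4 : ℝ) • y)
    rw [map_smul, inner_smul_left, inner_smul_right] at h1
    simp only [conj_trivial] at h1
    have a1 := h _ (n1.trans (by norm_num))
    have a2 := h _ (n2.trans (by norm_num))
    have a3 := h _ ((norm_add_le _ _).trans (by linarith : ‖(1 / 4 : ℝ) • x‖ + ‖(1 / 4 : ℝ) • y‖ ≤ 1 / 2))
    rw [abs_le] at *
    constructor <;> linarith [a1.1, a1.2, a2.1, a2.2, a3.1, a3.2]
  have key2 : ∀ y : E, ‖y‖ ≤ 1 → ‖aop D y‖ ≤ 48 * η := by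
    intro y hy
    rcases eq_or_ne (aop D y) 0 with h0 | h0
    · rw [h0, norm_zero]; positivity
    · have := key (‖aop D y‖⁻¹ • aop D y) y (by
        rw [norm_smul, norm_inv, norm_norm, inv_mul_cancel₀ (norm_ne_zero_iff.2 h0)]) hy
      rw [inner_smul_left, real_inner_self_eq_norm_sq] at this
      simp only [conj_trivial] at this
      rw [sq, ← mul_assoc, inv_mul_cancel₀ (norm_ne_zero_iff.2 h0), one_mul, abs_norm] at this
      exact this
  rcases eq_or_ne y 0 with h0 | h0
  · simp [h0]
  · have := key2 (‖y‖⁻¹ • y) (by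
      rw [norm_smul, norm_inv, norm_norm, inv_mul_cancel₀ (norm_ne_zero_iff.2 h0)])
    have hy : 0 < ‖y‖ := norm_pos_iff.2 h0
    rw [map_smul, norm_smul, norm_inv, norm_norm, inv_mul_le_iff₀ hy] at this
    linarith

/-- `L²` smallness implies uniform smallness. -/
lemma sup_small {M : ℝ} (hM : 0 < M) {ε : ℝ} (hε : 0 < ε) : ∃ δ > 0, ∀ f : E → ℝ, Continuous f →
    (∀ y z, ‖y‖ ≤ 1 → ‖z‖ ≤ 1 → |f z - f y| ≤ M * ‖z - y‖) → ∫ y, (f y) ^ 2 * wt 1 y < δ →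
    ∀ y, ‖y‖ ≤ 1 / 2 → |f y| ≤ ε := by
  set τ := min (1 / 4) (ε / (2 * M)) with hτ
  have hτ0 : 0 < τ := by positivity
  have hτ1 : τ ≤ 1 / 4 := min_le_left _ _
  have hτ2 : M * τ ≤ ε / 2 := by
    have : τ ≤ ε / (2 * M) := min_le_right _ _
    calc M * τ ≤ M * (ε / (2 * M)) := by gcongr
      _ = ε / 2 := by field_simp
  set c := volume.real (ball (0 : E) τ) with hc
  have hc0 : 0 < c := by
    apply ENNReal.toReal_pos (measure_ball_pos _ _ hτ0).ne' measure_ball_lt_top.ne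
  refine ⟨(ε / 2) ^ 2 * (7 / 16) * c, by positivity, ?_⟩
  intro f hf hlip hintg y hy
  by_contra hcon
  push Not at hcon
  have hcy : volume.real (ball y τ) = c := by
    rw [hc, Measure.real, Measure.real, Measure.addHaar_ball_center]
  have hI : Integrable fun y => (f y) ^ 2 * wt 1 y := integrable_mul_wt (hf.pow 2) one_ne_zero
  have h1 : ∫ z in ball y τ, ((ε / 2) ^ 2 * (7 / 16) : ℝ) ≤ ∫ z in ball y τ, (f z) ^ 2 * wt 1 z := by
    apply setIntegral_mono_on _ hI.integrableOn measurableSet_ball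
    · intro z hz
      rw [mem_ball, dist_eq_norm] at hz
      have hz1 : ‖z‖ ≤ 3 / 4 := by
        have : z = y + (z - y) := by abel
        rw [this]
        exact (norm_add_le _ _).trans (by linarith)
      have h2 := hlip y z (by linarith) (by linarith)
      have h3 : M * ‖z - y‖ ≤ ε / 2 := le_trans (by gcongr) hτ2
      have h4 : ε / 2 ≤ |f z| := by
        have := abs_sub_abs_le_abs_sub (f y) (f z)
        rw [abs_sub_comm] at this
        linarith
      have h5 : (7 / 16 : ℝ) ≤ wt 1 z := by
        rw [wt_one_of (by linarith)]
        nlinarith [norm_nonneg z]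
      have h6 : (ε / 2) ^ 2 ≤ (f z) ^ 2 := by
        rw [← sq_abs (f z)]; gcongr
      gcongr
    · exact integrableOn_const measure_ball_lt_top.ne
  have h2 : ∫ z in ball y τ, (f z) ^ 2 * wt 1 z ≤ ∫ z, (f z) ^ 2 * wt 1 z :=
    setIntegral_le_integral hI (ae_of_all _ fun z => mul_nonneg (sq_nonneg _) (wt_nonneg _ _))
  rw [setIntegral_const, hcy, smul_eq_mul] at h1
  linarith

/-- squared weighted distance -/
lemma sq_tri {f g h : E → ℝ} (hf : Continuous f) (hg : Continuous g) (hh : Continuous h) :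
    ∫ y, (f y - h y) ^ 2 * wt 1 y ≤
      2 * (∫ y, (f y - g y) ^ 2 * wt 1 y) + 2 * ∫ y, (g y - h y) ^ 2 * wt 1 y := by
  have I1 : Integrable fun y => (f y - g y) ^ 2 * wt 1 y :=
    integrable_mul_wt ((hf.sub hg).pow 2) one_ne_zero
  have I2 : Integrable fun y => (g y - h y) ^ 2 * wt 1 y :=
    integrable_mul_wt ((hg.sub hh).pow 2) one_ne_zero
  have I3 : Integrable fun y => (f y - h y) ^ 2 * wt 1 y :=
    integrable_mul_wt ((hf.sub hh).pow 2) one_ne_zero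
  rw [← integral_const_mul, ← integral_const_mul, ← integral_add (I1.const_mul _) (I2.const_mul _)]
  apply integral_mono I3 ((I1.const_mul _).add (I2.const_mul _))
  intro y
  have := wt_nonneg 1 y
  have h2 : (f y - h y) ^ 2 ≤ 2 * (f y - g y) ^ 2 + 2 * (g y - h y) ^ 2 := by
    nlinarith [sq_nonneg ((f y - g y) - (g y - h y))]
  calc (f y - h y) ^ 2 * wt 1 y ≤ (2 * (f y - g y) ^ 2 + 2 * (g y - h y) ^ 2) * wt 1 y := by gcongr
    _ = 2 * ((f y - g y) ^ 2 * wt 1 y) + 2 * ((g y - h y) ^ 2 * wt 1 y) := by ring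

/-- distance of quadratic forms -/
def qd (A B : Matrix (Fin n) (Fin n) ℝ) : ℝ :=
  ∫ y : EuclideanSpace ℝ (Fin n), (quadForm A y - quadForm B y) ^ 2 * wt 1 y

lemma hfun_tri {U : E → ℝ} (hU : Continuous U) (A B : Matrix (Fin n) (Fin n) ℝ) :
    hfun U B ≤ 2 * hfun U A + 2 * qd A B :=
  sq_tri hU (quadForm_continuous A) (quadForm_continuous B)

lemma qd_tri {U : E → ℝ} (hU : Continuous U) (A B : Matrix (Fin n) (Fin n) ℝ) :
    qd A B ≤ 2 * hfun U A + 2 * hfun U B := by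
  have := sq_tri (quadForm_continuous A) hU (quadForm_continuous B)
  unfold qd hfun
  refine this.trans (le_of_eq ?_)
  congr 2
  congr 1; ext y; ring

variable {x0 : EuclideanSpace ℝ (Fin n)} {ρ : ℝ}
  {u : EuclideanSpace ℝ (Fin n) → ℝ} {u' : EuclideanSpace ℝ (Fin n) → EuclideanSpace ℝ (Fin n)}

lemma sclU_cont (h : Loc L x0 ρ u u') (x : E) (s : ℝ) : Continuous (sclU u x s) := by
  have := h.cont
  unfold sclU
  fun_prop

/-- data produced by the blow-up analysis -/
theorem sset_data (hn : n ≠ 0) (h : Loc L x0 ρ u u') {r0 : ℝ} (hr0 : 0 < r0) (hr : 2 * r0 ≤ ρ) :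
    ∃ A : E → Matrix (Fin n) (Fin n) ℝ, (∀ x ∈ sset u u' x0 r0, MemP (A x)) ∧
      ContinuousOn (fun x => aop (A x)) (sset u u' x0 r0) ∧
      (∀ ε > 0, ∃ δ > 0, ∀ x ∈ sset u u' x0 r0, ∀ y ∈ sset u u' x0 r0, ‖y - x‖ < δ →
        ‖aop (A x) (y - x)‖ ≤ ε * ‖y - x‖) ∧
      ∀ x ∈ sset u u' x0 r0, ∀ B, MemP B →
        Tendsto (fun s => hfun (sclU u x s) B) (𝓝[>] 0) (𝓝 0) → A x = B := by
  classical
  set K := sset u u' x0 r0 with hK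
  have hex : ∀ x : E, ∃ B : Matrix (Fin n) (Fin n) ℝ, x ∈ K → (MemP B ∧
      ∀ ε > 0, ∃ s0, 0 < s0 ∧ s0 ≤ r0 ∧ ∀ s, 0 < s → s ≤ s0 → hfun (sclU u x s) B < ε) := by
    intro x
    by_cases hx : x ∈ K
    · obtain ⟨B, hB⟩ := sset_blow hn h hr0 hr hx
      exact ⟨B, fun _ => hB⟩
    · exact ⟨0, fun h => absurd h hx⟩
  choose A hA using hex
  -- local uniformity
  have loc : ∀ δ > 0, ∀ x ∈ K, ∃ t, 0 < t ∧ ∀ᶠ z in 𝓝[K] x, qd (A x) (A z) < 4 * δ ∧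
      ∀ s, 0 < s → s ≤ t → hfun (sclU u z s) (A z) < 10 * δ := by
    intro δ hδ x hx
    obtain ⟨t, ht, htr, hts⟩ := (hA x hx).2 δ hδ
    refine ⟨t, ht, ?_⟩
    have h1 : ∀ᶠ z in 𝓝[K] x, hfun (sclU u z t) (A x) < δ :=
      ((hfun_cont h t (A x)).continuousAt.eventually (gt_mem_nhds (hts t ht le_rfl))).filter_mono
        nhdsWithin_le_nhds
    filter_upwards [h1, self_mem_nhdsWithin] with z hz hzK
    have h2 : ∀ s, 0 < s → s ≤ t → hfun (sclU u z s) (A x) < δ := fun s hs hst =>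
      (sset_mono hn h hr hzK (hA x hx).1 hs hst htr).trans_lt hz
    have h3 : qd (A x) (A z) < 4 * δ := by
      obtain ⟨t', ht', htr', hts'⟩ := (hA z hzK).2 δ hδ
      have h4 := h2 (min t t') (lt_min ht ht') (min_le_left _ _)
      have h5 := hts' (min t t') (lt_min ht ht') (min_le_right _ _)
      have := qd_tri (sclU_cont h z (min t t')) (A x) (A z)
      linarith
    refine ⟨h3, fun s hs hst => ?_⟩
    have := hfun_tri (sclU_cont h z s) (A x) (A z)
    linarith [h2 s hs hst]
  have unif : ∀ δ > 0, ∃ t, 0 < t ∧ ∀ z ∈ K, ∀ s, 0 < s → s ≤ t →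
      hfun (sclU u z s) (A z) < 10 * δ := by
    intro δ hδ
    refine (sset_compact h r0).induction_on (p := fun S => ∃ t, 0 < t ∧ ∀ z ∈ S, ∀ s, 0 < s → s ≤ t →
      hfun (sclU u z s) (A z) < 10 * δ) ?_ ?_ ?_ ?_
    · exact ⟨1, one_pos, fun z hz => absurd hz (notMem_empty z)⟩
    · rintro S T hST ⟨t, ht, h1⟩
      exact ⟨t, ht, fun z hz => h1 z (hST hz)⟩
    · rintro S T ⟨t, ht, h1⟩ ⟨t', ht', h2⟩
      refine ⟨min t t', lt_min ht ht', ?_⟩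
      rintro z (hz | hz) s hs hst
      · exact h1 z hz s hs (hst.trans (min_le_left _ _))
      · exact h2 z hz s hs (hst.trans (min_le_right _ _))
    · intro x hx
      obtain ⟨t, ht, h1⟩ := loc δ hδ x hx
      exact ⟨_, h1, t, ht, fun z hz => hz.2⟩
  refine ⟨A, fun x hx => (hA x hx).1, ?_, ?_, ?_⟩
  · intro x hx
    rw [ContinuousWithinAt, Metric.tendsto_nhds]
    intro ε hε
    obtain ⟨δ, hδ, hsup⟩ := sup_small (n := n) (M := 4) (by norm_num) (ε := ε / 96) (by positivity)
    obtain ⟨t, ht, h1⟩ := loc (δ / 4) (by positivity) x hx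
    filter_upwards [h1, self_mem_nhdsWithin] with z hz hzK
    have mx := (hA x hx).1
    have mz := (hA z hzK).1
    have h2 := hsup (fun y => quadForm (A x) y - quadForm (A z) y)
      ((quadForm_continuous _).sub (quadForm_continuous _)) (by
        intro y y' hy hy'
        have a1 := mx.quad_lip hy hy'
        have a2 := mz.quad_lip hy hy'
        rw [abs_le] at *
        constructor <;> linarith [a1.1, a1.2, a2.1, a2.2]) (lt_of_lt_of_eq hz.1 (by ring))
    have h3 := aop_small (D := A x - A z) (mx.symm.sub mz.symm) (η := ε / 96) (by
      intro y hy
      rw [quadForm_sub]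
      exact h2 y hy)
    rw [dist_comm, dist_eq_norm]
    have e : aop (A x) - aop (A z) = aop (A x - A z) := by
      ext1 y
      rw [aop_sub]; rfl
    rw [e]
    linarith
  · intro ε hε
    have hL : (0:ℝ) ≤ L := L.2
    obtain ⟨δ, hδ, hsup⟩ := sup_small (n := n) (M := 3 * L + 2) (by positivity) (ε := ε ^ 2 / 8)
      (by positivity)
    obtain ⟨t, ht, h1⟩ := unif (δ / 10) (by positivity)
    refine ⟨min t r0 / 2, by positivity, ?_⟩
    intro x hx y hy hxy
    rcases eq_or_ne y x with rfl | hne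
    · simp
    have hd : 0 < ‖y - x‖ := norm_pos_iff.2 (sub_ne_zero.2 hne)
    set s := 2 * ‖y - x‖ with hs
    have hs0 : 0 < s := by positivity
    have hst : s ≤ t := by linarith [min_le_left t r0]
    have hsr : s ≤ r0 := by linarith [min_le_right t r0]
    have mx := (hA x hx).1
    have g := h.good hs0 (by linarith [hx.1]) hx.2.1
    have h2 := hsup (fun y => sclU u x s y - quadForm (A x) y)
      ((sclU_cont h x s).sub (quadForm_continuous _)) (by
        intro y y' hy hy'
        have a1 := g.lipBall hy hy'
        have a2 := mx.quad_lip hy hy'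
        rw [abs_le] at *
        constructor <;> linarith [a1.1, a1.2, a2.1, a2.2])
      (lt_of_lt_of_eq (h1 x hx s hs0 hst) (by ring)) (s⁻¹ • (y - x)) (by
        rw [norm_smul, norm_inv, Real.norm_of_nonneg hs0.le, hs]
        apply le_of_eq
        field_simp)
    have e1 : sclU u x s (s⁻¹ • (y - x)) = 0 := by
      unfold sclU
      rw [smul_inv_smul₀ hs0.ne', add_sub_cancel, hy.2.1, zero_div]
    rw [e1, quadForm_smul, zero_sub, abs_neg] at h2
    have h3 := (le_abs_self _).trans h2
    rw [inv_pow, inv_mul_le_iff₀ (by positivity)] at h3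
    have h4 := mx.aop_sq_le (y - x)
    have h5 : ‖aop (A x) (y - x)‖ ^ 2 ≤ (ε * ‖y - x‖) ^ 2 := by
      rw [hs] at h3
      nlinarith
    exact (abs_le_of_sq_le_sq' h5 (by positivity)).2
  · intro x hx B hB hlim
    have mx := (hA x hx).1
    apply eq_of_quadForm_ball mx.symm hB.symm one_pos
    intro y hy
    rw [← sub_eq_zero]
    refine zero_of_int (f := fun y => quadForm (A x) y - quadForm B y)
      ((quadForm_continuous _).sub (quadForm_continuous _)) ?_ y hy
    have h0 : 0 ≤ qd (A x) B := integral_nonneg fun y => mul_nonneg (sq_nonneg _) (wt_nonneg _ _)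
    apply le_antisymm _ h0
    apply le_of_forall_pos_le_add
    intro ε hε
    obtain ⟨t, ht, htr, hts⟩ := (hA x hx).2 (ε / 4) (by positivity)
    obtain ⟨s, hs1, hs2⟩ := ((hlim.eventually (gt_mem_nhds (show (0:ℝ) < ε / 4 by positivity))).and
      (Ioo_mem_nhdsGT ht)).exists
    have := qd_tri (sclU_cont h x s) (A x) B
    have h3 := hts s hs2.1 hs2.2.le
    rw [zero_add]
    show qd (A x) B ≤ ε
    linarith

/-- passage from `IsBlowup` to the local functional -/
lemma IsBlowup.hfun_lim {w : E → ℝ} (hn : n ≠ 0) (h : Loc L x0 ρ u u')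
    (huw : ∀ x, dist x x0 < ρ → u x = w x) {x : E} (hx : dist x x0 < ρ)
    {B : Matrix (Fin n) (Fin n) ℝ} (hB : IsBlowup w x B) :
    u x = 0 ∧ Tendsto (fun s => hfun (sclU u x s) B) (𝓝[>] 0) (𝓝 0) := by
  obtain ⟨hB1, hB2⟩ := hB
  have h1 : ∀ ε > 0, ∀ᶠ s in 𝓝[>] (0:ℝ), ∀ y : E, ‖y‖ ≤ 1 → |sclU u x s y - quadForm B y| < ε := by
    intro ε hε
    have h2 : TendstoUniformlyOn (fun (r : ℝ) y => w (x + r • y) / r ^ 2) (quadForm B) (𝓝[>] 0)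
        (closedBall 0 1) :=
      (tendstoLocallyUniformlyOn_iff_tendstoUniformlyOn_of_compact (isCompact_closedBall _ _)).1
        hB2.tendstoLocallyUniformlyOn
    rw [Metric.tendstoUniformlyOn_iff] at h2
    filter_upwards [h2 ε hε, Ioo_mem_nhdsGT (sub_pos.2 hx)] with s hs hs' y hy
    have h3 := hs y (by simpa using hy)
    rw [dist_comm, Real.dist_eq] at h3
    unfold sclU
    rw [huw]
    · exact h3
    · calc dist (x + s • y) x0 ≤ dist (x + s • y) x + dist x x0 := dist_triangle _ _ _
        _ < ρ := by
          rw [dist_eq_norm, add_sub_cancel_left, norm_smul, Real.norm_of_nonneg hs'.1.le]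
          have h5 := mul_le_mul_of_nonneg_left hy hs'.1.le
          linarith [hs'.2]
  constructor
  · by_contra hne
    have hp : 0 < u x := lt_of_le_of_ne (h.nonneg x) (Ne.symm hne)
    obtain ⟨s, hs1, hs2⟩ := ((h1 1 one_pos).and
      (Ioo_mem_nhdsGT (show (0:ℝ) < min (u x) 1 by positivity))).exists
    have h2 := hs1 0 (by simp)
    have e : quadForm B (0 : E) = 0 := by simp [quadForm]
    rw [e, sub_zero] at h2
    unfold sclU at h2
    rw [smul_zero, add_zero] at h2
    have h3 := (le_abs_self _).trans_lt h2
    have hs0 : 0 < s := hs2.1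
    rw [div_lt_iff₀ (by positivity)] at h3
    have h4 : s < u x := hs2.2.trans_le (min_le_left _ _)
    have h5 : s < 1 := hs2.2.trans_le (min_le_right _ _)
    nlinarith
  · rw [Metric.tendsto_nhds]
    intro ε hε
    have hw := wvol_nonneg n
    have hε' : 0 < Real.sqrt (ε / (wvol n + 1)) := by positivity
    filter_upwards [h1 _ hε'] with s hs
    rw [Real.dist_eq, sub_zero]
    unfold hfun
    have h2 := abs_integral_wt_le (f := fun y => (sclU u x s y - quadForm B y) ^ 2)
      (g := fun y : E => ε / (wvol n + 1)) (j := 1) ((integrable_wt one_ne_zero).const_mul _) (by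
        intro y hy
        rw [abs_pow]
        have h3 := (hs y hy).le
        calc _ ≤ (Real.sqrt (ε / (wvol n + 1))) ^ 2 := by gcongr
          _ = _ := Real.sq_sqrt (by positivity)) one_ne_zero
    refine h2.trans_lt ?_
    rw [integral_const_mul, div_mul_eq_mul_div, div_lt_iff₀ (by positivity)]
    show ε * wvol n < _
    linarith

theorem blowup_data (hn : n ≠ 0) {Ω : Set E} (hΩ : IsOpen Ω) {w : E → ℝ}
    (hw : IsObstacleSol Ω w) {x0 : E} (hx0 : x0 ∈ Ω) :
    ∃ r > 0, ∃ K : Set E, IsCompact K ∧ ∃ A : E → Matrix (Fin n) (Fin n) ℝ,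
      (∀ x ∈ K, MemP (A x)) ∧ ContinuousOn (fun x => aop (A x)) K ∧
      (∀ ε > 0, ∃ δ > 0, ∀ x ∈ K, ∀ y ∈ K, ‖y - x‖ < δ →
        ‖aop (A x) (y - x)‖ ≤ ε * ‖y - x‖) ∧
      ∀ x, dist x x0 < r → ∀ B, IsBlowup w x B → x ∈ K ∧ A x = B := by
  obtain ⟨ρ, L, v, v', hρ, hloc, hvw, -⟩ := exists_loc hΩ hw hx0
  obtain ⟨A, h1, h2, h3, h4⟩ := sset_data hn hloc (r0 := ρ / 2) (by positivity) (by linarith)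
  refine ⟨ρ / 2, by positivity, sset v v' x0 (ρ / 2), sset_compact hloc _, A, h1, h2, h3, ?_⟩
  intro x hx B hB
  obtain ⟨a, b⟩ := hB.hfun_lim hn hloc hvw (by linarith)
  have hxK := sset_of_hfun hn hloc (r0 := ρ / 2) (by linarith) hx.le a hB.1 b
  exact ⟨hxK, h4 x hxK B hB.1 b⟩

end unif


/-! ### Whitney extension: the kernel -/

section whitney_kernel
variable {n : ℕ}
local notation "E" => EuclideanSpace ℝ (Fin n)

def kap {n : ℕ} (K : Set (EuclideanSpace ℝ (Fin n))) (z w : EuclideanSpace ℝ (Fin n)) : ℝ :=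
  (max (infDist w K ^ 2 - 16 * ‖z - w‖ ^ 2) 0) ^ 2

def kapg {n : ℕ} (K : Set (EuclideanSpace ℝ (Fin n))) (z w : EuclideanSpace ℝ (Fin n)) :
    EuclideanSpace ℝ (Fin n) :=
  (-64 * max (infDist w K ^ 2 - 16 * ‖z - w‖ ^ 2) 0) • (z - w)

lemma kap_nonneg (K : Set E) (z w : E) : 0 ≤ kap K z w := by unfold kap; positivity

lemma kap_hasFDerivAt (K : Set E) (z w : E) :
    HasFDerivAt (fun z => kap K z w) (innerSL ℝ (kapg K z w)) z := by
  unfold kap kapg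
  have h1 : HasFDerivAt (fun z : E => ‖z - w‖ ^ 2) ((2:ℝ) • innerSL ℝ (z - w)) z := by
    have := ((hasFDerivAt_id z).sub_const w).norm_sq
    have e : (2:ℝ) • innerSL ℝ (z - w)
        = (2 • (innerSL ℝ) (id z - w)).comp (ContinuousLinearMap.id ℝ E) := by
      ext v; simp [two_smul, two_mul]
    rw [e]
    exact this
  have h2 : HasFDerivAt (fun z : E => infDist w K ^ 2 - 16 * ‖z - w‖ ^ 2)
      (-((16:ℝ) • ((2:ℝ) • innerSL ℝ (z - w)))) z := by
    exact (h1.const_mul 16).const_sub _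
  have h3 := (hasDerivAt_maxpow (j := 1) one_ne_zero
    (infDist w K ^ 2 - 16 * ‖z - w‖ ^ 2)).comp_hasFDerivAt z h2
  refine h3.congr_fderiv ?_
  ext v
  simp
  ring

lemma kap_cont_left (K : Set E) (w : E) : Continuous (fun z => kap K z w) := by
  unfold kap; fun_prop

lemma kap_cont_right (K : Set E) (z : E) : Continuous (fun w => kap K z w) := by
  unfold kap
  have := continuous_infDist_pt K
  fun_prop

lemma kapg_cont_left (K : Set E) (w : E) : Continuous (fun z => kapg K z w) := by
  unfold kapg; fun_prop

lemma kapg_cont_right (K : Set E) (z : E) : Continuous (fun w => kapg K z w) := by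
  unfold kapg
  have := continuous_infDist_pt K
  fun_prop

lemma kap_supp {K : Set E} {z w : E} (h : ¬ (‖z - w‖ < infDist w K / 4)) :
    max (infDist w K ^ 2 - 16 * ‖z - w‖ ^ 2) 0 = 0 := by
  apply max_eq_right
  have := infDist_nonneg (x := w) (s := K)
  push Not at h
  nlinarith

lemma kap_zero {K : Set E} {z w : E} (h : ¬ (‖z - w‖ < infDist w K / 4)) : kap K z w = 0 := by
  unfold kap; rw [kap_supp h]; simp

lemma kapg_zero {K : Set E} {z w : E} (h : ¬ (‖z - w‖ < infDist w K / 4)) : kapg K z w = 0 := by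
  unfold kapg; rw [kap_supp h]; simp

lemma kap_geo {K : Set E} {z w : E} (h : ‖z - w‖ < infDist w K / 4) :
    infDist w K ≤ 4 / 3 * infDist z K ∧ ‖z - w‖ ≤ infDist z K / 3 ∧ 0 < infDist z K := by
  have h1 : infDist w K ≤ infDist z K + dist w z := infDist_le_infDist_add_dist
  rw [dist_comm, dist_eq_norm] at h1
  have := norm_nonneg (z - w)
  refine ⟨by linarith, by linarith, by linarith⟩

lemma kap_bound {K : Set E} {z w : E} : kap K z w ≤ 4 * infDist z K ^ 4 := by
  by_cases h : ‖z - w‖ < infDist w K / 4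
  · obtain ⟨a, b, c⟩ := kap_geo h
    have h0 := infDist_nonneg (x := w) (s := K)
    unfold kap
    have : max (infDist w K ^ 2 - 16 * ‖z - w‖ ^ 2) 0 ≤ 2 * infDist z K ^ 2 := by
      apply max_le _ (by positivity)
      nlinarith [sq_nonneg ‖z - w‖]
    calc _ ≤ (2 * infDist z K ^ 2) ^ 2 := by gcongr
      _ = _ := by ring
  · rw [kap_zero h]; have := infDist_nonneg (x := z) (s := K); positivity

lemma kapg_bound {K : Set E} {z w : E} : ‖kapg K z w‖ ≤ 64 * infDist z K ^ 3 := by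
  by_cases h : ‖z - w‖ < infDist w K / 4
  · obtain ⟨a, b, c⟩ := kap_geo h
    have h0 := infDist_nonneg (x := w) (s := K)
    unfold kapg
    have : max (infDist w K ^ 2 - 16 * ‖z - w‖ ^ 2) 0 ≤ 2 * infDist z K ^ 2 := by
      apply max_le _ (by positivity)
      nlinarith [sq_nonneg ‖z - w‖]
    rw [norm_smul, norm_mul, Real.norm_of_nonneg (le_max_right _ _)]
    have e : ‖(-64:ℝ)‖ = 64 := by norm_num
    rw [e]
    calc _ ≤ 64 * (2 * infDist z K ^ 2) * (infDist z K / 3) := by gcongr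
      _ ≤ _ := by nlinarith [pow_pos c 3]
  · rw [kapg_zero h]; have := infDist_nonneg (x := z) (s := K); simp; positivity

lemma kap_lower {K : Set E} {z w : E} (h : ‖z - w‖ ≤ infDist z K / 8) :
    1 / 4 * infDist z K ^ 4 ≤ kap K z w := by
  have h1 : infDist z K ≤ infDist w K + dist z w := infDist_le_infDist_add_dist
  rw [dist_eq_norm] at h1
  have h0 := infDist_nonneg (x := z) (s := K)
  unfold kap
  have : 1 / 2 * infDist z K ^ 2 ≤ max (infDist w K ^ 2 - 16 * ‖z - w‖ ^ 2) 0 := by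
    apply le_max_of_le_left
    have : 7 / 8 * infDist z K ≤ infDist w K := by linarith
    nlinarith [norm_nonneg (z - w)]
  calc _ = (1 / 2 * infDist z K ^ 2) ^ 2 := by ring
    _ ≤ _ := by gcongr

lemma kap_cb {K : Set E} {z w z0 : E} (hz : z ∈ ball z0 1) :
    kap K z w ≤ (closedBall z0 (1 + (infDist z0 K + 1))).indicator
      (fun _ => 4 * (infDist z0 K + 1) ^ 4) w ∧
    ‖kapg K z w‖ ≤ (closedBall z0 (1 + (infDist z0 K + 1))).indicator
      (fun _ => 64 * (infDist z0 K + 1) ^ 3) w := by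
  have h1 : infDist z K ≤ infDist z0 K + dist z z0 := infDist_le_infDist_add_dist
  rw [mem_ball] at hz
  have h0 := infDist_nonneg (x := z) (s := K)
  have h2 : infDist z K ≤ infDist z0 K + 1 := by linarith
  by_cases h : ‖z - w‖ < infDist w K / 4
  · have hw : w ∈ closedBall z0 (1 + (infDist z0 K + 1)) := by
      rw [mem_closedBall]
      obtain ⟨a, b, c⟩ := kap_geo h
      have := dist_triangle w z z0
      rw [dist_comm w z, dist_eq_norm z w] at this
      linarith
    rw [indicator_of_mem hw, indicator_of_mem hw]
    refine ⟨kap_bound.trans (by gcongr), kapg_bound.trans (by gcongr)⟩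
  · rw [kap_zero h, kapg_zero h, norm_zero]
    have := infDist_nonneg (x := z0) (s := K)
    constructor <;> (apply indicator_nonneg; intros; positivity)

lemma integrable_ind (z0 : E) (R c : ℝ) :
    Integrable (fun w => (closedBall z0 R).indicator (fun _ => c) w) := by
  apply IntegrableOn.integrable_indicator _ measurableSet_closedBall
  exact integrableOn_const (measure_closedBall_lt_top.ne)

lemma kap_integrable (K : Set E) (z : E) : Integrable (fun w => kap K z w) := by
  apply (integrable_ind z _ _).mono' (kap_cont_right K z).aestronglyMeasurable
  refine Eventually.of_forall fun w => ?_
  rw [Real.norm_of_nonneg (kap_nonneg _ _ _)]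
  exact (kap_cb (mem_ball_self one_pos)).1

lemma kapg_integrable (K : Set E) (z : E) : Integrable (fun w => ‖kapg K z w‖) := by
  apply (integrable_ind z _ _).mono' (kapg_cont_right K z).norm.aestronglyMeasurable
  refine Eventually.of_forall fun w => ?_
  rw [norm_norm]
  exact (kap_cb (mem_ball_self one_pos)).2

section param
variable {G : Type*} [NormedAddCommGroup G] [NormedSpace ℝ G] [CompleteSpace G]

/-- Pointwise derivative of the kernel integrand. -/
def kder {n : ℕ} (K : Set (EuclideanSpace ℝ (Fin n)))
    (c : EuclideanSpace ℝ (Fin n) → G) (M : EuclideanSpace ℝ (Fin n) → EuclideanSpace ℝ (Fin n) →L[ℝ] G)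
    (z w : EuclideanSpace ℝ (Fin n)) : EuclideanSpace ℝ (Fin n) →L[ℝ] G :=
  kap K z w • M w + (innerSL ℝ (kapg K z w)).smulRight (c w + M w z)

lemma kder_hasFDerivAt (K : Set E) (c : E → G) (M : E → E →L[ℝ] G) (z w : E) :
    HasFDerivAt (fun z => kap K z w • (c w + M w z)) (kder K c M z w) z := by
  unfold kder
  exact (kap_hasFDerivAt K z w).smul ((M w).hasFDerivAt.const_add (c w))

lemma kder_cont (K : Set E) (c : E → G) (M : E → E →L[ℝ] G) (w : E) :
    Continuous (fun z => kder K c M z w) := by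
  unfold kder
  have h1 := kap_cont_left K w
  have h2 := kapg_cont_left K w
  have h3 : Continuous (fun z => (ContinuousLinearMap.smulRightL ℝ E G (innerSL ℝ (kapg K z w)))
    (c w + M w z)) := by fun_prop
  exact (h1.smul continuous_const).add h3

lemma kder_meas (K : Set E) {c : E → G} {M : E → E →L[ℝ] G} (hc : StronglyMeasurable c)
    (hM : StronglyMeasurable M) (z : E) : AEStronglyMeasurable (fun w => kder K c M z w) := by
  unfold kder
  have h1 := (kap_cont_right K z).stronglyMeasurable
  have h2 := (kapg_cont_right K z)
  have h4 : StronglyMeasurable fun w => M w z := by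
    exact (ContinuousLinearMap.apply ℝ G z).continuous.comp_stronglyMeasurable hM
  have h5 : StronglyMeasurable fun w => innerSL ℝ (kapg K z w) := by
    apply Continuous.stronglyMeasurable
    fun_prop
  have h7 : AEStronglyMeasurable fun w => (innerSL ℝ (kapg K z w)).smulRight (c w + M w z) :=
    (ContinuousLinearMap.smulRightL ℝ E G).aestronglyMeasurable_comp₂ h5.aestronglyMeasurable
      (hc.add h4).aestronglyMeasurable
  have h9 : StronglyMeasurable fun w => kap K z w • M w := h1.smul hM
  exact h9.aestronglyMeasurable.add h7

lemma kfun_meas (K : Set E) {c : E → G} {M : E → E →L[ℝ] G} (hc : StronglyMeasurable c)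
    (hM : StronglyMeasurable M) (z : E) :
    AEStronglyMeasurable (fun w => kap K z w • (c w + M w z)) := by
  have h1 := (kap_cont_right K z).stronglyMeasurable
  have h4 : StronglyMeasurable fun w => M w z := by
    exact (ContinuousLinearMap.apply ℝ G z).continuous.comp_stronglyMeasurable hM
  exact (h1.smul (hc.add h4)).aestronglyMeasurable

lemma kder_norm (K : Set E) (c : E → G) (M : E → E →L[ℝ] G) (z w : E) :
    ‖kder K c M z w‖ ≤ kap K z w * ‖M w‖ + ‖kapg K z w‖ * ‖c w + M w z‖ := by
  unfold kder
  refine (norm_add_le _ _).trans ?_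
  rw [norm_smul, Real.norm_of_nonneg (kap_nonneg _ _ _), ContinuousLinearMap.norm_smulRight_apply,
    innerSL_apply_norm]

lemma kder_bound (K : Set E) {c : E → G} {M : E → E →L[ℝ] G} {B : ℝ} (hcB : ∀ w, ‖c w‖ ≤ B)
    (hMB : ∀ w, ‖M w‖ ≤ B) (z0 : E) : ∃ g : E → ℝ, Integrable g ∧ ∀ z ∈ ball z0 1, ∀ w,
      ‖kder K c M z w‖ ≤ g w ∧ ‖kap K z w • (c w + M w z)‖ ≤ g w := by
  have hB : 0 ≤ B := (norm_nonneg _).trans (hcB 0)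
  set D := B + B * (‖z0‖ + 1)
  have hD : 0 ≤ D := by positivity
  set i1 : E → ℝ := fun w => (closedBall z0 (1 + (infDist z0 K + 1))).indicator
      (fun _ => 4 * (infDist z0 K + 1) ^ 4) w
  set i2 : E → ℝ := fun w => (closedBall z0 (1 + (infDist z0 K + 1))).indicator
      (fun _ => 64 * (infDist z0 K + 1) ^ 3) w
  refine ⟨fun w => i1 w * D + i2 w * D, ((integrable_ind _ _ _).mul_const _).add
    ((integrable_ind _ _ _).mul_const _), ?_⟩
  intro z hz w
  obtain ⟨a, b⟩ := kap_cb (K := K) (w := w) hz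
  have h1 : ‖z‖ ≤ ‖z0‖ + 1 := by
    rw [mem_ball, dist_eq_norm] at hz
    have := norm_le_norm_add_norm_sub' z z0
    linarith
  have h2 : ‖c w + M w z‖ ≤ D := by
    refine (norm_add_le _ _).trans (add_le_add (hcB w) (((M w).le_opNorm z).trans ?_))
    gcongr; exact hMB w
  have h3 : ‖M w‖ ≤ D := (hMB w).trans (by simp only [D]; nlinarith [norm_nonneg z0])
  have hk := kap_nonneg K z w
  have hi1 : 0 ≤ i1 w := hk.trans a
  have hi2 : 0 ≤ i2 w := (norm_nonneg _).trans b
  constructor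
  · refine (kder_norm K c M z w).trans (add_le_add ?_ ?_)
    · exact mul_le_mul a h3 (norm_nonneg _) hi1
    · exact mul_le_mul b h2 (norm_nonneg _) hi2
  · rw [norm_smul, Real.norm_of_nonneg hk]
    have := mul_le_mul a h2 (norm_nonneg _) hi1
    have : 0 ≤ i2 w * D := by positivity
    linarith

lemma kint_integrable (K : Set E) {c : E → G} {M : E → E →L[ℝ] G} {B : ℝ}
    (hc : StronglyMeasurable c) (hM : StronglyMeasurable M) (hcB : ∀ w, ‖c w‖ ≤ B)
    (hMB : ∀ w, ‖M w‖ ≤ B) (z : E) : Integrable (fun w => kap K z w • (c w + M w z)) := by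
  obtain ⟨g, hg, h⟩ := kder_bound K hcB hMB z
  exact hg.mono' (kfun_meas K hc hM z)
    (Eventually.of_forall fun w => (h z (mem_ball_self one_pos) w).2)

lemma kint_hasFDerivAt (K : Set E) {c : E → G} {M : E → E →L[ℝ] G} {B : ℝ}
    (hc : StronglyMeasurable c) (hM : StronglyMeasurable M) (hcB : ∀ w, ‖c w‖ ≤ B)
    (hMB : ∀ w, ‖M w‖ ≤ B) (z : E) :
    HasFDerivAt (fun z => ∫ w, kap K z w • (c w + M w z)) (∫ w, kder K c M z w) z := by
  obtain ⟨g, hg, h⟩ := kder_bound K hcB hMB z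
  apply hasFDerivAt_integral_of_dominated_of_fderiv_le (ball_mem_nhds z one_pos) (bound := g)
    (F := fun z w => kap K z w • (c w + M w z)) (F' := fun z w => kder K c M z w)
  · exact Eventually.of_forall fun z => kfun_meas K hc hM z
  · exact kint_integrable K hc hM hcB hMB z
  · exact kder_meas K hc hM z
  · exact Eventually.of_forall fun w x hx => (h x hx w).1
  · exact hg
  · exact Eventually.of_forall fun w x hx => kder_hasFDerivAt K c M x w

lemma kint_contDiff (K : Set E) {c : E → G} {M : E → E →L[ℝ] G} {B : ℝ}
    (hc : StronglyMeasurable c) (hM : StronglyMeasurable M) (hcB : ∀ w, ‖c w‖ ≤ B)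
    (hMB : ∀ w, ‖M w‖ ≤ B) :
    ContDiff ℝ 1 (fun z => ∫ w, kap K z w • (c w + M w z)) := by
  rw [contDiff_one_iff_fderiv]
  have h := fun z => kint_hasFDerivAt K hc hM hcB hMB z
  refine ⟨fun z => (h z).differentiableAt, ?_⟩
  have e : fderiv ℝ (fun z => ∫ w, kap K z w • (c w + M w z)) = fun z => ∫ w, kder K c M z w := by
    funext z; exact (h z).fderiv
  rw [e, continuous_iff_continuousAt]
  intro z
  obtain ⟨g, hg, hb⟩ := kder_bound K hcB hMB z
  apply MeasureTheory.continuousAt_of_dominated (bound := g) (F := fun z w => kder K c M z w)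
  · exact Eventually.of_forall fun z => kder_meas K hc hM z
  · filter_upwards [ball_mem_nhds z one_pos] with x hx
    exact Eventually.of_forall fun w => (hb x hx w).1
  · exact hg
  · exact Eventually.of_forall fun w => (kder_cont K c M w).continuousAt

end param

/-- Total mass of the kernel. -/
def kmass {n : ℕ} (K : Set (EuclideanSpace ℝ (Fin n))) (z : EuclideanSpace ℝ (Fin n)) : ℝ :=
  ∫ w, kap K z w

lemma kmass_hasFDerivAt (K : Set E) (z : E) :
    ∃ L : E →L[ℝ] ℝ, HasFDerivAt (kmass K) L z ∧ ‖L‖ ≤ ∫ w, ‖kapg K z w‖ := by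
  have h := kint_hasFDerivAt K (c := fun _ => (1:ℝ)) (M := fun _ => 0) (B := 1)
    stronglyMeasurable_const stronglyMeasurable_const (by simp) (by simp) z
  refine ⟨∫ w, kder K (fun _ => (1:ℝ)) (fun _ => 0) z w, ?_, ?_⟩
  · have e : kmass K = fun z => ∫ w, kap K z w • ((1:ℝ) + (0 : E →L[ℝ] ℝ) z) := by
      funext z; simp [kmass]
    rw [e]
    exact h
  · refine norm_integral_le_of_norm_le (kapg_integrable K z) (Eventually.of_forall fun w => ?_)
    exact (kder_norm _ _ _ _ _).trans (by simp)

lemma kmass_contDiff (K : Set E) : ContDiff ℝ 1 (kmass K) := by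
  have h := kint_contDiff K (c := fun _ => (1:ℝ)) (M := fun _ => 0) (B := 1)
    stronglyMeasurable_const stronglyMeasurable_const (by simp) (by simp)
  convert h using 1
  funext z; simp [kmass]

lemma kmass_lower (K : Set E) (z : E) :
    1 / 4 * infDist z K ^ 4 * volume.real (ball z (infDist z K / 8)) ≤ kmass K z := by
  have h1 : ∫ w in ball z (infDist z K / 8), kap K z w ≤ kmass K z :=
    setIntegral_le_integral (kap_integrable K z) (Eventually.of_forall fun w => kap_nonneg _ _ _)
  have h2 : ∫ w in ball z (infDist z K / 8), (1 / 4 * infDist z K ^ 4)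
      ≤ ∫ w in ball z (infDist z K / 8), kap K z w := by
    apply setIntegral_mono_on (integrableOn_const measure_ball_lt_top.ne)
      (kap_integrable K z).integrableOn measurableSet_ball
    intro w hw
    rw [mem_ball, dist_comm, dist_eq_norm] at hw
    exact kap_lower hw.le
  rw [setIntegral_const, smul_eq_mul, mul_comm] at h2
  linarith

lemma kapg_upper (K : Set E) (z : E) :
    ∫ w, ‖kapg K z w‖ ≤ 64 * infDist z K ^ 3 * volume.real (closedBall z (infDist z K / 3)) := by
  have h2 : ∫ w, ‖kapg K z w‖
      ≤ ∫ w, (closedBall z (infDist z K / 3)).indicator (fun _ => 64 * infDist z K ^ 3) w := by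
    apply integral_mono (kapg_integrable K z) (integrable_ind _ _ _)
    intro w
    by_cases h : ‖z - w‖ < infDist w K / 4
    · obtain ⟨a, b, c⟩ := kap_geo h
      have hw : w ∈ closedBall z (infDist z K / 3) := by
        rw [mem_closedBall, dist_comm, dist_eq_norm]; exact b
      simp only [indicator_of_mem hw]
      exact kapg_bound
    · simp only [kapg_zero h, norm_zero]
      have := infDist_nonneg (x := z) (s := K)
      apply indicator_nonneg; intros; positivity
  rw [integral_indicator measurableSet_closedBall, setIntegral_const, smul_eq_mul, mul_comm] at h2
  exact h2

lemma kmass_pos {K : Set E} {z : E} (hz : 0 < infDist z K) : 0 < kmass K z := by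
  refine lt_of_lt_of_le ?_ (kmass_lower K z)
  have : 0 < volume.real (ball z (infDist z K / 8)) :=
    ENNReal.toReal_pos (measure_ball_pos _ _ (by positivity)).ne' measure_ball_lt_top.ne
  positivity

lemma kmass_kapg (n : ℕ) : ∃ C : ℝ, 0 ≤ C ∧ ∀ (K : Set (EuclideanSpace ℝ (Fin n))) (z : EuclideanSpace ℝ (Fin n)),
    infDist z K * ∫ w, ‖kapg K z w‖ ≤ C * kmass K z := by
  refine ⟨256 * 8 ^ n, by positivity, fun K z => ?_⟩
  have h0 := infDist_nonneg (x := z) (s := K)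
  rcases h0.eq_or_lt with h | h
  · rw [← h, zero_mul]
    have : 0 ≤ kmass K z := integral_nonneg fun w => kap_nonneg _ _ _
    positivity
  set d := infDist z K
  have h1 := kmass_lower K z
  have h2 := kapg_upper K z
  have e1 : volume.real (ball z d) = 8 ^ n * volume.real (ball z (d / 8)) := by
    have := Measure.addHaar_ball_mul_of_pos (volume : Measure (EuclideanSpace ℝ (Fin n))) z
      (r := 8) (by norm_num) (d / 8)
    rw [show 8 * (d / 8) = d by ring] at this
    rw [Measure.real, Measure.real, this]
    rw [Measure.addHaar_ball_center, ENNReal.toReal_mul, ENNReal.toReal_ofReal (by positivity)]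
    simp [Measure.addHaar_ball_center]
  have e2 : volume.real (closedBall z (d / 3)) ≤ volume.real (ball z d) :=
    measureReal_mono (closedBall_subset_ball (by linarith)) measure_ball_lt_top.ne
  calc d * ∫ w, ‖kapg K z w‖ ≤ d * (64 * d ^ 3 * volume.real (closedBall z (d / 3))) := by gcongr
    _ ≤ d * (64 * d ^ 3 * volume.real (ball z d)) := by gcongr
    _ = 256 * 8 ^ n * (1 / 4 * d ^ 4 * volume.real (ball z (d / 8))) := by rw [e1]; ring
    _ ≤ _ := by gcongr

end whitney_kernel


/-! ### Whitney extension theorem (class `C¹`, vanishing values) -/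

section whitney
variable {n : ℕ}
local notation "E" => EuclideanSpace ℝ (Fin n)

lemma exists_sel {K : Set E} (hne : K.Nonempty) :
    ∃ (D : ℕ → E) (idx : E → ℕ), Measurable idx ∧ (∀ k, D k ∈ K) ∧
      ∀ w, 0 < infDist w K → dist w (D (idx w)) < 2 * infDist w K := by
  classical
  haveI : Nonempty K := hne.to_subtype
  let D : ℕ → E := fun k => (TopologicalSpace.denseSeq K k : E)
  have hp : ∀ w : E, ∃ k, dist w (D k) < 2 * infDist w K ∨ infDist w K ≤ 0 := by
    intro w
    rcases le_or_gt (infDist w K) 0 with h | h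
    · exact ⟨0, Or.inr h⟩
    · obtain ⟨y, hy, hlt⟩ := (infDist_lt_iff hne (x := w) (r := 2 * infDist w K)).1 (by linarith)
      have hd := TopologicalSpace.denseRange_denseSeq K
      have ho : IsOpen {p : K | dist w (p : E) < 2 * infDist w K} := by
        apply isOpen_lt _ continuous_const
        fun_prop
      obtain ⟨k, hk⟩ := hd.exists_mem_open ho ⟨⟨y, hy⟩, hlt⟩
      exact ⟨k, Or.inl hk⟩
  refine ⟨D, fun w => Nat.find (hp w), ?_, fun k => (TopologicalSpace.denseSeq K k).2, ?_⟩
  · apply measurable_find hp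
    intro k
    have hc := continuous_infDist_pt K
    have s1 : MeasurableSet {w : E | dist w (D k) < 2 * infDist w K} :=
      (isOpen_lt (by fun_prop) (by fun_prop)).measurableSet
    have s2 : MeasurableSet {w : E | infDist w K ≤ 0} :=
      (isClosed_le hc continuous_const).measurableSet
    exact s1.union s2
  · intro w hw
    rcases Nat.find_spec (hp w) with h | h
    · exact h
    · linarith

/-- The Whitney extension. -/
def wfun {n : ℕ} (K : Set (EuclideanSpace ℝ (Fin n)))
    (c : EuclideanSpace ℝ (Fin n) → EuclideanSpace ℝ (Fin n))
    (M : EuclideanSpace ℝ (Fin n) → EuclideanSpace ℝ (Fin n) →L[ℝ] EuclideanSpace ℝ (Fin n))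
    (z : EuclideanSpace ℝ (Fin n)) : EuclideanSpace ℝ (Fin n) :=
  (kmass K z)⁻¹ • ∫ w, kap K z w • (c w + M w z)

lemma wfun_zero {K : Set E} {c : E → E} {M : E → E →L[ℝ] E} {z : E} (hz : z ∈ K) :
    wfun K c M z = 0 := by
  have h : ∀ w, kap K z w = 0 := by
    intro w
    apply kap_zero
    intro h
    have := (kap_geo h).2.2
    rw [infDist_zero_of_mem hz] at this
    exact lt_irrefl _ this
  simp [wfun, h]

lemma wfun_contDiffAt {K : Set E} {c : E → E} {M : E → E →L[ℝ] E} {B : ℝ}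
    (hc : StronglyMeasurable c) (hM : StronglyMeasurable M) (hcB : ∀ w, ‖c w‖ ≤ B)
    (hMB : ∀ w, ‖M w‖ ≤ B) {z : E} (hz : 0 < infDist z K) :
    ContDiffAt ℝ 1 (wfun K c M) z := by
  unfold wfun
  exact ((kmass_contDiff K).contDiffAt.inv (kmass_pos hz).ne').smul
    (kint_contDiff K hc hM hcB hMB).contDiffAt

lemma wfun_est {K : Set E} {c : E → E} {M : E → E →L[ℝ] E} {B C : ℝ}
    (hc : StronglyMeasurable c) (hM : StronglyMeasurable M) (hcB : ∀ w, ‖c w‖ ≤ B)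
    (hMB : ∀ w, ‖M w‖ ≤ B) {z : E} (hz : 0 < infDist z K) (c0 : E) (M0 : E →L[ℝ] E) {a b : ℝ}
    (hC : infDist z K * ∫ w, ‖kapg K z w‖ ≤ C * kmass K z) (ha : 0 ≤ a) (hb : 0 ≤ b)
    (h : ∀ w, ‖z - w‖ < infDist w K / 4 → ‖M w - M0‖ ≤ a ∧
      ‖c w + M w z - (c0 + M0 z)‖ ≤ b) :
    ‖wfun K c M z - (c0 + M0 z)‖ ≤ b ∧
    ‖fderiv ℝ (wfun K c M) z - M0‖ ≤ a + 2 * C * (b / infDist z K) := by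
  have hm := kmass_pos hz
  set c' : E → E := fun w => c w - c0
  set M' : E → E →L[ℝ] E := fun w => M w - M0
  set B' := B + ‖c0‖ + ‖M0‖
  have hc' : StronglyMeasurable c' := hc.sub stronglyMeasurable_const
  have hM' : StronglyMeasurable M' := hM.sub stronglyMeasurable_const
  have hcB' : ∀ w, ‖c' w‖ ≤ B' := fun w => (norm_sub_le _ _).trans (by
    have := hcB w; have := norm_nonneg M0; simp only [B']; linarith)
  have hMB' : ∀ w, ‖M' w‖ ≤ B' := fun w => (norm_sub_le _ _).trans (by
    have := hMB w; have := norm_nonneg c0; simp only [B']; linarith)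
  set H : E → E := fun z => ∫ w, kap K z w • (c' w + M' w z) with hH
  have hHd := kint_hasFDerivAt K hc' hM' hcB' hMB' z
  set H' := ∫ w, kder K c' M' z w with hH'
  have hS : ∀ w, ‖z - w‖ < infDist w K / 4 → ‖c' w + M' w z‖ ≤ b := by
    intro w hw
    have e : c' w + M' w z = c w + M w z - (c0 + M0 z) := by
      simp only [c', M', ContinuousLinearMap.sub_apply]; abel
    rw [e]; exact (h w hw).2
  have hHn : ‖H z‖ ≤ kmass K z * b := by
    rw [kmass, ← integral_mul_const]
    refine norm_integral_le_of_norm_le ((kap_integrable K z).mul_const b)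
      (Eventually.of_forall fun w => ?_)
    by_cases hw : ‖z - w‖ < infDist w K / 4
    · rw [norm_smul, Real.norm_of_nonneg (kap_nonneg _ _ _)]
      exact mul_le_mul_of_nonneg_left (hS w hw) (kap_nonneg _ _ _)
    · simp [kap_zero hw]
  set I := ∫ w, ‖kapg K z w‖ with hI
  have hH'n : ‖H'‖ ≤ kmass K z * a + I * b := by
    have e : kmass K z * a + I * b = ∫ w, (kap K z w * a + ‖kapg K z w‖ * b) := by
      rw [integral_add ((kap_integrable K z).mul_const a) ((kapg_integrable K z).mul_const b),
        integral_mul_const, integral_mul_const]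
      rfl
    rw [e]
    refine norm_integral_le_of_norm_le (((kap_integrable K z).mul_const a).add
      ((kapg_integrable K z).mul_const b)) (Eventually.of_forall fun w => ?_)
    refine (kder_norm _ _ _ _ _).trans ?_
    by_cases hw : ‖z - w‖ < infDist w K / 4
    · exact add_le_add (mul_le_mul_of_nonneg_left (h w hw).1 (kap_nonneg _ _ _))
        (mul_le_mul_of_nonneg_left (hS w hw) (norm_nonneg _))
    · simp [kap_zero hw, kapg_zero hw]
  have hrep : ∀ y, 0 < kmass K y → wfun K c M y = (kmass K y)⁻¹ • H y + (c0 + M0 y) := by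
    intro y hy
    have e : ∫ w, kap K y w • (c w + M w y) = H y + kmass K y • (c0 + M0 y) := by
      have e2 : kmass K y • (c0 + M0 y) = ∫ w, kap K y w • (c0 + M0 y) := by
        rw [integral_smul_const]; rfl
      have i1 := kint_integrable K hc' hM' hcB' hMB' y
      have i2 : Integrable fun w => kap K y w • (c0 + M0 y) := (kap_integrable K y).smul_const _
      rw [e2, hH, ← integral_add i1 i2]
      congr 1
      funext w
      rw [← smul_add]
      congr 1
      simp only [c', M', ContinuousLinearMap.sub_apply]; abel
    rw [wfun, e, smul_add, smul_smul, inv_mul_cancel₀ hy.ne', one_smul]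
  have hI0 : 0 ≤ I := integral_nonneg fun w => norm_nonneg _
  constructor
  · rw [hrep z hm, add_sub_cancel_right, norm_smul, norm_inv, Real.norm_of_nonneg hm.le,
      inv_mul_le_iff₀ hm]
    exact hHn
  · obtain ⟨L, hL, hLn⟩ := kmass_hasFDerivAt K z
    have hd1 : HasFDerivAt (fun y => (kmass K y)⁻¹) (-((kmass K z) ^ 2)⁻¹ • L) z :=
      (hasDerivAt_inv hm.ne').comp_hasFDerivAt z hL
    have hd2 : HasFDerivAt (fun y => (kmass K y)⁻¹ • H y + (c0 + M0 y))
        (((kmass K z)⁻¹ • H' + (-((kmass K z) ^ 2)⁻¹ • L).smulRight (H z)) + M0) z :=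
      (hd1.smul hHd).add (M0.hasFDerivAt.const_add c0)
    have hev : wfun K c M =ᶠ[𝓝 z] fun y => (kmass K y)⁻¹ • H y + (c0 + M0 y) := by
      have := (kmass_contDiff K).continuous.continuousAt.eventually (lt_mem_nhds hm)
      filter_upwards [this] with y hy using hrep y hy
    rw [(hd2.congr_of_eventuallyEq hev).fderiv, add_sub_cancel_right]
    have n1 : ‖(kmass K z)⁻¹ • H'‖ ≤ a + (I / kmass K z) * b := by
      rw [norm_smul, norm_inv, Real.norm_of_nonneg hm.le, inv_mul_le_iff₀ hm]
      calc _ ≤ _ := hH'n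
        _ = _ := by field_simp
    have n2 : ‖(-((kmass K z) ^ 2)⁻¹ • L).smulRight (H z)‖ ≤ (I / kmass K z) * b := by
      rw [ContinuousLinearMap.norm_smulRight_apply, norm_smul, norm_neg, norm_inv, norm_pow,
        Real.norm_of_nonneg hm.le]
      calc _ ≤ (kmass K z ^ 2)⁻¹ * I * (kmass K z * b) := by gcongr
        _ = _ := by field_simp
    have n3 : I / kmass K z ≤ C / infDist z K := by
      rw [div_le_div_iff₀ hm hz]; linarith
    have n4 : (I / kmass K z) * b ≤ (C / infDist z K) * b := by gcongr
    refine (norm_add_le _ _).trans ?_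
    have e : 2 * C * (b / infDist z K) = (C / infDist z K) * b + (C / infDist z K) * b := by ring
    linarith

theorem whitney_zero {K : Set E} (hK : IsCompact K) (hne : K.Nonempty) {A : E → E →L[ℝ] E}
    (hA : ContinuousOn A K)
    (hcomp : ∀ ε > 0, ∃ δ > 0, ∀ x ∈ K, ∀ y ∈ K, ‖y - x‖ < δ → ‖A x (y - x)‖ ≤ ε * ‖y - x‖) :
    ∃ F : E → E, ContDiff ℝ 1 F ∧ (∀ x ∈ K, F x = 0) ∧ ∀ x ∈ K, fderiv ℝ F x = A x := by
  obtain ⟨D, idx, hidx, hDK, hD⟩ := exists_sel hne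
  obtain ⟨B0, hB0⟩ := hK.exists_bound_of_continuousOn hA
  obtain ⟨R, hR⟩ := hK.exists_bound_of_continuousOn continuousOn_id
  set q : E → E := fun w => D (idx w) with hq
  have hqK : ∀ w, q w ∈ K := fun w => hDK _
  set c : E → E := fun w => -(A (q w) (q w)) with hcdef
  set M : E → E →L[ℝ] E := fun w => A (q w) with hMdef
  have hc : StronglyMeasurable c := by
    have : StronglyMeasurable (fun k : ℕ => -(A (D k) (D k))) := StronglyMeasurable.of_discrete
    exact this.comp_measurable hidx
  have hM : StronglyMeasurable M := by
    have : StronglyMeasurable (fun k : ℕ => A (D k)) := StronglyMeasurable.of_discrete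
    exact this.comp_measurable hidx
  have hB00 : 0 ≤ B0 := (norm_nonneg _).trans (hB0 _ (hqK 0))
  have hR0 : 0 ≤ R := (norm_nonneg _).trans (hR _ (hqK 0))
  set B := B0 * R + B0
  have hcB : ∀ w, ‖c w‖ ≤ B := fun w => by
    simp only [c, norm_neg]
    have h1 := (A (q w)).le_opNorm (q w)
    have h2 : ‖A (q w)‖ * ‖q w‖ ≤ B0 * R :=
      mul_le_mul (hB0 _ (hqK w)) (hR _ (hqK w)) (norm_nonneg _) hB00
    simp only [B]; linarith
  have hMB : ∀ w, ‖M w‖ ≤ B := fun w => (hB0 _ (hqK w)).trans (by simp only [B]; nlinarith)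
  have hKc := hK.isClosed
  have hpos : ∀ z, z ∉ K → 0 < infDist z K := fun z hz =>
    (hKc.notMem_iff_infDist_pos hne).1 hz
  have huc := Metric.uniformContinuousOn_iff.1 (hK.uniformContinuousOn_of_continuous hA)
  have hest : ∀ ε > 0, ∃ η > 0, ∀ x ∈ K, ∀ z, ‖z - x‖ < η → ∀ w, ‖z - w‖ < infDist w K / 4 →
      ‖M w - A x‖ ≤ ε ∧ ‖c w + M w z - (-(A x x) + A x z)‖ ≤ ε * ‖z - x‖ := by
    intro ε hε
    obtain ⟨δ1, hδ1, h1⟩ := huc (ε / 8) (by positivity)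
    obtain ⟨δ2, hδ2, h2⟩ := hcomp (ε / 8) (by positivity)
    refine ⟨min δ1 δ2 / 4, by positivity, fun x hx z hz w hw => ?_⟩
    have hz1 : 4 * ‖z - x‖ < δ1 := by linarith [min_le_left δ1 δ2]
    have hz2 : 4 * ‖z - x‖ < δ2 := by linarith [min_le_right δ1 δ2]
    obtain ⟨g1, g2, g3⟩ := kap_geo hw
    have g4 : infDist z K ≤ ‖z - x‖ := by
      have := infDist_le_dist_of_mem (x := z) hx
      rwa [dist_eq_norm] at this
    have g5 := hD w (by linarith [norm_nonneg (z - w)])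
    rw [dist_eq_norm] at g5
    set p := q w with hp
    change ‖w - p‖ < _ at g5
    have g6 : ‖z - p‖ ≤ 3 * ‖z - x‖ := by
      have := norm_sub_le_norm_sub_add_norm_sub z w p
      linarith
    have g7 : ‖p - x‖ ≤ 4 * ‖z - x‖ := by
      have := norm_sub_le_norm_sub_add_norm_sub p z x
      rw [norm_sub_rev p z] at this
      linarith
    have g8 := h1 p (hqK w) x hx (by rw [dist_eq_norm]; linarith)
    rw [dist_eq_norm] at g8
    have g9 := h2 x hx p (hqK w) (by linarith)
    refine ⟨by change ‖A p - A x‖ ≤ ε; linarith, ?_⟩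
    have e : c w + M w z - (-(A x x) + A x z) = (A p - A x) (z - p) - A x (p - x) := by
      simp only [c, M, ← hp, map_sub, ContinuousLinearMap.sub_apply]; abel
    rw [e]
    calc _ ≤ ‖(A p - A x) (z - p)‖ + ‖A x (p - x)‖ := norm_sub_le _ _
      _ ≤ ε / 8 * (3 * ‖z - x‖) + ε / 8 * (4 * ‖z - x‖) := by
          apply add_le_add
          · exact ((A p - A x).le_opNorm _).trans
              (mul_le_mul g8.le g6 (norm_nonneg _) (by positivity))
          · exact g9.trans (by gcongr)
      _ ≤ ε * ‖z - x‖ := by nlinarith [norm_nonneg (z - x)]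
  obtain ⟨C, hC0, hC⟩ := kmass_kapg n
  set F := wfun K c M with hF
  have hF0 : ∀ x ∈ K, F x = 0 := fun x hx => wfun_zero hx
  have hFK : ∀ x ∈ K, HasFDerivAt F (A x) x := by
    intro x hx
    rw [hasFDerivAt_iff_isLittleO, Asymptotics.isLittleO_iff]
    intro ε hε
    obtain ⟨η, hη, h1⟩ := hest ε hε
    obtain ⟨δ, hδ, h2⟩ := hcomp ε hε
    filter_upwards [ball_mem_nhds x hη, ball_mem_nhds x hδ] with z hz1 hz2
    rw [mem_ball, dist_eq_norm] at hz1 hz2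
    rw [hF0 x hx, sub_zero]
    by_cases hzK : z ∈ K
    · rw [hF0 z hzK, zero_sub, norm_neg]
      exact h2 x hx z hzK hz2
    · have := (wfun_est (C := C) hc hM hcB hMB (hpos z hzK) (-(A x x)) (A x) (hC K z) hε.le
        (by positivity) (h1 x hx z hz1)).1
      have e : A x (z - x) = -(A x x) + A x z := by rw [map_sub]; abel
      rw [e]; exact this
  have hFo : ∀ z, z ∉ K → ContDiffAt ℝ 1 F z := fun z hz =>
    wfun_contDiffAt hc hM hcB hMB (hpos z hz)
  refine ⟨F, ?_, hF0, fun x hx => (hFK x hx).fderiv⟩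
  rw [contDiff_one_iff_fderiv]
  constructor
  · intro z
    by_cases hz : z ∈ K
    · exact (hFK z hz).differentiableAt
    · exact (hFo z hz).differentiableAt one_ne_zero
  · rw [continuous_iff_continuousAt]
    intro x
    by_cases hx : x ∈ K
    · rw [Metric.continuousAt_iff]
      intro ε hε
      set ε' := ε / (2 * (2 + 2 * C)) with hε'
      have hε'0 : 0 < ε' := by positivity
      obtain ⟨η, hη, h1⟩ := hest ε' hε'0
      obtain ⟨δ, hδ, h2⟩ := huc ε' hε'0
      refine ⟨min η (δ / 2), by positivity, fun {z} hz => ?_⟩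
      have hz1 : dist z x < η := hz.trans_le (min_le_left _ _)
      have hz2 : dist z x < δ / 2 := hz.trans_le (min_le_right _ _)
      have hlt : ε' * (2 + 2 * C) < ε := by
        have : ε' * (2 + 2 * C) = ε / 2 := by rw [hε']; field_simp
        linarith
      rw [(hFK x hx).fderiv]
      by_cases hzK : z ∈ K
      · rw [(hFK z hzK).fderiv]
        have := h2 z hzK x hx (by linarith)
        nlinarith
      · obtain ⟨y, hy, hyd⟩ := hK.exists_infDist_eq_dist hne z
        have h3 : infDist z K ≤ dist z x := infDist_le_dist_of_mem hx
        have hyn : ‖z - y‖ = infDist z K := by rw [hyd, dist_eq_norm]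
        have h4 := (wfun_est (C := C) hc hM hcB hMB (hpos z hzK) (-(A y y)) (A y) (hC K z) hε'0.le
          (by positivity) (h1 y hy z (by rw [hyn]; linarith))).2
        rw [hyn, mul_div_assoc, div_self (hpos z hzK).ne', mul_one] at h4
        have h5 : dist y x < δ := by
          have := dist_triangle y z x
          rw [dist_comm y z, ← hyd] at this
          linarith
        have h6 := h2 y hy x hx h5
        have h7 := dist_triangle (fderiv ℝ F z) (A y) (A x)
        rw [dist_eq_norm (fderiv ℝ F z) (A y)] at h7
        nlinarith
    · exact ((hFo x hx).fderiv_right (m := 0) (by norm_num)).continuousAt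

end whitney


/-! ### Conclusion -/

section conclusion
variable {n : ℕ}
local notation "E" => EuclideanSpace ℝ (Fin n)

lemma finrank_ker_aop (A : Matrix (Fin n) (Fin n) ℝ) :
    Module.finrank ℝ (LinearMap.ker (aop A : E →ₗ[ℝ] E))
      = Module.finrank ℝ (LinearMap.ker (Matrix.toLin' A)) := by
  have e : LinearMap.ker (Matrix.toLin' A)
      = (LinearMap.ker (aop A : E →ₗ[ℝ] E)).map
        ((WithLp.linearEquiv 2 ℝ (Fin n → ℝ)).toLinearMap) := by
    ext v
    simp only [LinearMap.mem_ker, Submodule.mem_map, Matrix.toLin'_apply]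
    constructor
    · intro h
      refine ⟨WithLp.toLp 2 v, ?_, rfl⟩
      ext i
      have := congrFun h i
      simpa [aop_apply, Matrix.mulVec, dotProduct] using this
    · rintro ⟨y, hy, rfl⟩
      funext i
      have : (aop A y) i = 0 := by
        have h2 : aop A y = 0 := hy
        rw [h2]; rfl
      rw [aop_apply] at this
      simpa [Matrix.mulVec, dotProduct] using this
  rw [e, LinearEquiv.finrank_map_eq]

lemma exists_surj_data (f : E →L[ℝ] E) {m : ℕ} (hf : Module.finrank ℝ (LinearMap.ker (f : E →ₗ[ℝ] E)) = m) :
    ∃ (P : E →L[ℝ] EuclideanSpace ℝ (Fin (n - m))) (S : EuclideanSpace ℝ (Fin (n - m)) →L[ℝ] E),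
      (P.comp f).comp S = ContinuousLinearMap.id ℝ _ := by
  have h1 := LinearMap.finrank_range_add_finrank_ker (f : E →ₗ[ℝ] E)
  rw [hf, finrank_euclideanSpace_fin] at h1
  have h2 : Module.finrank ℝ (LinearMap.range (f : E →ₗ[ℝ] E))
      = Module.finrank ℝ (EuclideanSpace ℝ (Fin (n - m))) := by
    rw [finrank_euclideanSpace_fin]; omega
  let e := LinearEquiv.ofFinrankEq _ _ h2
  obtain ⟨p, hp⟩ := LinearMap.exists_leftInverse_of_injective
    (LinearMap.range (f : E →ₗ[ℝ] E)).subtype (Submodule.ker_subtype _)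
  let P := e.toLinearMap ∘ₗ p
  have hs : Function.Surjective (P ∘ₗ (f : E →ₗ[ℝ] E)) := by
    intro y
    obtain ⟨x, hx⟩ := (e.symm y).2
    refine ⟨x, ?_⟩
    have h3 := LinearMap.congr_fun hp (e.symm y)
    have h4 : p (f x) = e.symm y := by
      rw [show f x = ((e.symm y : LinearMap.range (f : E →ₗ[ℝ] E)) : E) from hx]
      exact h3
    change e (p (f x)) = y
    rw [h4]; simp
  obtain ⟨S, hS⟩ := LinearMap.exists_rightInverse_of_surjective _ (LinearMap.range_eq_top.2 hs)
  refine ⟨LinearMap.toContinuousLinearMap P, LinearMap.toContinuousLinearMap S, ?_⟩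
  ext1 y
  exact LinearMap.congr_fun hS y

theorem main_aux (hn : 2 ≤ n)
    (Ω : Set E) (hΩopen : IsOpen Ω) (u : E → ℝ) (hu : IsObstacleSol Ω u)
    (m : ℕ) (x0 : E) (hx0 : x0 ∈ singularStratum Ω u m) :
    ∃ U : Set E, IsOpen U ∧ x0 ∈ U ∧
      ∃ M : Set E, IsC1SubmanifoldOfDim m M ∧ singularStratum Ω u m ∩ U ⊆ M := by
  have hxΩ : x0 ∈ Ω := hx0.1.1.2
  obtain ⟨A0, hb, hA0⟩ := hx0.2
  obtain ⟨r, hr, K, hK, A, hP, hAc, hcomp, hall⟩ := blowup_data (by omega) hΩopen hu hxΩ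
  obtain ⟨hx0K, hAx0⟩ := hall x0 (by simpa using hr) A0 hb
  obtain ⟨F, hF, hF0, hFd⟩ := whitney_zero hK ⟨x0, hx0K⟩ hAc hcomp
  obtain ⟨P, S, hPS⟩ := exists_surj_data (aop A0) ((finrank_ker_aop A0).trans hA0)
  set f : E → EuclideanSpace ℝ (Fin (n - m)) := fun z => P (F z) with hf
  have hfC : ContDiff ℝ 1 f := P.contDiff.comp hF
  have hfd : ∀ z, fderiv ℝ f z = P.comp (fderiv ℝ F z) := fun z =>
    (P.hasFDerivAt.comp z ((hF.differentiable one_ne_zero) z).hasFDerivAt).fderiv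
  set g : E → (EuclideanSpace ℝ (Fin (n - m)) →L[ℝ] EuclideanSpace ℝ (Fin (n - m))) :=
    fun z => (fderiv ℝ f z).comp S with hg
  have hgc : Continuous g := by
    have := hfC.continuous_fderiv one_ne_zero
    exact this.clm_comp continuous_const
  set V : Set E := {z | IsUnit (g z)} with hV
  have hVo : IsOpen V := Units.isOpen.preimage hgc
  have hx0V : x0 ∈ V := by
    have : g x0 = 1 := by
      simp only [hg, hfd, hFd x0 hx0K, hAx0]
      exact hPS
    change IsUnit (g x0)
    rw [this]; exact isUnit_one
  have hsurj : ∀ z ∈ V, Function.Surjective (fderiv ℝ f z) := by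
    intro z hz y
    obtain ⟨v, hv⟩ := hz
    refine ⟨S ((↑v⁻¹ : EuclideanSpace ℝ (Fin (n - m)) →L[ℝ] EuclideanSpace ℝ (Fin (n - m))) y), ?_⟩
    have h1 := v.mul_inv
    rw [hv] at h1
    exact congrArg (fun L : EuclideanSpace ℝ (Fin (n - m)) →L[ℝ] EuclideanSpace ℝ (Fin (n - m)) => L y) h1
  refine ⟨V ∩ ball x0 r, hVo.inter isOpen_ball, ⟨hx0V, mem_ball_self hr⟩, {z ∈ V | f z = 0}, ?_, ?_⟩
  · intro y hy
    refine ⟨V, hVo, hy.1, f, hfC.contDiffOn, ?_, fun z hz => hsurj z hz.2⟩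
    ext z
    constructor
    · rintro ⟨h, -⟩; exact h
    · intro h; exact ⟨h, h.1⟩
  · rintro x ⟨hx, hxV, hxr⟩
    obtain ⟨-, B, hB, -⟩ := hx
    obtain ⟨hxK, -⟩ := hall x hxr B hB
    exact ⟨hxV, by simp [hf, hF0 x hxK]⟩

end conclusion


/-- C¹ stratification of the singular set: for every
`m ∈ {0, …, n-1}`, the stratum `Σ_m` is locally contained in an `m`-dimensional
manifold of class `C¹`. -/
theorem singular_set_C1_stratification
    {n : ℕ} (hn : 2 ≤ n)
    (Ω : Set (EuclideanSpace ℝ (Fin n))) (hΩopen : IsOpen Ω)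
    (u : EuclideanSpace ℝ (Fin n) → ℝ) (hu : IsObstacleSol Ω u)
    (m : ℕ) (hm : m ≤ n - 1)
    (x0 : EuclideanSpace ℝ (Fin n)) (hx0 : x0 ∈ singularStratum Ω u m) :
    ∃ U : Set (EuclideanSpace ℝ (Fin n)), IsOpen U ∧ x0 ∈ U ∧
      ∃ M : Set (EuclideanSpace ℝ (Fin n)),
        IsC1SubmanifoldOfDim m M ∧ singularStratum Ω u m ∩ U ⊆ M := by
  exact main_aux hn Ω hΩopen u hu m x0 hx0
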